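/- arXiv:2110.07286 — 2 statements merged into one kernel-verified Lean document; each statement's English description precedes it below -/
import Mathlib

section
/- Let k ≥ 2 be an integer and set d = 2^{k−2} + 1. Then for any mass μ on ℝ^d there exists an arrangement of k affine hyperplanes in ℝ^d that equiparts μ. -/
open MeasureTheory

/-- A mass on `ℝ^d`: a finite Borel measure vanishing on every affine hyperplane
(the zero set of an affine map with nonzero linear part). -/
def IsMass {d : ℕ} (μ : Measure (Fin d → ℝ)) : Prop :=
  IsFiniteMeasure μ ∧
    ∀ f : (Fin d → ℝ) →ᵃ[ℝ] ℝ, f.linear ≠ 0 → μ {x | f x = 0} = 0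

/-- The arrangement of `k` affine hyperplanes given by the affine maps `f t`
equiparts `μ`: every open orthant carries measure `μ(ℝ^d) / 2 ^ k`. -/
def Equiparts {d k : ℕ} (f : Fin k → ((Fin d → ℝ) →ᵃ[ℝ] ℝ))
    (μ : Measure (Fin d → ℝ)) : Prop :=
  ∀ ε : Fin k → Bool,
    μ {x | ∀ t, if ε t then 0 < f t x else f t x < 0} = μ Set.univ / 2 ^ k

namespace GHR
open Finsupp

abbrev Ch (X : Type) := List X →₀ ZMod 2

section chains
variable {X : Type}

noncomputable def ev (u : List X → ZMod 2) : Ch X →ₗ[ZMod 2] ZMod 2 :=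
  Finsupp.linearCombination (ZMod 2) u

noncomputable def cns (x : X) : Ch X →ₗ[ZMod 2] Ch X :=
  Finsupp.lmapDomain (ZMod 2) (ZMod 2) (List.cons x)

noncomputable def bd : List X → Ch X
  | [] => 0
  | x :: l => single l 1 + cns x (bd l)

noncomputable def dd : Ch X →ₗ[ZMod 2] Ch X := Finsupp.linearCombination (ZMod 2) bd

noncomputable def act (f : X → X) : Ch X →ₗ[ZMod 2] Ch X :=
  Finsupp.lmapDomain (ZMod 2) (ZMod 2) (List.map f)

@[simp] lemma ev_single (u : List X → ZMod 2) (l : List X) : ev u (single l 1) = u l := by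
  simp [ev]

@[simp] lemma cns_single (x : X) (l : List X) : cns x (single l 1) = single (x :: l) 1 := by
  simp [cns]

@[simp] lemma act_single (f : X → X) (l : List X) :
    act f (single l 1) = single (l.map f) 1 := by
  simp [act]

@[simp] lemma dd_single (l : List X) : dd (single l 1) = bd l := by
  simp [dd]

lemma chext {M : Type*} [AddCommMonoid M] [Module (ZMod 2) M] {f g : Ch X →ₗ[ZMod 2] M}
    (h : ∀ l, f (single l 1) = g (single l 1)) : f = g := by
  apply Finsupp.lhom_ext
  intro l b
  have : (single l b : Ch X) = b • single l 1 := by simp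
  rw [this, map_smul, map_smul, h]

lemma chadd {M : Type*} [AddCommMonoid M] [Module (ZMod 2) M] (a : M) : a + a = 0 := by
  have : (2 : ZMod 2) • a = a + a := two_smul _ _
  rw [← this]
  have h2 : (2 : ZMod 2) = 0 := by decide
  rw [h2, zero_smul]

lemma dd_cns (x : X) (c : Ch X) : dd (cns x c) = c + cns x (dd c) := by
  have : (dd ∘ₗ cns x) = LinearMap.id + cns x ∘ₗ dd := by
    apply chext; intro l; simp [bd]
  exact congrArg (fun f => f c) this

lemma dd_bd (l : List X) : dd (bd l) = 0 := by
  induction l with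
  | nil => simp [bd]
  | cons x l ih =>
    simp only [bd, map_add, dd_single, dd_cns, ih, map_zero, add_zero]
    exact chadd _

lemma dd_dd (c : Ch X) : dd (dd c) = 0 := by
  have : (dd ∘ₗ dd : Ch X →ₗ[ZMod 2] Ch X) = 0 := by
    apply chext; intro l; simp [dd_bd]
  exact congrArg (fun f => f c) this

lemma act_cns (f : X → X) (x : X) (c : Ch X) : act f (cns x c) = cns (f x) (act f c) := by
  have : (act f ∘ₗ cns x) = cns (f x) ∘ₗ act f := by
    apply chext; intro l; simp
  exact congrArg (fun f => f c) this

lemma bd_map (f : X → X) (l : List X) : bd (l.map f) = act f (bd l) := by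
  induction l with
  | nil => simp [bd]
  | cons x l ih => simp [bd, ih, act_cns]

lemma dd_act (f : X → X) (c : Ch X) : dd (act f c) = act f (dd c) := by
  have : (dd ∘ₗ act f) = act f ∘ₗ dd := by
    apply chext; intro l; simp [bd_map]
  exact congrArg (fun f => f c) this

lemma act_act (f g : X → X) (c : Ch X) : act f (act g c) = act (f ∘ g) c := by
  have : (act f ∘ₗ act g) = act (f ∘ g) := by
    apply chext; intro l; simp
  exact congrArg (fun f => f c) this

lemma act_id (c : Ch X) : act id c = c := by
  have : (act id : Ch X →ₗ[ZMod 2] Ch X) = LinearMap.id := by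
    apply chext; intro l; simp
  exact congrArg (fun f => f c) this

lemma ev_cns (u : List X → ZMod 2) (x : X) (c : Ch X) :
    ev u (cns x c) = ev (fun l => u (x :: l)) c := by
  have : (ev u ∘ₗ cns x) = ev (fun l => u (x :: l)) := by
    apply chext; intro l; simp
  exact congrArg (fun f => f c) this

lemma ev_act (u : List X → ZMod 2) (f : X → X) (c : Ch X) :
    ev u (act f c) = ev (fun l => u (l.map f)) c := by
  have : (ev u ∘ₗ act f) = ev (fun l => u (l.map f)) := by
    apply chext; intro l; simp
  exact congrArg (fun f => f c) this

lemma ev_mul (a : ZMod 2) (u : List X → ZMod 2) (c : Ch X) :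
    ev (fun l => a * u l) c = a * ev u c := by
  have : ev (fun l => a * u l) = a • ev u := by
    apply chext; intro l; simp
  exact congrArg (fun f => f c) this

lemma ev_add (u v : List X → ZMod 2) (c : Ch X) :
    ev (fun l => u l + v l) c = ev u c + ev v c := by
  have : ev (fun l => u l + v l) = ev u + ev v := by
    apply chext; intro l; simp
  exact congrArg (fun f => f c) this

lemma ev_congr {u v : List X → ZMod 2} (h : ∀ l, u l = v l) (c : Ch X) : ev u c = ev v c := by
  rw [funext h]

/-- support induction -/
lemma sup_ind {M : Type*} [AddCommMonoid M] [Module (ZMod 2) M] (φ : Ch X →ₗ[ZMod 2] M)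
    (S : Set (List X)) (N : Submodule (ZMod 2) M) (h : ∀ l ∈ S, φ (single l 1) ∈ N)
    {c : Ch X} (hc : c ∈ Finsupp.supported (ZMod 2) (ZMod 2) S) : φ c ∈ N := by
  rw [Finsupp.supported_eq_span_single] at hc
  have : Submodule.span (ZMod 2) ((fun i => single i (1 : ZMod 2)) '' S) ≤ N.comap φ := by
    rw [Submodule.span_le]
    rintro _ ⟨l, hl, rfl⟩
    exact h l hl
  exact this hc

lemma ev_eq_zero_of_sup {u : List X → ZMod 2} {S : Set (List X)} (h : ∀ l ∈ S, u l = 0)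
    {c : Ch X} (hc : c ∈ Finsupp.supported (ZMod 2) (ZMod 2) S) : ev u c = 0 := by
  have := sup_ind (ev u) S ⊥ (by intro l hl; simp [h l hl]) hc
  simpa using this

/-- prism -/
noncomputable def prl (f g : X → X) : List X → Ch X
  | [] => 0
  | x :: l => single (f x :: g x :: l.map g) 1 + cns (f x) (prl f g l)

noncomputable def pr (f g : X → X) : Ch X →ₗ[ZMod 2] Ch X :=
  Finsupp.linearCombination (ZMod 2) (prl f g)

@[simp] lemma pr_single (f g : X → X) (l : List X) : pr f g (single l 1) = prl f g l := by
  simp [pr]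

lemma pr_cns (f g : X → X) (x : X) (c : Ch X) :
    pr f g (cns x c) = cns (f x) (cns (g x) (act g c)) + cns (f x) (pr f g c) := by
  have : (pr f g ∘ₗ cns x) = cns (f x) ∘ₗ cns (g x) ∘ₗ act g + cns (f x) ∘ₗ pr f g := by
    apply chext; intro l; simp [prl]
  exact congrArg (fun f => f c) this

lemma dd_prl (f g : X → X) (l : List X) :
    dd (prl f g l) = single (l.map f) 1 + single (l.map g) 1 + pr f g (bd l) := by
  induction l with
  | nil => simp only [prl, bd, map_zero, List.map_nil, add_zero]; exact (chadd _).symm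
  | cons x l ih =>
    have h1 : single (f x :: g x :: l.map g) (1 : ZMod 2)
        = cns (f x) (cns (g x) (act g (single l 1))) := by simp
    simp only [prl, map_add, h1, dd_cns, ih, bd, pr_single, pr_cns, dd_act, dd_single,
      List.map_cons]
    simp only [act_single, cns_single]
    have := chadd (single (f x :: List.map g l) (1 : ZMod 2))
    have e : ∀ a b c d e p q : Ch X, b + b = 0 →
        a + (b + c) + (p + (e + b + q)) = e + a + (p + (c + q)) := by
      intro a b c d e p q hb
      calc _ = e + a + (p + (c + q)) + (b + b) := by abel
        _ = _ := by rw [hb, add_zero]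
    exact e _ _ _ 0 _ _ _ this

lemma dd_pr (f g : X → X) (c : Ch X) :
    dd (pr f g c) = act f c + act g c + pr f g (dd c) := by
  have : (dd ∘ₗ pr f g) = act f + act g + pr f g ∘ₗ dd := by
    apply chext; intro l; simp [dd_prl]
  exact congrArg (fun f => f c) this

lemma act_prl (f g f' g' s : X → X) (hf : ∀ x, s (f x) = f' (s x)) (hg : ∀ x, s (g x) = g' (s x))
    (l : List X) : act s (prl f g l) = prl f' g' (l.map s) := by
  have hg' : s ∘ g = g' ∘ s := funext hg
  induction l with
  | nil => simp [prl]
  | cons x l ih =>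
    simp [prl, act_cns, ih, hf, hg, hg']

lemma act_pr (f g f' g' s : X → X) (hf : ∀ x, s (f x) = f' (s x)) (hg : ∀ x, s (g x) = g' (s x))
    (c : Ch X) : act s (pr f g c) = pr f' g' (act s c) := by
  have : (act s ∘ₗ pr f g) = pr f' g' ∘ₗ act s := by
    apply chext; intro l; simp [act_prl f g f' g' s hf hg]
  exact congrArg (fun f => f c) this

/-- filling with a homotopy `H`, apex `e`, `M` steps -/
noncomputable def fill (H : ℕ → X → X) (e : X) (M : ℕ) : Ch X →ₗ[ZMod 2] Ch X :=
  (∑ i ∈ Finset.range M, pr (H i) (H (i + 1))) + cns e ∘ₗ act (H M)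

lemma dd_fill (H : ℕ → X → X) (e : X) (M : ℕ) (h0 : H 0 = id) (c : Ch X) (hc : dd c = 0) :
    dd (fill H e M c) = c := by
  have key : ∀ M, ∑ i ∈ Finset.range M, dd (pr (H i) (H (i + 1)) c) = c + act (H M) c := by
    intro M
    induction M with
    | zero => simp [h0, act_id, chadd]
    | succ M ih =>
      rw [Finset.sum_range_succ, ih, dd_pr, hc, map_zero, add_zero]
      calc _ = c + act (H (M + 1)) c + (act (H M) c + act (H M) c) := by abel
        _ = _ := by rw [chadd, add_zero]
  simp only [fill, LinearMap.add_apply, LinearMap.sum_apply, map_add, map_sum, key,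
    LinearMap.comp_apply, dd_cns, dd_act, hc, map_zero, add_zero]
  rw [add_assoc, chadd, add_zero]

lemma act_fill (H H' : ℕ → X → X) (e e' : X) (M : ℕ) (s : X → X) (he : s e = e')
    (hs : ∀ i x, s (H i x) = H' i (s x)) (c : Ch X) :
    act s (fill H e M c) = fill H' e' M (act s c) := by
  have hc : s ∘ H M = H' M ∘ s := funext (hs M)
  simp only [fill, LinearMap.add_apply, LinearMap.sum_apply, map_add, map_sum,
    LinearMap.comp_apply, act_cns, he, act_act, hc]
  congr 1
  exact Finset.sum_congr rfl fun i _ => act_pr _ _ _ _ s (hs i) (hs (i + 1)) c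

/-! cochain operations -/

def s0 (s : X → ZMod 2) (v : List X → ZMod 2) : List X → ZMod 2
  | [] => 0
  | x :: l => s x * v (x :: l)

def W (s : X → ZMod 2) (v : List X → ZMod 2) : List X → ZMod 2
  | x :: y :: l => (s x + s y) * v (y :: l)
  | _ => 0

def ee (s t b : X → ZMod 2) (x y : X) : ZMod 2 := (s x + s y) * (t x + t y) * (1 + b x)

def E2 (s t b : X → ZMod 2) (v : List X → ZMod 2) : List X → ZMod 2
  | x :: y :: l => ee s t b x y * v (y :: l)
  | _ => 0

def cc (s t b : X → ZMod 2) (x y z : X) : ZMod 2 :=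
  (s x + s y) * (t y + t z) + (ee s t b y z + ee s t b x z + ee s t b x y)

def C2 (s t b : X → ZMod 2) (v : List X → ZMod 2) : List X → ZMod 2
  | x :: y :: z :: l => cc s t b x y z * v (z :: l)
  | _ => 0

def Coc (v : List X → ZMod 2) : Prop := ∀ c, ev v (dd c) = 0

lemma Coc.bd {v : List X → ZMod 2} (h : Coc v) (l : List X) : ev v (bd l) = 0 := by
  simpa using h (single l 1)

lemma ev_W {v : List X → ZMod 2} (hv : Coc v) (s : X → ZMod 2) (c : Ch X) :
    ev (W s v) c = ev (s0 s v) (dd c) := by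
  have : ev (W s v) = ev (s0 s v) ∘ₗ dd := by
    apply chext; intro l
    rcases l with _ | ⟨x, _ | ⟨y, l⟩⟩
    · simp [W, GHR.bd]
    · simp [W, GHR.bd, s0]
    · have h := hv.bd (x :: y :: l)
      simp only [GHR.bd, map_add, ev_single, ev_cns, cns_single] at h
      simp only [W, ev_single, LinearMap.comp_apply, dd_single, GHR.bd, map_add, ev_cns,
        cns_single, s0, ev_mul]
      have e : ∀ a b p q r : ZMod 2, p + (q + r) = 0 → (a + b) * p = b * p + (a * q + a * r) := by
        decide
      exact e _ _ _ _ _ h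
  exact congrArg (fun f => f c) this

lemma W_coc {v : List X → ZMod 2} (hv : Coc v) (s : X → ZMod 2) : Coc (W s v) := by
  intro c
  rw [ev_W hv, dd_dd, map_zero]

lemma ev_C2 {v : List X → ZMod 2} (hv : Coc v) (s t b : X → ZMod 2) (c : Ch X) :
    ev (C2 s t b v) c = ev (W s (W t v)) c + ev (E2 s t b v) (dd c) := by
  have : ev (C2 s t b v) = ev (W s (W t v)) + ev (E2 s t b v) ∘ₗ dd := by
    apply chext; intro l
    rcases l with _ | ⟨x, _ | ⟨y, _ | ⟨z, l⟩⟩⟩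
    · simp [C2, W, GHR.bd]
    · simp [C2, W, GHR.bd, E2]
    · simp [C2, W, GHR.bd, E2]
    · have h := hv.bd (y :: z :: l)
      simp only [GHR.bd, map_add, ev_single, ev_cns, cns_single] at h
      simp only [W, C2, ev_single, LinearMap.comp_apply, dd_single, GHR.bd, map_add, ev_cns,
        cns_single, E2, ev_mul, LinearMap.add_apply, cc]
      have e : ∀ a b c d f p q r : ZMod 2, p + (q + r) = 0 →
          (a * b + (c + d + f)) * p = a * (b * p) + (c * p + (d * p + (f * q + f * r))) := by
        decide
      exact e _ _ _ _ _ _ _ _ h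
  exact congrArg (fun f => f c) this

lemma C2_coc {v : List X → ZMod 2} (hv : Coc v) (s t b : X → ZMod 2) : Coc (C2 s t b v) := by
  intro c
  rw [ev_C2 hv, dd_dd, map_zero, (W_coc (W_coc hv t) s) c, add_zero]

def v0 : List X → ZMod 2
  | [_] => 1
  | _ => 0

lemma v0_coc : Coc (v0 : List X → ZMod 2) := by
  intro c
  have : ev (v0 : List X → ZMod 2) ∘ₗ dd = 0 := by
    apply chext; intro l
    rcases l with _ | ⟨x, _ | ⟨y, l⟩⟩
    · simp [GHR.bd]
    · simp [v0, GHR.bd]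
    · have : (fun l : List X => v0 (x :: y :: l)) = fun l => 0 * v0 l := by
        ext l; simp [v0]
      simp only [LinearMap.comp_apply, dd_single, GHR.bd, map_add, ev_cns, cns_single, ev_single,
        this, LinearMap.zero_apply]
      rw [ev_mul, zero_mul, add_zero]
      rcases l with _ | ⟨z, l⟩
      · simp only [v0]; decide
      · simp [v0]
  exact congrArg (fun f => f c) this

end chains
end GHR

namespace GHR
open Finsupp

lemma prl_supp {X : Type} (f g : X → X) (l : List X) :
    prl f g l ∈ Finsupp.supported (ZMod 2) (ZMod 2)
      {l' : List X | l'.length = l.length + 1 ∧ ∀ y ∈ l', ∃ x ∈ l, y = f x ∨ y = g x} := by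
  induction l with
  | nil => simp [prl]
  | cons x l ih =>
    refine Submodule.add_mem _ ?_ ?_
    · apply Finsupp.single_mem_supported
      refine ⟨by simp, ?_⟩
      intro y hy
      simp only [List.mem_cons, List.mem_map] at hy
      rcases hy with rfl | rfl | ⟨z, hz, rfl⟩
      · exact ⟨x, by simp, Or.inl rfl⟩
      · exact ⟨x, by simp, Or.inr rfl⟩
      · exact ⟨z, by simp [hz], Or.inr rfl⟩
    · refine sup_ind (cns (f x)) _ _ ?_ ih
      rintro l' ⟨h1, h2⟩
      rw [cns_single]
      apply Finsupp.single_mem_supported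
      refine ⟨by simp [h1], ?_⟩
      intro y hy
      simp only [List.mem_cons] at hy
      rcases hy with rfl | hy
      · exact ⟨x, by simp, Or.inl rfl⟩
      · obtain ⟨z, hz, h⟩ := h2 y hy
        exact ⟨z, by simp [hz], h⟩

abbrev Xs (m D : ℕ) : Type := Fin m → Fin D → ℝ

section
variable {m D : ℕ}

def T (i : Fin m) (x : Xs m D) : Xs m D := Function.update x i (-x i)

def base (n : Fin m → ℕ) : Xs m D := fun i j => if j.val = n i then 1 else 0

noncomputable def Hm (n : Fin m → ℕ) (M : ℕ) (k : ℕ) (x : Xs m D) : Xs m D :=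
  fun i j => (1 - (k : ℝ) / (M + 1)) * x i j + (k : ℝ) / (M + 1) * base n i j

def dec (n : Fin m → ℕ) (i : Fin m) : Fin m → ℕ := Function.update n i (n i - 1)

noncomputable def HH (M : ℕ) : ℕ → (Fin m → ℕ) → Ch (Xs m D)
  | 0, n => single [base n] 1
  | N + 1, n => fill (Hm n M) (base n) M
      (∑ i, if 0 < n i then (HH M N (dec n i) + act (T i) (HH M N (dec n i))) else 0)

noncomputable def hh (M : ℕ) (n : Fin m → ℕ) : Ch (Xs m D) := HH M (∑ i, n i) n

noncomputable def bn (M : ℕ) (n : Fin m → ℕ) : Ch (Xs m D) :=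
  ∑ i, if 0 < n i then (hh M (dec n i) + act (T i) (hh M (dec n i))) else 0

lemma sum_dec {n : Fin m → ℕ} {i : Fin m} (h : 0 < n i) : ∑ j, dec n i j + 1 = ∑ j, n j := by
  rw [dec, Finset.sum_update_of_mem (Finset.mem_univ i),
    ← Finset.add_sum_erase _ _ (Finset.mem_univ i), Finset.sdiff_singleton_eq_erase]
  omega

lemma hh_succ (M : ℕ) {n : Fin m → ℕ} (h : n ≠ 0) :
    (hh M n : Ch (Xs m D)) = fill (Hm n M) (base n) M (bn M n) := by
  obtain ⟨i, hi⟩ : ∃ i, n i ≠ 0 := by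
    by_contra hc; push Not at hc; exact h (funext hc)
  obtain ⟨N, hN⟩ : ∃ N, ∑ j, n j = N + 1 := ⟨_, (sum_dec (Nat.pos_of_ne_zero hi)).symm⟩
  rw [hh, hN, HH]
  congr 1
  refine Finset.sum_congr rfl fun i _ => ?_
  split_ifs with h
  · have : ∑ j, dec n i j = N := by have := sum_dec h; omega
    rw [hh, this]
  · rfl

lemma hh_zero (M : ℕ) : (hh M (0 : Fin m → ℕ) : Ch (Xs m D)) = single [base 0] 1 := by
  simp [hh, HH]

lemma bn_zero (M : ℕ) : (bn M (0 : Fin m → ℕ) : Ch (Xs m D)) = 0 := by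
  simp [bn]

lemma T_T (i : Fin m) (x : Xs m D) : T i (T i x) = x := by
  simp [T]

lemma T_apply (i k : Fin m) (x : Xs m D) : T i x k = if k = i then - x k else x k := by
  unfold T
  split_ifs with h
  · subst h; simp
  · simp [h]

lemma T_comm (i k : Fin m) (x : Xs m D) : T i (T k x) = T k (T i x) := by
  ext a j
  simp only [T_apply]
  split_ifs <;> simp

lemma dec_comm (n : Fin m → ℕ) (i k : Fin m) : dec (dec n i) k = dec (dec n k) i := by
  by_cases h : i = k
  · subst h; rfl
  · ext a
    simp only [dec, Function.update_apply]
    split_ifs <;> simp_all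

lemma dd_bn_aux (M : ℕ) (n : Fin m → ℕ)
    (ih : ∀ i, 0 < n i → dd (hh M (dec n i) : Ch (Xs m D)) =
      (if dec n i = 0 then single [] 1 else 0) + bn M (dec n i)) :
    dd (bn M n : Ch (Xs m D)) = 0 := by
  classical
  have h1 : dd (bn M n : Ch (Xs m D)) = ∑ i, ∑ k, (if 0 < n i ∧ 0 < dec n i k then
      (hh M (dec (dec n i) k) + act (T k) (hh M (dec (dec n i) k)))
      + act (T i) (hh M (dec (dec n i) k) + act (T k) (hh M (dec (dec n i) k))) else 0) := by
    rw [bn, map_sum]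
    refine Finset.sum_congr rfl fun i _ => ?_
    by_cases h : 0 < n i
    · simp only [h, if_true, true_and, map_add, dd_act]
      rw [ih i h]
      have e0 : act (T i) (if dec n i = 0 then single [] 1 else 0 : Ch (Xs m D)) =
         (if dec n i = 0 then single [] 1 else 0 : Ch (Xs m D)) := by
        split_ifs <;> simp
      rw [map_add, e0]
      generalize (if dec n i = 0 then single [] 1 else 0 : Ch (Xs m D)) = q
      calc q + bn M (dec n i) + (q + act (T i) (bn M (dec n i)))
          = (q + q) + (bn M (dec n i) + act (T i) (bn M (dec n i))) := by abel
        _ = _ := by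
          rw [chadd, zero_add, bn, map_sum, ← Finset.sum_add_distrib]
          refine Finset.sum_congr rfl fun k _ => ?_
          split_ifs
          · simp only [map_add]
          · simp
    · simp [h]
  rw [h1, ← Finset.sum_product']
  refine Finset.sum_involution (fun p _ => p.swap) ?_ ?_ ?_ ?_
  · rintro ⟨i, k⟩ _
    simp only [Prod.swap]
    have hc : (0 < n i ∧ 0 < dec n i k) ↔ (0 < n k ∧ 0 < dec n k i) := by
      simp only [dec, Function.update_apply]
      by_cases h : i = k
      · subst h; rfl
      · have h' : k ≠ i := fun e => h e.symm
        simp only [h, h', if_false]; tauto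
    rw [dec_comm n k i]
    by_cases hp : 0 < n i ∧ 0 < dec n i k
    · rw [if_pos hp, if_pos (hc.1 hp)]
      simp only [map_add, act_act]
      have : (T k ∘ T i : Xs m D → Xs m D) = T i ∘ T k := funext fun x => T_comm k i x
      rw [this]
      generalize (hh M (dec (dec n i) k) : Ch (Xs m D)) = q
      calc _ = (q + q) + (act (T k) q + act (T k) q) + (act (T i) q + act (T i) q) +
            (act (T i ∘ T k) q + act (T i ∘ T k) q) := by abel
        _ = 0 := by simp only [chadd, add_zero]
    · rw [if_neg hp, if_neg (fun h => hp (hc.2 h)), add_zero]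
  · rintro ⟨i, k⟩ _ hne heq
    simp only [Prod.swap, Prod.mk.injEq] at heq
    obtain ⟨rfl, -⟩ := heq
    apply hne
    have e : (T k ∘ T k : Xs m D → Xs m D) = id := funext fun x => T_T k x
    split_ifs
    · simp only [map_add, act_act, e, act_id]
      generalize (hh M (dec (dec n k) k) : Ch (Xs m D)) = q
      calc _ = (q + q) + (act (T k) q + act (T k) q) := by abel
        _ = 0 := by simp only [chadd, add_zero]
    · rfl
  · intros; simp
  · intros; simp

lemma Hm_zero (n : Fin m → ℕ) (M : ℕ) : (Hm n M 0 : Xs m D → Xs m D) = id := by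
  ext x i j; simp [Hm]

lemma dd_hh (M : ℕ) (n : Fin m → ℕ) : dd (hh M n : Ch (Xs m D)) =
      (if n = 0 then single [] 1 else 0) + bn M n := by
  induction hN : ∑ i, n i using Nat.strong_induction_on generalizing n with
  | _ N ih =>
    by_cases h : n = 0
    · subst h; simp [hh_zero, bn_zero, bd]
    · rw [hh_succ M h, if_neg h, zero_add]
      apply dd_fill _ _ _ (Hm_zero n M)
      apply dd_bn_aux
      intro i hi
      exact ih _ (by have := sum_dec hi; omega) _ rfl

/-- permuting coordinates -/
def pm (π : Equiv.Perm (Fin m)) (x : Xs m D) : Xs m D := fun i => x (π i)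

lemma pm_T (π : Equiv.Perm (Fin m)) (i : Fin m) (x : Xs m D) :
    pm π (T (π i) x) = T i (pm π x) := by
  ext a j
  simp only [pm, T_apply, EmbeddingLike.apply_eq_iff_eq]

lemma dec_pm (π : Equiv.Perm (Fin m)) (n : Fin m → ℕ) (i : Fin m) :
    (dec n (π i)) ∘ π = dec (n ∘ π) i := by
  ext a
  simp only [dec, Function.comp, Function.update_apply, EmbeddingLike.apply_eq_iff_eq]

lemma hh_pm (M : ℕ) (π : Equiv.Perm (Fin m)) (n : Fin m → ℕ) :
    act (pm π) (hh M n : Ch (Xs m D)) = hh M (n ∘ π) := by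
  induction hN : ∑ i, n i using Nat.strong_induction_on generalizing n with
  | _ N ih =>
    by_cases h : n = 0
    · subst h
      have : (0 : Fin m → ℕ) ∘ π = 0 := by ext; simp
      rw [this, hh_zero]
      simp [base, pm]
      rfl
    · have h' : n ∘ π ≠ 0 := by
        intro e; apply h; ext i
        have := congrFun e (π.symm i)
        simpa using this
      rw [hh_succ M h, hh_succ M h']
      rw [act_fill (Hm n M) (Hm (n ∘ π) M) (base n) (base (n ∘ π)) M (pm π)]
      · congr 1
        rw [bn, bn, map_sum, ← Equiv.sum_comp π]
        refine Finset.sum_congr rfl fun i _ => ?_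
        simp only [Function.comp]
        split_ifs with hi
        · have h1 := ih _ (by have := sum_dec hi; omega) (dec n (π i)) rfl
          rw [dec_pm] at h1
          rw [map_add, act_act]
          have : (pm π ∘ T (π i) : Xs m D → Xs m D) = T i ∘ pm π := funext fun x => pm_T π i x
          rw [this, ← act_act, h1]
        · simp
      · rfl
      · intro i x; rfl

/-! supports -/

def Reg (c : ℝ) (n : Fin m → ℕ) : Set (Xs m D) :=
  {x | ∀ i, (∀ j, |x i j| ≤ 1) ∧ (∀ j : Fin D, n i < j.val → x i j = 0) ∧
    (∀ j : Fin D, j.val = n i → 0 ≤ x i j) ∧ ∃ j, c ≤ |x i j|}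

def Sml (ε : ℝ) (l : List (Xs m D)) : Prop := ∀ x ∈ l, ∀ y ∈ l, ∀ i j, |x i j - y i j| ≤ ε

def LS (n : Fin m → ℕ) (N : ℕ) (c ε : ℝ) : Set (List (Xs m D)) :=
  {l | (∀ x ∈ l, x ∈ Reg c n) ∧ Sml ε l ∧ l.length = N + 1}

lemma base_abs (n : Fin m → ℕ) (i : Fin m) (j : Fin D) : |(base n i j : ℝ)| ≤ 1 := by
  unfold base; split_ifs <;> simp

lemma base_reg (n : Fin m → ℕ) (hn : ∀ i, n i < D) (c : ℝ) (hc : c ≤ 1) :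
    (base n : Xs m D) ∈ Reg c n := by
  intro i
  refine ⟨fun j => base_abs n i j, ?_, ?_, ⟨⟨n i, hn i⟩, by simpa [base] using hc⟩⟩
  · intro j hj; simp [base, hj.ne']
  · intro j hj; simp [base, hj]

lemma Hm_reg (n : Fin m → ℕ) (hn : ∀ i, n i < D) (M k : ℕ) (hk : k ≤ M) (c c' : ℝ) (hc : 0 < c)
    (hc' : c' = c / (1 + c)) (x : Xs m D) (hx : x ∈ Reg c n) : Hm n M k x ∈ Reg c' n := by
  intro i
  obtain ⟨h1, h2, h3, j, h4⟩ := hx i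
  have hM : (0 : ℝ) < M + 1 := by positivity
  have hk' : (k : ℝ) ≤ M := by exact_mod_cast hk
  set t : ℝ := (k : ℝ) / (M + 1) with ht
  have ht0 : 0 ≤ t := by positivity
  have ht1 : t ≤ 1 := by rw [ht, div_le_one hM]; linarith
  have hH : ∀ j, Hm n M k x i j = (1 - t) * x i j + t * base n i j := fun j => rfl
  have hc1 : c' * (1 + c) = c := by rw [hc']; field_simp
  have hcp : 0 < c' := by rw [hc']; positivity
  refine ⟨?_, ?_, ?_, ?_⟩
  · intro j
    rw [hH]
    have ha := abs_le.1 (h1 j)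
    have hb := abs_le.1 (base_abs n i j)
    rw [abs_le]
    constructor <;> nlinarith
  · intro j hj
    rw [hH, h2 j hj]; simp [base, hj.ne']
  · intro j hj
    rw [hH]; simp only [base, hj, if_true]
    have := h3 j hj
    have : 0 ≤ (1 - t) * x i j := mul_nonneg (by linarith) this
    linarith
  · by_cases htc : c' ≤ t
    · refine ⟨⟨n i, hn i⟩, ?_⟩
      rw [hH]
      have := h3 ⟨n i, hn i⟩ rfl
      have : 0 ≤ (1 - t) * x i ⟨n i, hn i⟩ := mul_nonneg (by linarith) this
      simp only [base, if_true, mul_one]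
      rw [abs_of_nonneg (by linarith)]; linarith
    · push Not at htc
      refine ⟨j, ?_⟩
      rw [hH]
      have h5 : c' ≤ (1 - t) * |x i j| := by nlinarith
      by_cases hj : j.val = n i
      · have h6 := h3 j hj
        rw [abs_of_nonneg h6] at h5
        simp only [base, hj, if_true, mul_one]
        rw [abs_of_nonneg (by linarith)]; linarith
      · simp only [base, hj, if_false, mul_zero, add_zero]
        rw [abs_mul, abs_of_nonneg (by linarith : (0:ℝ) ≤ 1 - t)]; exact h5

lemma T_reg (n : Fin m → ℕ) (i : Fin m) (hi : 0 < n i) (c : ℝ) (x : Xs m D)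
    (hx : x ∈ Reg c (dec n i)) : x ∈ Reg c n ∧ T i x ∈ Reg c n := by
  constructor
  · intro a
    obtain ⟨h1, h2, h3, h4⟩ := hx a
    refine ⟨h1, ?_, ?_, h4⟩
    · intro j hj; apply h2; simp only [dec, Function.update_apply]; split_ifs with h
      · subst h; omega
      · exact hj
    · intro j hj
      by_cases h : a = i
      · subst h; rw [h2 j (by simp [dec]; omega)]
      · exact h3 j (by simp [dec, h, hj])
  · intro a
    obtain ⟨h1, h2, h3, h4⟩ := hx a
    rw [T_apply]
    by_cases h : a = i
    · subst h
      simp only [if_true, Pi.neg_apply, abs_neg]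
      refine ⟨h1, ?_, ?_, h4⟩
      · intro j hj; rw [h2 j (by simp [dec]; omega), neg_zero]
      · intro j hj; rw [h2 j (by simp [dec]; omega), neg_zero]
    · simp only [h, if_false]
      refine ⟨h1, ?_, ?_, h4⟩
      · intro j hj; exact h2 j (by simp [dec, h, hj])
      · intro j hj; exact h3 j (by simp [dec, h, hj])

lemma Hm_dist (n : Fin m → ℕ) (M k k' : ℕ) (hk : k ≤ M) (hkk : k' = k ∨ k' = k + 1 ∨ k = k' + 1)
    (ε : ℝ) (x y : Xs m D) (i : Fin m) (j : Fin D) (hxy : |x i j - y i j| ≤ ε)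
    (hy : |y i j| ≤ 1) :
    |Hm n M k x i j - Hm n M k' y i j| ≤ ε + 2 / (M + 1) := by
  have hM : (0 : ℝ) < M + 1 := by positivity
  have hk' : (k : ℝ) ≤ M := by exact_mod_cast hk
  have e : Hm n M k x i j - Hm n M k' y i j = (1 - (k : ℝ) / (M + 1)) * (x i j - y i j)
    + (((k' : ℝ) - k) / (M + 1)) * (y i j - base n i j) := by
    simp only [Hm]; ring
  rw [e]
  have hb := base_abs n i j
  have h1 : |y i j - base n i j| ≤ 2 := by
    rw [abs_le] at *; constructor <;> linarith
  have h2 : |((k' : ℝ) - k) / (M + 1)| ≤ 1 / (M + 1) := by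
    rw [abs_div, abs_of_pos hM]
    gcongr
    rcases hkk with rfl | rfl | rfl <;> simp
  have h3 : |1 - (k : ℝ) / (M + 1)| ≤ 1 := by
    have : (k : ℝ) / (M + 1) ≤ 1 := by rw [div_le_one hM]; linarith
    have h0 : 0 ≤ (k : ℝ) / (M + 1) := by positivity
    rw [abs_le]; constructor <;> linarith
  refine (abs_add_le _ _).trans ?_
  rw [abs_mul, abs_mul]
  have : |((k' : ℝ) - k) / (M + 1)| * |y i j - base n i j| ≤ 1 / (M + 1) * 2 := by gcongr
  have h4 : |1 - (k : ℝ) / (M + 1)| * |x i j - y i j| ≤ 1 * ε := by gcongr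
  calc _ ≤ 1 * ε + 1 / (M + 1) * 2 := add_le_add h4 this
    _ = _ := by ring

lemma fill_supp (n : Fin m → ℕ) (hn : ∀ i, n i < D) (M N : ℕ) (c c' ε : ℝ) (hc : 0 < c)
    (hc1 : c ≤ 1) (hε : 0 ≤ ε)
    (hc' : c' = c / (1 + c)) (b : Ch (Xs m D))
    (hb : b ∈ Finsupp.supported (ZMod 2) (ZMod 2) (LS n N c ε)) :
    fill (Hm n M) (base n) M b ∈
      Finsupp.supported (ZMod 2) (ZMod 2) (LS n (N + 1) c' (ε + 2 / (M + 1))) := by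
  have hc'1 : c' ≤ 1 := by rw [hc', div_le_one (by linarith)]; linarith
  have hM : (0 : ℝ) < M + 1 := by positivity
  refine sup_ind _ _ _ ?_ hb
  rintro l ⟨h1, h2, h3⟩
  simp only [fill, LinearMap.add_apply, LinearMap.sum_apply, LinearMap.comp_apply, pr_single,
    act_single, cns_single]
  refine Submodule.add_mem _ (Submodule.sum_mem _ ?_) ?_
  · intro k hk
    rw [Finset.mem_range] at hk
    refine Finsupp.supported_mono ?_ (prl_supp (Hm n M k) (Hm n M (k + 1)) l)
    rintro l' ⟨g1, g2⟩
    refine ⟨?_, ?_, by rw [g1, h3]⟩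
    · intro y hy
      obtain ⟨x, hx, rfl | rfl⟩ := g2 y hy
      · exact Hm_reg n hn M k hk.le c c' hc hc' x (h1 x hx)
      · exact Hm_reg n hn M (k + 1) hk c c' hc hc' x (h1 x hx)
    · intro y hy z hz i j
      obtain ⟨x, hx, hx'⟩ := g2 y hy
      obtain ⟨w, hw, hw'⟩ := g2 z hz
      have hxw := h2 x hx w hw i j
      have hw1 := (h1 w hw i).1 j
      rcases hx' with rfl | rfl <;> rcases hw' with rfl | rfl <;>
        exact Hm_dist n M _ _ (by omega) (by omega) ε x w i j hxw hw1
  · apply Finsupp.single_mem_supported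
    have hb1 : ∀ x ∈ l, ∀ i j, |base n i j - Hm n M M x i j| ≤ ε + 2 / (M + 1) := by
      intro x hx i j
      have e : base n i j - Hm n M M x i j = (1 / (M + 1)) * (base n i j - x i j) := by
        simp only [Hm]; field_simp; ring
      rw [e, abs_mul, abs_of_pos (by positivity : (0:ℝ) < 1 / (M + 1))]
      have hb := base_abs n i j
      have hx1 := (h1 x hx i).1 j
      have : |base n i j - x i j| ≤ 2 := by rw [abs_le] at *; constructor <;> linarith
      calc _ ≤ 1 / ((M:ℝ) + 1) * 2 := by gcongr
        _ ≤ _ := by rw [one_div_mul_eq_div]; linarith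
    refine ⟨?_, ?_, by simp [h3]⟩
    · intro y hy
      simp only [List.mem_cons, List.mem_map] at hy
      rcases hy with rfl | ⟨x, hx, rfl⟩
      · exact base_reg n hn _ hc'1
      · exact Hm_reg n hn M M le_rfl c c' hc hc' x (h1 x hx)
    · intro y hy z hz i j
      simp only [List.mem_cons, List.mem_map] at hy hz
      rcases hy with rfl | ⟨x, hx, rfl⟩ <;> rcases hz with rfl | ⟨w, hw, rfl⟩
      · simp; positivity
      · exact hb1 w hw i j
      · rw [abs_sub_comm]; exact hb1 x hx i j
      · exact Hm_dist n M _ _ (by omega) (by omega) ε x w i j (h2 x hx w hw i j) ((h1 w hw i).1 j)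

lemma hh_supp (M : ℕ) (n : Fin m → ℕ) (hn : ∀ i, n i < D) :
    (hh M n : Ch (Xs m D)) ∈ Finsupp.supported (ZMod 2) (ZMod 2)
      (LS n (∑ i, n i) (1 / ((∑ i, n i : ℕ) + 1)) ((∑ i, n i : ℕ) * (2 / (M + 1)))) := by
  induction hN : ∑ i, n i using Nat.strong_induction_on generalizing n with
  | _ N ih =>
    by_cases h : n = 0
    · subst h
      have : N = 0 := by rw [← hN]; simp
      subst this
      rw [hh_zero]
      apply Finsupp.single_mem_supported
      refine ⟨?_, ?_, by simp⟩
      · intro x hx; rw [List.mem_singleton] at hx; subst hx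
        exact base_reg _ hn _ (by simp)
      · intro x hx y hy i j; rw [List.mem_singleton] at hx hy; subst hx; subst hy; simp
    · obtain ⟨N', rfl⟩ : ∃ N', N = N' + 1 := by
        obtain ⟨i, hi⟩ : ∃ i, n i ≠ 0 := by
          by_contra hc; push Not at hc; exact h (funext hc)
        exact ⟨_, by rw [← hN]; exact (sum_dec (Nat.pos_of_ne_zero hi)).symm⟩
      rw [hh_succ M h]
      have hMp : (0 : ℝ) < M + 1 := by positivity
      have := fill_supp n hn M N' (1 / ((N' : ℝ) + 1)) (1 / ((N' + 1 : ℕ) + 1))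
        ((N' : ℝ) * (2 / (M + 1))) (by positivity)
        (by rw [div_le_one (by positivity)]; linarith [(Nat.cast_nonneg N' : (0:ℝ) ≤ N')])
        (by positivity) (by push_cast; field_simp) (bn M n) ?_
      · convert this using 3
        push_cast; ring
      · refine Submodule.sum_mem _ fun i _ => ?_
        split_ifs with hi
        · have hsum : ∑ j, dec n i j = N' := by have := sum_dec hi; omega
          have h1 := ih N' (by omega) (dec n i) (by
            intro a; simp only [dec, Function.update_apply]; split_ifs
            · have := hn i; omega
            · exact hn a) hsum
          refine Submodule.add_mem _ (Finsupp.supported_mono ?_ h1) (sup_ind _ _ _ ?_ h1)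
          · rintro l ⟨g1, g2, g3⟩
            exact ⟨fun x hx => (T_reg n i hi _ x (g1 x hx)).1, g2, g3⟩
          · rintro l ⟨g1, g2, g3⟩
            rw [act_single]
            apply Finsupp.single_mem_supported
            refine ⟨?_, ?_, by simp [g3]⟩
            · intro y hy
              rw [List.mem_map] at hy
              obtain ⟨x, hx, rfl⟩ := hy
              exact (T_reg n i hi _ x (g1 x hx)).2
            · intro y hy z hz a j
              rw [List.mem_map] at hy hz
              obtain ⟨x, hx, rfl⟩ := hy
              obtain ⟨w, hw, rfl⟩ := hz
              have := g2 x hx w hw a j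
              rw [T_apply, T_apply]
              split_ifs
              · simp only [Pi.neg_apply]
                rw [← abs_neg]; convert this using 2; ring
              · exact this
        · exact Submodule.zero_mem _

end
end GHR

namespace GHR
open Finsupp

section
variable {m D : ℕ}

lemma ev_congr_on {X : Type} {u v : List X → ZMod 2} {S : Set (List X)} (h : ∀ l ∈ S, u l = v l)
    {c : Ch X} (hc : c ∈ Finsupp.supported (ZMod 2) (ZMod 2) S) : ev u c = ev v c := by
  have h1 : ev (fun l => u l + v l) c = 0 := by
    refine ev_eq_zero_of_sup (S := S) ?_ hc
    intro l hl
    rw [h l hl, chadd]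
  rw [ev_add] at h1
  have e : ∀ a b : ZMod 2, a + b = 0 → a = b := by decide
  exact e _ _ h1

def KK (c : ℝ) : Set (Xs m D) := {x | ∀ i, (∀ j, |x i j| ≤ 1) ∧ ∃ j, c ≤ |x i j|}

def KS (c ε : ℝ) : Set (List (Xs m D)) := {l | (∀ x ∈ l, x ∈ KK c) ∧ Sml ε l}

lemma KK_T {c : ℝ} {x : Xs m D} (hx : x ∈ KK c) (i : Fin m) : T i x ∈ KK c := by
  intro a
  obtain ⟨h1, j, h2⟩ := hx a
  refine ⟨fun j => ?_, j, ?_⟩ <;> rw [T_apply] <;> split_ifs <;> simp [h1, h2]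

lemma KK_pm {c : ℝ} {x : Xs m D} (hx : x ∈ KK c) (π : Equiv.Perm (Fin m)) : pm π x ∈ KK c :=
  fun a => hx (π a)

lemma KS_T {c ε : ℝ} {l : List (Xs m D)} (hl : l ∈ KS c ε) (i : Fin m) :
    l.map (T i) ∈ KS c ε := by
  refine ⟨?_, ?_⟩
  · intro x hx
    obtain ⟨y, hy, rfl⟩ := List.mem_map.1 hx
    exact KK_T (hl.1 y hy) i
  · intro x hx y hy a j
    obtain ⟨x', hx', rfl⟩ := List.mem_map.1 hx
    obtain ⟨y', hy', rfl⟩ := List.mem_map.1 hy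
    have := hl.2 x' hx' y' hy' a j
    simp only [T_apply]
    split_ifs
    · rw [← abs_neg]
      simp only [Pi.neg_apply]
      convert this using 2; ring
    · exact this

lemma KS_pm {c ε : ℝ} {l : List (Xs m D)} (hl : l ∈ KS c ε) (π : Equiv.Perm (Fin m)) :
    l.map (pm π) ∈ KS c ε := by
  refine ⟨?_, ?_⟩
  · intro x hx
    obtain ⟨y, hy, rfl⟩ := List.mem_map.1 hx
    exact KK_pm (hl.1 y hy) π
  · intro x hx y hy a j
    obtain ⟨x', hx', rfl⟩ := List.mem_map.1 hx
    obtain ⟨y', hy', rfl⟩ := List.mem_map.1 hy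
    exact hl.2 x' hx' y' hy' (π a) j

lemma KS_sub {c ε : ℝ} {l l' : List (Xs m D)} (hl : l ∈ KS c ε) (h : ∀ x ∈ l', x ∈ l) :
    l' ∈ KS c ε :=
  ⟨fun x hx => hl.1 x (h x hx), fun x hx y hy => hl.2 x (h x hx) y (h y hy)⟩

lemma hh_KS (M N : ℕ) (n : Fin m → ℕ) (hn : ∀ i, n i < D) (hN : ∑ i, n i ≤ N) :
    (hh M n : Ch (Xs m D)) ∈ Finsupp.supported (ZMod 2) (ZMod 2)
      (KS (1 / ((N : ℝ) + 1)) (N * (2 / (M + 1)))) := by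
  refine Finsupp.supported_mono ?_ (hh_supp M n hn)
  rintro l ⟨h1, h2, -⟩
  have hN' : ((∑ i, n i : ℕ) : ℝ) ≤ N := by exact_mod_cast hN
  refine ⟨?_, ?_⟩
  · intro x hx i
    obtain ⟨g1, -, -, j, g2⟩ := h1 x hx i
    refine ⟨g1, j, le_trans ?_ g2⟩
    exact one_div_le_one_div_of_le (by positivity) (by linarith)
  · intro x hx y hy i j
    refine (h2 x hx y hy i j).trans ?_
    gcongr

lemma bd_supp {X : Type} (l : List X) : bd l ∈ Finsupp.supported (ZMod 2) (ZMod 2)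
    {l' : List X | ∀ x ∈ l', x ∈ l} := by
  induction l with
  | nil => simp [bd]
  | cons x l ih =>
    rw [bd]
    refine Submodule.add_mem _ ?_ ?_
    · exact Finsupp.single_mem_supported _ _ (fun y hy => List.mem_cons_of_mem _ hy)
    · refine sup_ind (cns x) _ _ ?_ ih
      intro l' hl'
      rw [cns_single]
      refine Finsupp.single_mem_supported _ _ ?_
      intro y hy
      rcases List.mem_cons.1 hy with rfl | hy
      · simp
      · exact List.mem_cons_of_mem _ (hl' y hy)

/-- basic niceness -/
structure Nice (c ε : ℝ) (M : ℕ) (n0 : Fin m → ℕ) (v : List (Xs m D) → ZMod 2)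
    (p : MvPolynomial (Fin m) (ZMod 2)) : Prop where
  coc : Coc v
  inv : ∀ l ∈ KS c ε, ∀ i, v (l.map (T i)) = v l
  val : ∀ n ≤ n0, ev v (hh M n) = MvPolynomial.coeff (Finsupp.equivFunOnFinite.symm n) p

lemma Coc.nil {v : List (Xs m D) → ZMod 2} (h : Coc v) : v [] = 0 := by
  have := h.bd [0]
  simpa [GHR.bd] using this

noncomputable def lin (a : Fin m → ZMod 2) : MvPolynomial (Fin m) (ZMod 2) :=
  ∑ j, MvPolynomial.C (a j) * MvPolynomial.X j

lemma dec_le {n n0 : Fin m → ℕ} (h : n ≤ n0) (i : Fin m) : dec n i ≤ n0 := by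
  intro a
  have : n a ≤ n0 a := h a
  simp only [dec, Function.update_apply]
  split_ifs with h'
  · subst h'; omega
  · exact this

lemma coeff_lin (a : Fin m → ZMod 2) (p : MvPolynomial (Fin m) (ZMod 2)) (n : Fin m → ℕ) :
    MvPolynomial.coeff (Finsupp.equivFunOnFinite.symm n) (lin a * p) =
      ∑ i, if 0 < n i then
        a i * MvPolynomial.coeff (Finsupp.equivFunOnFinite.symm (dec n i)) p else 0 := by
  classical
  rw [lin, Finset.sum_mul, MvPolynomial.coeff_sum]
  refine Finset.sum_congr rfl fun i _ => ?_
  rw [mul_assoc, MvPolynomial.coeff_C_mul, MvPolynomial.coeff_X_mul']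
  simp only [Finsupp.mem_support_iff, Finsupp.equivFunOnFinite_symm_apply_apply,
    Nat.pos_iff_ne_zero, mul_ite, mul_zero]
  split_ifs with h
  · congr 2
    ext j
    simp only [Finsupp.tsub_apply, Finsupp.equivFunOnFinite_symm_apply_apply, dec,
      Function.update_apply, Finsupp.single_apply]
    split_ifs with h1 h2 h2
    · subst h1; rfl
    · exact absurd h1.symm h2
    · exact absurd h2.symm h1
    · simp
  · rfl

variable {c ε : ℝ} {M : ℕ} {n0 : Fin m → ℕ}

lemma ev_dd_hh (u : List (Xs m D) → ZMod 2) (hu : u [] = 0) (n : Fin m → ℕ) :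
    ev u (dd (hh M n)) = ∑ i, if 0 < n i then
      ev (fun l => u l + u (l.map (T i))) (hh M (dec n i)) else 0 := by
  rw [dd_hh, map_add, bn, map_sum]
  have : ev u (if n = 0 then single [] 1 else 0) = 0 := by
    split_ifs <;> simp [hu]
  rw [this, zero_add]
  refine Finset.sum_congr rfl fun i _ => ?_
  split_ifs
  · rw [map_add, ev_act, ev_add]
  · simp

lemma W_inv {v : List (Xs m D) → ZMod 2} (hv : ∀ l ∈ KS c ε, ∀ i, v (l.map (T i)) = v l)
    (s : Xs m D → ZMod 2) (a : Fin m → ZMod 2)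
    (hs : ∀ x ∈ KK c, ∀ i, s (T i x) = s x + a i) :
    ∀ l ∈ KS c ε, ∀ i, W s v (l.map (T i)) = W s v l := by
  intro l hl i
  rcases l with _ | ⟨x, _ | ⟨y, l⟩⟩
  · simp
  · simp [W]
  · have := hv (y :: l) (KS_sub hl (fun z hz => List.mem_cons_of_mem _ hz)) i
    simp only [List.map_cons, W] at this ⊢
    rw [this, hs x (hl.1 x (by simp)), hs y (hl.1 y (by simp))]
    have e : ∀ p q r t : ZMod 2, (p + r + (q + r)) * t = (p + q) * t := by decide
    exact e _ _ _ _

lemma Nice.W (hS : ∀ n ≤ n0, (hh M n : Ch (Xs m D)) ∈ Finsupp.supported (ZMod 2) (ZMod 2) (KS c ε))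
    {v : List (Xs m D) → ZMod 2} {p} (hv : Nice c ε M n0 v p)
    (s : Xs m D → ZMod 2) (a : Fin m → ZMod 2)
    (hs : ∀ x ∈ KK c, ∀ i, s (T i x) = s x + a i) :
    Nice c ε M n0 (W s v) (lin a * p) where
  coc := W_coc hv.coc s
  inv := W_inv hv.inv s a hs
  val := by
    intro n hn
    rw [ev_W hv.coc, coeff_lin, ev_dd_hh _ (by simp [s0])]
    refine Finset.sum_congr rfl fun i _ => ?_
    split_ifs with hi
    · rw [← hv.val _ (dec_le hn i), ← ev_mul]
      refine ev_congr_on ?_ (hS _ (dec_le hn i))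
      intro l hl
      rcases l with _ | ⟨x, l⟩
      · simp [s0, hv.coc.nil]
      · have := hv.inv _ hl i
        simp only [List.map_cons, s0] at this ⊢
        rw [this, hs x (hl.1 x (by simp))]
        have e : ∀ p r t : ZMod 2, p * t + (p + r) * t = r * t := by decide
        exact e _ _ _
    · rfl

lemma cc_T (s t b : Xs m D → ZMod 2) (a a' : Fin m → ZMod 2)
    (hs : ∀ x ∈ KK c, ∀ i, s (T i x) = s x + a i)
    (ht : ∀ x ∈ KK c, ∀ i, t (T i x) = t x + a' i)
    (hb : ∀ x ∈ KK c, ∀ i, b (T i x) = b x) {x y : Xs m D} (hx : x ∈ KK c) (hy : y ∈ KK c)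
    (i : Fin m) : ee s t b (T i x) (T i y) = ee s t b x y := by
  simp only [ee, hs x hx, hs y hy, ht x hx, ht y hy, hb x hx]
  have e : ∀ p q p' q' r r' t : ZMod 2,
    (p + r + (q + r)) * (p' + r' + (q' + r')) * t = (p + q) * (p' + q') * t := by decide
  exact e _ _ _ _ _ _ _

lemma Nice.C2 (hS : ∀ n ≤ n0, (hh M n : Ch (Xs m D)) ∈ Finsupp.supported (ZMod 2) (ZMod 2) (KS c ε))
    {v : List (Xs m D) → ZMod 2} {p} (hv : Nice c ε M n0 v p)
    (s t b : Xs m D → ZMod 2) (a a' : Fin m → ZMod 2)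
    (hs : ∀ x ∈ KK c, ∀ i, s (T i x) = s x + a i)
    (ht : ∀ x ∈ KK c, ∀ i, t (T i x) = t x + a' i)
    (hb : ∀ x ∈ KK c, ∀ i, b (T i x) = b x) :
    Nice c ε M n0 (C2 s t b v) (lin a * (lin a' * p)) where
  coc := C2_coc hv.coc s t b
  inv := by
    intro l hl i
    rcases l with _ | ⟨x, _ | ⟨y, _ | ⟨z, l⟩⟩⟩
    · simp
    · simp [GHR.C2]
    · simp [GHR.C2]
    · have := hv.inv (z :: l) (KS_sub hl (fun z hz =>
        List.mem_cons_of_mem _ (List.mem_cons_of_mem _ hz))) i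
      simp only [List.map_cons, GHR.C2] at this ⊢
      have hx := hl.1 x (by simp)
      have hy := hl.1 y (by simp)
      have hz := hl.1 z (by simp)
      rw [this, cc, cc, cc_T s t b a a' hs ht hb hx hy, cc_T s t b a a' hs ht hb hx hz,
        cc_T s t b a a' hs ht hb hy hz, hs x hx, hs y hy, ht y hy, ht z hz]
      have e : ∀ p q p' q' r r' t u : ZMod 2,
        ((p + r + (q + r)) * (p' + r' + (q' + r')) + t) * u = ((p + q) * (p' + q') + t) * u := by
        decide
      exact e _ _ _ _ _ _ _ _
  val := by
    intro n hn
    rw [ev_C2 hv.coc, ((hv.W hS t a' ht).W hS s a hs).val n hn, ev_dd_hh _ (by simp [E2]),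
      Finset.sum_eq_zero, add_zero]
    intro i _
    split_ifs with hi
    · refine ev_eq_zero_of_sup ?_ (hS _ (dec_le hn i))
      intro l hl
      rcases l with _ | ⟨x, _ | ⟨y, l⟩⟩
      · simp [E2]
      · simp [E2]
      · have := hv.inv (y :: l) (KS_sub hl (fun z hz => List.mem_cons_of_mem _ hz)) i
        simp only [List.map_cons, E2] at this ⊢
        rw [this, cc_T s t b a a' hs ht hb (hl.1 x (by simp)) (hl.1 y (by simp)), chadd]
    · rfl

lemma Nice.v0 (hD : ∀ i, n0 i < D) : Nice c ε M n0 (v0 : List (Xs m D) → ZMod 2) 1 where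
  coc := v0_coc
  inv := by
    intro l hl i
    rcases l with _ | ⟨x, _ | ⟨y, l⟩⟩ <;> simp [GHR.v0]
  val := by
    classical
    intro n hn
    rw [MvPolynomial.coeff_one]
    by_cases h : n = 0
    · subst h
      rw [hh_zero, ev_single, if_pos (by ext; simp)]
      rfl
    · rw [if_neg]
      · refine ev_eq_zero_of_sup ?_ (hh_supp M n (fun i => (hn i).trans_lt (hD i)))
        rintro l ⟨-, -, hl⟩
        obtain ⟨i, hi⟩ : ∃ i, n i ≠ 0 := by
          by_contra hc; push Not at hc; exact h (funext hc)
        have : n i ≤ ∑ i, n i := Finset.single_le_sum (fun _ _ => Nat.zero_le _) (Finset.mem_univ i)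
        rcases l with _ | ⟨x, _ | ⟨y, l⟩⟩
        · simp [GHR.v0]
        · simp at hl; exact absurd (hl i) hi
        · simp [GHR.v0]
      · intro h'
        apply h
        ext i
        have := congrArg (fun f => f i) h'
        simpa using this.symm

end
end GHR

namespace GHR
open Finsupp

section
variable {X : Type}

lemma map_self_iff {f : X → X} {l : List X} : l.map f = l ↔ ∀ x ∈ l, f x = x := by
  induction l with
  | nil => simp
  | cons y l ih => simp [ih]

def RR (σ : X → X) : Set (List X) := {l | WellOrderingRel l (l.map σ)}

lemma RR_fix {σ : X → X} {l : List X} (h : l.map σ = l) : l ∉ RR σ := by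
  intro h'
  rw [RR, Set.mem_ofPred_eq, h] at h'
  exact (irrefl_of WellOrderingRel l) h'

lemma map_invol {σ : X → X} (hσ : ∀ x, σ (σ x) = x) (l : List X) : (l.map σ).map σ = l := by
  rw [List.map_map, show σ ∘ σ = id from funext hσ, List.map_id]

lemma RR_iff {σ : X → X} (hσ : ∀ x, σ (σ x) = x) {l : List X} (h : l.map σ ≠ l) :
    l.map σ ∈ RR σ ↔ l ∉ RR σ := by
  rw [RR, Set.mem_ofPred_eq, Set.mem_ofPred_eq, map_invol hσ]
  constructor
  · intro h1 h2
    exact (asymm_of WellOrderingRel h1) h2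
  · intro h1
    rcases trichotomous_of WellOrderingRel l (l.map σ) with h2 | h2 | h2
    · exact absurd h2 h1
    · exact absurd h2.symm h
    · exact h2

open Classical in
noncomputable def fR (σ : X → X) : Ch X →ₗ[ZMod 2] Ch X :=
  Finsupp.linearCombination (ZMod 2) (fun l => if l ∈ RR σ then single l 1 else 0)

open Classical in
noncomputable def fX (σ : X → X) : Ch X →ₗ[ZMod 2] Ch X :=
  Finsupp.linearCombination (ZMod 2) (fun l => if l.map σ = l then single l 1 else 0)

open Classical in
@[simp] lemma fR_single (σ : X → X) (l : List X) :
    fR σ (single l 1) = if l ∈ RR σ then single l 1 else 0 := by simp [fR]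

open Classical in
@[simp] lemma fX_single (σ : X → X) (l : List X) :
    fX σ (single l 1) = if l.map σ = l then single l 1 else 0 := by simp [fX]

lemma decomp {σ : X → X} (hσ : ∀ x, σ (σ x) = x) {c : Ch X} (hc : act σ c = c) :
    c = fR σ c + act σ (fR σ c) + fX σ c := by
  have : (LinearMap.id : Ch X →ₗ[ZMod 2] Ch X) = fR σ + act σ ∘ₗ fR σ ∘ₗ act σ + fX σ := by
    apply chext; intro l
    by_cases h : l.map σ = l
    · have := RR_fix h
      simp [h, this]
    · have := RR_iff hσ h
      by_cases h' : l ∈ RR σ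
      · have h2 : l.map σ ∉ RR σ := fun h3 => this.1 h3 h'
        simp [h, h', h2]
      · have h2 := this.2 h'
        have h3 := map_invol hσ l
        rw [List.map_map] at h3
        simp [h, h', h2, h3]
  have := congrArg (fun f => f c) this
  simpa [hc] using this

lemma fR_supp (σ : X → X) {S : Set (List X)} {c : Ch X}
    (hc : c ∈ Finsupp.supported (ZMod 2) (ZMod 2) S) :
    fR σ c ∈ Finsupp.supported (ZMod 2) (ZMod 2) S := by
  refine sup_ind (fR σ) S _ ?_ hc
  intro l hl
  rw [fR_single]
  split_ifs
  · exact Finsupp.single_mem_supported _ _ hl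
  · exact Submodule.zero_mem _

lemma fX_supp (σ : X → X) (c : Ch X) :
    fX σ c ∈ Finsupp.supported (ZMod 2) (ZMod 2) {l : List X | ∀ x ∈ l, σ x = x} := by
  refine sup_ind (fX σ) Set.univ _ ?_ (by simp [Finsupp.mem_supported])
  intro l _
  rw [fX_single]
  split_ifs with h
  · refine Finsupp.single_mem_supported _ _ ?_
    intro x hx
    exact (map_self_iff.1 h) x hx
  · exact Submodule.zero_mem _

lemma dd_supp {S S' : Set (List X)} (h : ∀ l ∈ S, ∀ l', (∀ x ∈ l', x ∈ l) → l' ∈ S') {c : Ch X}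
    (hc : c ∈ Finsupp.supported (ZMod 2) (ZMod 2) S) :
    dd c ∈ Finsupp.supported (ZMod 2) (ZMod 2) S' := by
  refine sup_ind dd S _ ?_ hc
  intro l hl
  rw [dd_single]
  exact Finsupp.supported_mono (fun l' hl' => h l hl l' hl') (bd_supp l)

lemma act_supp {S S' : Set (List X)} {f : X → X} (h : ∀ l ∈ S, l.map f ∈ S') {c : Ch X}
    (hc : c ∈ Finsupp.supported (ZMod 2) (ZMod 2) S) :
    act f c ∈ Finsupp.supported (ZMod 2) (ZMod 2) S' := by
  refine sup_ind (act f) S _ ?_ hc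
  intro l hl
  rw [act_single]
  exact Finsupp.single_mem_supported _ _ (h l hl)

open Classical in
noncomputable def uR (σ : X → X) (u : List X → ZMod 2) : List X → ZMod 2 :=
  fun l => if l ∈ RR σ then u l else 0

lemma uR_fix {σ : X → X} (u : List X → ZMod 2) {c : Ch X}
    (hc : c ∈ Finsupp.supported (ZMod 2) (ZMod 2) {l : List X | ∀ x ∈ l, σ x = x}) :
    ev (uR σ u) c = 0 := by
  refine ev_eq_zero_of_sup ?_ hc
  intro l hl
  exact if_neg (RR_fix (map_self_iff.2 hl))

lemma uR_half {σ : X → X} (hσ : ∀ x, σ (σ x) = x) {S : Set (List X)} {u : List X → ZMod 2}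
    (h1 : ∀ l ∈ S, u (l.map σ) = u l) (h2 : ∀ l ∈ S, l.map σ = l → u l = 0) {c : Ch X}
    (hc : c ∈ Finsupp.supported (ZMod 2) (ZMod 2) S) :
    ev (uR σ u) (c + act σ c) = ev u c := by
  rw [map_add, ev_act, ← ev_add]
  refine ev_congr_on ?_ hc
  intro l hl
  simp only [uR]
  by_cases h : l.map σ = l
  · simp [h, RR_fix h, h2 l hl h]
  · have := RR_iff hσ h
    by_cases h' : l ∈ RR σ
    · have h3 : l.map σ ∉ RR σ := fun h3 => this.1 h3 h'
      simp [h', h3]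
    · simp [h', this.2 h', h1 l hl]

end

section
variable {m D : ℕ} {c ε : ℝ} {M : ℕ} {n0 : Fin m → ℕ}

lemma s0_T {v : List (Xs m D) → ZMod 2} (hv : ∀ l ∈ KS c ε, ∀ i, v (l.map (T i)) = v l)
    (hnil : v [] = 0)
    (s : Xs m D → ZMod 2) (a : Fin m → ZMod 2)
    (hs : ∀ x ∈ KK c, ∀ i, s (T i x) = s x + a i) (i : Fin m) :
    ∀ l ∈ KS c ε, s0 s v l + s0 s v (l.map (T i)) = a i * v l := by
  intro l hl
  rcases l with _ | ⟨x, l⟩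
  · simp [s0, hnil]
  · have := hv _ hl i
    simp only [List.map_cons, s0] at this ⊢
    rw [this, hs x (hl.1 x (by simp))]
    have e : ∀ p r t : ZMod 2, p * t + (p + r) * t = r * t := by decide
    exact e _ _ _

lemma half (hS : ∀ n ≤ n0, (hh M n : Ch (Xs m D)) ∈ Finsupp.supported (ZMod 2) (ZMod 2) (KS c ε))
    {i0 i1 : Fin m} (h01 : i0 ≠ i1) (hn01 : n0 i0 = n0 i1) (hpos : 0 < n0 i0)
    {v : List (Xs m D) → ZMod 2} (hv : Coc v)
    (hvT : ∀ l ∈ KS c ε, ∀ i, v (l.map (T i)) = v l)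
    (s : Xs m D → ZMod 2) (a : Fin m → ZMod 2)
    (hs : ∀ x ∈ KK c, ∀ i, s (T i x) = s x + a i) (ha0 : a i0 = 1)
    (ha : ∀ i, i ≠ i0 → i ≠ i1 → a i = 0)
    (hu1 : ∀ l ∈ KS c ε, s0 s v (l.map (pm (Equiv.swap i0 i1))) = s0 s v l)
    (hu2 : ∀ l ∈ KS c ε, l.map (pm (Equiv.swap i0 i1)) = l → s0 s v l = 0) :
    ∃ z ∈ Finsupp.supported (ZMod 2) (ZMod 2) (KS (m := m) (D := D) c ε),
      ev (W s v) z = ev v (hh M (dec n0 i0)) := by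
  set σ : Xs m D → Xs m D := pm (Equiv.swap i0 i1) with hσdef
  have hσ : ∀ x, σ (σ x) = x := by
    intro x; ext i j; simp [hσdef, pm]
  have hcomp : n0 ∘ Equiv.swap i0 i1 = n0 := by
    ext i
    simp only [Function.comp, Equiv.swap_apply_def]
    split_ifs with h1 h2
    · rw [h1, hn01]
    · rw [h2, hn01]
    · rfl
  have hinv : act σ (hh M n0 : Ch (Xs m D)) = hh M n0 := by rw [hσdef, hh_pm, hcomp]
  have hsub : ∀ l ∈ KS (m := m) (D := D) c ε, ∀ l', (∀ x ∈ l', x ∈ l) → l' ∈ KS c ε :=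
    fun l hl l' h => KS_sub hl h
  have hfixsub : ∀ l ∈ {l : List (Xs m D) | ∀ x ∈ l, σ x = x}, ∀ l', (∀ x ∈ l', x ∈ l) →
    l' ∈ {l : List (Xs m D) | ∀ x ∈ l, σ x = x} := fun l hl l' h x hx => hl x (h x hx)
  set u := s0 s v with hu
  refine ⟨fR σ (hh M n0), fR_supp σ (hS n0 le_rfl), ?_⟩
  have key : ev u (dd (fR σ (hh M n0 : Ch (Xs m D)))) = ev (uR σ u) (dd (hh M n0)) := by
    have h1 := uR_half hσ hu1 hu2 (dd_supp hsub (fR_supp σ (hS n0 le_rfl)))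
    have h2 := congrArg (fun y => ev (uR σ u) (dd y)) (decomp hσ hinv)
    simp only [map_add] at h2
    rw [uR_fix u (dd_supp hfixsub (fX_supp σ _)), add_zero, dd_act, ← map_add, h1] at h2
    exact h2.symm
  rw [ev_W hv, ← hu, key, ev_dd_hh _ (by simp [uR, hu, s0])]
  have hterm : ∀ n : Fin m → ℕ, ∀ i, ev (fun l => uR σ u l + uR σ u (l.map (T i)))
      (hh M n : Ch (Xs m D)) = ev (uR σ u) (hh M n + act (T i) (hh M n)) := by
    intro n i
    rw [ev_add, map_add, ev_act]
  have h1 : n0 i1 = n0 i0 := hn01.symm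
  rw [Finset.sum_eq_add i0 i1 h01]
  · rw [if_pos hpos, if_pos (by omega), hterm, hterm, ← map_add]
    have h2 : (hh M (dec n0 i1) : Ch (Xs m D)) = act σ (hh M (dec n0 i0)) := by
      have := dec_pm (Equiv.swap i0 i1) n0 i1
      rw [Equiv.swap_apply_right, hcomp] at this
      rw [hσdef, hh_pm, this]
    have h3 : ∀ y : Ch (Xs m D), act (T i1) (act σ y) = act σ (act (T i0) y) := by
      intro y
      rw [act_act, act_act]
      congr 1
      congr 1
      funext x
      have := pm_T (Equiv.swap i0 i1) i1 x
      rw [Equiv.swap_apply_right] at this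
      exact this.symm
    rw [h2, h3]
    set y := (hh M (dec n0 i0) : Ch (Xs m D))
    have hy : y ∈ Finsupp.supported (ZMod 2) (ZMod 2) (KS c ε) := hS _ (dec_le le_rfl i0)
    rw [← map_add (act σ), uR_half hσ hu1 hu2, map_add, ev_act, ← ev_add]
    · refine ev_congr_on ?_ hy
      intro l hl
      rw [s0_T hvT hv.nil s a hs i0 l hl, ha0, one_mul]
    · exact Submodule.add_mem _ hy (act_supp (fun l hl => KS_T hl i0) hy)
  · rintro i - ⟨hi0, hi1⟩
    split_ifs with hi
    · rw [hterm]
      set y := (hh M (dec n0 i) : Ch (Xs m D)) with hydef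
      have hy : y ∈ Finsupp.supported (ZMod 2) (ZMod 2) (KS c ε) := hS _ (dec_le le_rfl i)
      have hsw : Equiv.swap i0 i1 i = i := Equiv.swap_apply_of_ne_of_ne hi0 hi1
      have hyinv : act σ y = y := by
        have := dec_pm (Equiv.swap i0 i1) n0 i
        rw [hsw, hcomp] at this
        rw [hydef, hσdef, hh_pm, this]
      have hTσ : ∀ x, T i (σ x) = σ (T i x) := by
        intro x
        have := pm_T (Equiv.swap i0 i1) i x
        rw [hsw] at this
        exact this.symm
      have h3 : ∀ y : Ch (Xs m D), act (T i) (act σ y) = act σ (act (T i) y) := by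
        intro y
        rw [act_act, act_act]
        congr 1
        congr 1
        funext x
        exact hTσ x
      have h4 : y + act (T i) y = (fR σ y + act (T i) (fR σ y)) +
          act σ (fR σ y + act (T i) (fR σ y)) + (fX σ y + act (T i) (fX σ y)) := by
        conv_lhs => rw [decomp hσ hyinv]
        simp only [map_add, h3]
        abel
      have hfy := fR_supp σ hy
      have hfT : act (T i) (fR σ y) ∈ Finsupp.supported (ZMod 2) (ZMod 2) (KS c ε) :=
        act_supp (fun l hl => KS_T hl i) hfy
      rw [h4, map_add, uR_half hσ hu1 hu2 (Submodule.add_mem _ hfy hfT), uR_fix, add_zero,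
        map_add, ev_act, ← ev_add]
      · refine ev_eq_zero_of_sup ?_ hfy
        intro l hl
        rw [s0_T hvT hv.nil s a hs i l hl, ha i hi0 hi1, zero_mul]
      · refine Submodule.add_mem _ (fX_supp σ y) (act_supp ?_ (fX_supp σ y))
        intro l hl x hx
        obtain ⟨x', hx', rfl⟩ := List.mem_map.1 hx
        rw [← hTσ, hl x' hx']
    · rfl
  · simp
  · simp

end
end GHR

namespace GHR
open Finsupp

def Nb (s s' t t' b b' : ZMod 2) : Bool :=
  (decide (s ≠ s') && decide (t ≠ t')) || (decide (s ≠ s') && (decide (b = 1) || decide (b' = 1)))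
    || (decide (t ≠ t') && (decide (b = 0) || decide (b' = 0)))

lemma Nb_spec {s s' t t' b b' : ZMod 2} (h : Nb s s' t t' b b' = true) :
    (s ≠ s' ∧ t ≠ t') ∨ (s ≠ s' ∧ (b = 1 ∨ b' = 1)) ∨ (t ≠ t' ∧ (b = 0 ∨ b' = 0)) := by
  simp only [Nb, Bool.or_eq_true, Bool.and_eq_true, decide_eq_true_eq] at h
  tauto

set_option maxRecDepth 100000 in
lemma cc_alg1 : ∀ sx sy sz tx ty tz bx b_y bz : ZMod 2,
    (sx + sy) * (ty + tz) + ((sy + sz) * (ty + tz) * (1 + b_y) +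
      (sx + sz) * (tx + tz) * (1 + bx) + (sx + sy) * (tx + ty) * (1 + bx)) = 0 ∨
    (Nb sx sy tx ty bx b_y || Nb sy sz ty tz b_y bz || Nb sx sz tx tz bx bz) = true := by
  decide

set_option maxRecDepth 100000 in
lemma cc_alg2 : ∀ sx sy sz tx ty tz bx b_y : ZMod 2,
    (tx + ty) * (sy + sz) + ((ty + tz) * (sy + sz) * (1 + (1 + b_y)) +
      (tx + tz) * (sx + sz) * (1 + (1 + bx)) + (tx + ty) * (sx + sy) * (1 + (1 + bx))) =
    (sx + sy) * (ty + tz) + ((sy + sz) * (ty + tz) * (1 + b_y) +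
      (sx + sz) * (tx + tz) * (1 + bx) + (sx + sy) * (tx + ty) * (1 + bx)) := by
  decide

section
variable {m D : ℕ}

def ltz (w : Fin D → ℝ) : Prop := (toLex w : Lex (Fin D → ℝ)) < 0

lemma ltz_neg {w : Fin D → ℝ} (h : w ≠ 0) : ltz (-w) ↔ ¬ ltz w := by
  have h' : (toLex w : Lex (Fin D → ℝ)) ≠ 0 := fun h1 => h (by simpa using h1)
  unfold ltz
  rw [toLex_neg]
  constructor
  · intro h1; exact not_lt.2 (neg_lt_zero.1 h1).le
  · intro h1; exact neg_lt_zero.2 (lt_of_le_of_ne (not_lt.1 h1) h'.symm)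

def alt (w w' : Fin D → ℝ) : Prop :=
  |(toLex w : Lex (Fin D → ℝ))| < |(toLex w' : Lex (Fin D → ℝ))|

lemma alt_neg_left (w w' : Fin D → ℝ) : alt (-w) w' ↔ alt w w' := by
  unfold alt; rw [toLex_neg, abs_neg]

lemma alt_neg_right (w w' : Fin D → ℝ) : alt w (-w') ↔ alt w w' := by
  unfold alt; rw [toLex_neg, abs_neg]

lemma alt_total {w w' : Fin D → ℝ} (h1 : w ≠ w') (h2 : w ≠ -w') : alt w' w ↔ ¬ alt w w' := by
  unfold alt
  constructor
  · intro h; exact not_lt.2 h.le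
  · intro h
    refine lt_of_le_of_ne (not_lt.1 h) ?_
    intro h'
    rcases abs_eq_abs.1 h' with h3 | h3
    · exact h1 (by simpa using h3.symm)
    · rw [← toLex_neg] at h3
      have h4 : w' = -w := toLex.injective h3
      exact h2 (by rw [h4, neg_neg])

open Classical in
noncomputable def sg (w : Fin D → ℝ) : ZMod 2 := if ltz w then 1 else 0

lemma sg_neg {w : Fin D → ℝ} (h : w ≠ 0) : sg (-w) = sg w + 1 := by
  unfold sg
  rw [ltz_neg h]
  by_cases h1 : ltz w
  · simp only [h1, not_true, if_true, if_false]; decide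
  · simp only [h1, not_false_iff, if_true, if_false, zero_add]

lemma KK_ne {c : ℝ} (hc : 0 < c) {x : Xs m D} (hx : x ∈ KK c) (i : Fin m) : x i ≠ 0 := by
  intro h
  obtain ⟨-, j, hj⟩ := hx i
  rw [h] at hj
  simp at hj
  linarith

def ia (α : Finset (Fin m)) : Fin m → ZMod 2 := fun i => if i ∈ α then 1 else 0

variable (F : Finset (Fin m) → Bool → Xs m D → ℝ)

open Classical in
noncomputable def lab (α : Finset (Fin m)) (a : Bool) (x : Xs m D) : ZMod 2 :=
  if F α a x < 0 then 1 else if 0 < F α a x then 0 else ∑ i ∈ α, sg (x i)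

lemma lab_T {c : ℝ} (hc : 0 < c)
    (hT : ∀ α a x i, F α a (T i x) = if i ∈ α then - F α a x else F α a x)
    (α : Finset (Fin m)) (a : Bool) : ∀ x ∈ KK c, ∀ i, lab F α a (T i x) = lab F α a x + ia α i := by
  intro x hx i
  unfold lab ia
  rw [hT]
  by_cases hi : i ∈ α
  · simp only [hi, if_true, neg_lt_zero, neg_pos]
    rcases lt_trichotomy (F α a x) 0 with h | h | h
    · simp only [h, not_lt.2 h.le, if_true, if_false]; decide
    · simp only [h, lt_irrefl, if_false]
      rw [← Finset.add_sum_erase _ _ hi, ← Finset.add_sum_erase _ (fun i => sg (x i)) hi]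
      rw [T_apply, if_pos rfl, sg_neg (KK_ne hc hx i)]
      have : ∑ k ∈ α.erase i, sg (T i x k) = ∑ k ∈ α.erase i, sg (x k) := by
        refine Finset.sum_congr rfl fun k hk => ?_
        rw [T_apply, if_neg (Finset.ne_of_mem_erase hk)]
      rw [this]; ring
    · simp only [h, not_lt.2 h.le, if_true, if_false, zero_add]
  · simp only [hi, if_false, add_zero]
    split_ifs
    · rfl
    · rfl
    · refine Finset.sum_congr rfl fun k hk => ?_
      rw [T_apply, if_neg (by rintro rfl; exact hi hk)]

lemma lab_pm (π : Equiv.Perm (Fin m))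
    (hπ : ∀ α a x, F α a (pm π x) = F (α.map π.toEmbedding) a x)
    (α : Finset (Fin m)) (a : Bool) (x : Xs m D) :
    lab F α a (pm π x) = lab F (α.map π.toEmbedding) a x := by
  unfold lab
  rw [hπ, Finset.sum_map]
  rfl

lemma lab_small {η : ℝ} {α : Finset (Fin m)} {a : Bool} {x y : Xs m D}
    (h : lab F α a x ≠ lab F α a y) (hxy : |F α a x - F α a y| ≤ η) :
    |F α a x| ≤ η ∧ |F α a y| ≤ η := by
  have hη : 0 ≤ η := (abs_nonneg _).trans hxy
  rw [abs_le] at hxy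
  have : ¬ (F α a x < 0 ∧ F α a y < 0) := by
    rintro ⟨h1, h2⟩; apply h; simp [lab, h1, h2]
  have : ¬ (0 < F α a x ∧ 0 < F α a y) := by
    rintro ⟨h1, h2⟩; apply h; simp [lab, h1, h2, not_lt.2 h1.le, not_lt.2 h2.le]
  rw [abs_le, abs_le]
  constructor <;> constructor <;> by_contra hc <;> push Not at hc <;>
    rcases lt_trichotomy (F α a x) 0 with h1 | h1 | h1 <;>
    rcases lt_trichotomy (F α a y) 0 with h2 | h2 | h2 <;>
    first | (exfalso; tauto; done) | linarith

variable (i0 i1 : Fin m)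

def Off (x : Xs m D) : Prop := x i0 ≠ x i1 ∧ x i0 ≠ - x i1

abbrev sw (α : Finset (Fin m)) : Finset (Fin m) := α.map (Equiv.swap i0 i1).toEmbedding

lemma sw_sw (α : Finset (Fin m)) : sw i0 i1 (sw i0 i1 α) = α := by
  ext i
  simp [sw, Finset.mem_map_equiv]

open Classical in
noncomputable def bl (α : Finset (Fin m)) (a : Bool) (x : Xs m D) : ZMod 2 :=
  if |F (sw i0 i1 α) a x| < |F α a x| then 1 else
    if |F α a x| < |F (sw i0 i1 α) a x| then 0 else
      if alt (x i1) (x i0) then 1 else 0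

lemma bl_T (hT : ∀ α a x i, F α a (T i x) = if i ∈ α then - F α a x else F α a x)
    (α : Finset (Fin m)) (a : Bool) (x : Xs m D) (i : Fin m) :
    bl F i0 i1 α a (T i x) = bl F i0 i1 α a x := by
  have h : ∀ α, |F α a (T i x)| = |F α a x| := by
    intro α; rw [hT]; split_ifs <;> simp
  have h2 : ∀ j k, alt (T i x j) (T i x k) ↔ alt (x j) (x k) := by
    intro j k; rw [T_apply, T_apply]; split_ifs <;> simp [alt_neg_left, alt_neg_right]
  unfold bl
  rw [h, h]
  have h3 := h2 i1 i0
  by_cases h4 : alt (x i1) (x i0)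
  · rw [if_pos h4, if_pos (h3.2 h4)]
  · rw [if_neg h4, if_neg (fun h5 => h4 (h3.1 h5))]

lemma bl_pm (hπ : ∀ α a x, F α a (pm (Equiv.swap i0 i1) x) = F (sw i0 i1 α) a x)
    (α : Finset (Fin m)) (a : Bool) (x : Xs m D) (hx : Off i0 i1 x) :
    bl F i0 i1 α a (pm (Equiv.swap i0 i1) x) = 1 + bl F i0 i1 α a x := by
  unfold bl
  rw [hπ, hπ, sw_sw]
  have h0 : pm (Equiv.swap i0 i1) x i0 = x i1 := by simp [pm]
  have h1 : pm (Equiv.swap i0 i1) x i1 = x i0 := by simp [pm]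
  rw [h0, h1]
  rcases lt_trichotomy (|F (sw i0 i1 α) a x|) (|F α a x|) with h | h | h
  · simp only [h, not_lt.2 h.le, if_true, if_false]; decide
  · simp only [h, lt_irrefl, if_false]
    rw [alt_total hx.1 hx.2]
    by_cases h3 : alt (x i0) (x i1)
    · simp only [h3, not_true, if_true, if_false]; decide
    · simp only [h3, not_false_iff, if_true, if_false]; decide
  · simp only [h, not_lt.2 h.le, if_true, if_false]; decide

lemma bl_one {α : Finset (Fin m)} {a : Bool} {x : Xs m D} (h : bl F i0 i1 α a x = 1) :
    |F (sw i0 i1 α) a x| ≤ |F α a x| := by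
  by_contra hc
  push Not at hc
  simp [bl, hc, not_lt.2 hc.le] at h

lemma bl_zero {α : Finset (Fin m)} {a : Bool} {x : Xs m D} (h : bl F i0 i1 α a x = 0) :
    |F α a x| ≤ |F (sw i0 i1 α) a x| := by
  by_contra hc
  push Not at hc
  simp [bl, hc] at h

lemma C_small {η : ℝ} {α : Finset (Fin m)} {a : Bool} {x y : Xs m D}
    (h : Nb (lab F α a x) (lab F α a y) (lab F (sw i0 i1 α) a x) (lab F (sw i0 i1 α) a y)
      (bl F i0 i1 α a x) (bl F i0 i1 α a y) = true)
    (h1 : |F α a x - F α a y| ≤ η) (h2 : |F (sw i0 i1 α) a x - F (sw i0 i1 α) a y| ≤ η) :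
    ∃ z, (z = x ∨ z = y) ∧ |F α a z| ≤ η ∧ |F (sw i0 i1 α) a z| ≤ η := by
  rcases Nb_spec h with ⟨hs, ht⟩ | ⟨hs, hb | hb⟩ | ⟨ht, hb | hb⟩
  · exact ⟨x, Or.inl rfl, (lab_small F hs h1).1, (lab_small F ht h2).1⟩
  · exact ⟨x, Or.inl rfl, (lab_small F hs h1).1, (bl_one F i0 i1 hb).trans (lab_small F hs h1).1⟩
  · exact ⟨y, Or.inr rfl, (lab_small F hs h1).2, (bl_one F i0 i1 hb).trans (lab_small F hs h1).2⟩
  · exact ⟨x, Or.inl rfl, (bl_zero F i0 i1 hb).trans (lab_small F ht h2).1, (lab_small F ht h2).1⟩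
  · exact ⟨y, Or.inr rfl, (bl_zero F i0 i1 hb).trans (lab_small F ht h2).2, (lab_small F ht h2).2⟩

structure Nice2 (c ε η : ℝ) (M : ℕ) (n0 : Fin m → ℕ) (v : List (Xs m D) → ZMod 2)
    (p : MvPolynomial (Fin m) (ZMod 2)) (Z : Set (Finset (Fin m) × Bool)) : Prop where
  nice : Nice c ε M n0 v p
  sym : ∀ l ∈ KS c ε, (∀ x ∈ l, Off i0 i1 x) → v (l.map (pm (Equiv.swap i0 i1))) = v l
  sm : ∀ l ∈ KS c ε, v l ≠ 0 → ∀ q ∈ Z, ∃ x ∈ l, |F q.1 q.2 x| ≤ η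

/-- standing hypotheses -/
structure Hyp (c ε η : ℝ) (M : ℕ) (n0 : Fin m → ℕ) : Prop where
  hS : ∀ n ≤ n0, (hh M n : Ch (Xs m D)) ∈ Finsupp.supported (ZMod 2) (ZMod 2) (KS c ε)
  hD : ∀ i, n0 i < D
  hc : 0 < c
  hT : ∀ α a x i, F α a (T i x) = if i ∈ α then - F α a x else F α a x
  hπ : ∀ (π : Equiv.Perm (Fin m)) α a x, F α a (pm π x) = F (α.map π.toEmbedding) a x
  hmod : ∀ x ∈ KK c, ∀ y ∈ KK c, (∀ i j, |x i j - y i j| ≤ ε) →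
    ∀ α a, |F α a x - F α a y| ≤ η

variable {F i0 i1} {c ε η : ℝ} {M : ℕ} {n0 : Fin m → ℕ}

lemma Hyp.close (H : Hyp F c ε η M n0) {l : List (Xs m D)} (hl : l ∈ KS c ε) {x y : Xs m D}
    (hx : x ∈ l) (hy : y ∈ l) (α : Finset (Fin m)) (a : Bool) : |F α a x - F α a y| ≤ η :=
  H.hmod x (hl.1 x hx) y (hl.1 y hy) (hl.2 x hx y hy) α a

lemma Nice2.v0 (H : Hyp F c ε η M n0) :
    Nice2 F i0 i1 c ε η M n0 (v0 : List (Xs m D) → ZMod 2) 1 ∅ where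
  nice := Nice.v0 H.hD
  sym := by
    intro l hl _
    rcases l with _ | ⟨x, _ | ⟨y, l⟩⟩ <;> simp [GHR.v0]
  sm := by simp

lemma Nice2.W (H : Hyp F c ε η M n0) {v : List (Xs m D) → ZMod 2} {p} {Z}
    (hv : Nice2 F i0 i1 c ε η M n0 v p Z) (α : Finset (Fin m)) (a : Bool)
    (hα : sw i0 i1 α = α) :
    Nice2 F i0 i1 c ε η M n0 (W (lab F α a) v) (lin (ia α) * p) (insert (α, a) Z) where
  nice := hv.nice.W H.hS _ _ (lab_T F H.hc H.hT α a)
  sym := by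
    intro l hl ho
    rcases l with _ | ⟨x, _ | ⟨y, l⟩⟩
    · simp
    · simp [GHR.W]
    · have := hv.sym (y :: l) (KS_sub hl (fun z hz => List.mem_cons_of_mem _ hz))
        (fun z hz => ho z (List.mem_cons_of_mem _ hz))
      simp only [List.map_cons, GHR.W] at this ⊢
      have e := fun x => lab_pm F (Equiv.swap i0 i1) (H.hπ _) α a x
      replace e := fun x => (e x).trans (congrArg (fun α => lab F α a x) hα)
      rw [this, e, e]
  sm := by
    intro l hl h q hq
    rcases l with _ | ⟨x, _ | ⟨y, l⟩⟩
    · simp [GHR.W] at h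
    · simp [GHR.W] at h
    · simp only [GHR.W] at h
      rcases hq with rfl | hq
      · refine ⟨x, by simp, (lab_small F ?_ (H.close hl (x := x) (y := y) (by simp) (by simp) α a)).1⟩
        intro he
        apply h
        rw [he, chadd, zero_mul]
      · obtain ⟨z, hz, h2⟩ := hv.sm (y :: l) (KS_sub hl (fun z hz => List.mem_cons_of_mem _ hz))
          (right_ne_zero_of_mul h) q hq
        exact ⟨z, List.mem_cons_of_mem _ hz, h2⟩

lemma Nice2.C2 (H : Hyp F c ε η M n0) {v : List (Xs m D) → ZMod 2} {p} {Z}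
    (hv : Nice2 F i0 i1 c ε η M n0 v p Z) (α : Finset (Fin m)) (a : Bool) :
    Nice2 F i0 i1 c ε η M n0 (C2 (lab F α a) (lab F (sw i0 i1 α) a) (bl F i0 i1 α a) v)
      (lin (ia α) * (lin (ia (sw i0 i1 α)) * p)) (insert (α, a) (insert (sw i0 i1 α, a) Z)) where
  nice := hv.nice.C2 H.hS _ _ _ _ _ (lab_T F H.hc H.hT α a) (lab_T F H.hc H.hT _ a)
    (fun x _ i => bl_T F i0 i1 H.hT α a x i)
  sym := by
    intro l hl ho
    rcases l with _ | ⟨x, _ | ⟨y, _ | ⟨z, l⟩⟩⟩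
    · simp
    · simp [GHR.C2]
    · simp [GHR.C2]
    · have := hv.sym (z :: l) (KS_sub hl (fun z hz =>
        List.mem_cons_of_mem _ (List.mem_cons_of_mem _ hz)))
        (fun z hz => ho z (List.mem_cons_of_mem _ (List.mem_cons_of_mem _ hz)))
      simp only [List.map_cons, GHR.C2] at this ⊢
      have e := fun x => lab_pm F (Equiv.swap i0 i1) (H.hπ _) α a x
      have e' := fun x => lab_pm F (Equiv.swap i0 i1) (H.hπ _) (sw i0 i1 α) a x
      replace e' := fun x => (e' x).trans (congrArg (fun α => lab F α a x) (sw_sw i0 i1 α))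
      have eb := fun x hx => bl_pm F i0 i1 (H.hπ _) α a x hx
      rw [this]
      congr 1
      simp only [cc, ee, e, e', eb x (ho x (by simp)), eb y (ho y (by simp))]
      exact cc_alg2 _ _ _ _ _ _ _ _
  sm := by
    intro l hl h q hq
    rcases l with _ | ⟨x, _ | ⟨y, _ | ⟨z, l⟩⟩⟩
    · simp [GHR.C2] at h
    · simp [GHR.C2] at h
    · simp [GHR.C2] at h
    · simp only [GHR.C2] at h
      have key : ∃ w ∈ x :: y :: z :: l, |F α a w| ≤ η ∧ |F (sw i0 i1 α) a w| ≤ η := by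
        have h1 := left_ne_zero_of_mul h
        simp only [cc, ee] at h1
        have h2 := (cc_alg1 _ _ _ _ _ _ _ _ (bl F i0 i1 α a z)).resolve_left h1
        simp only [Bool.or_eq_true] at h2
        rcases h2 with (h2 | h2) | h2
        · obtain ⟨w, hw, g⟩ := C_small F i0 i1 h2 (H.close hl (by simp) (by simp) _ _)
            (H.close hl (by simp) (by simp) _ _)
          exact ⟨w, by rcases hw with rfl | rfl <;> simp, g⟩
        · obtain ⟨w, hw, g⟩ := C_small F i0 i1 h2 (H.close hl (by simp) (by simp) _ _)
            (H.close hl (by simp) (by simp) _ _)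
          exact ⟨w, by rcases hw with rfl | rfl <;> simp, g⟩
        · obtain ⟨w, hw, g⟩ := C_small F i0 i1 h2 (H.close hl (by simp) (by simp) _ _)
            (H.close hl (by simp) (by simp) _ _)
          exact ⟨w, by rcases hw with rfl | rfl <;> simp, g⟩
      rcases hq with rfl | rfl | hq
      · obtain ⟨w, hw, g1, g2⟩ := key; exact ⟨w, hw, g1⟩
      · obtain ⟨w, hw, g1, g2⟩ := key; exact ⟨w, hw, g2⟩
      · obtain ⟨w, hw, h2⟩ := hv.sm (z :: l) (KS_sub hl (fun z hz =>
          List.mem_cons_of_mem _ (List.mem_cons_of_mem _ hz))) (right_ne_zero_of_mul h) q hq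
        exact ⟨w, List.mem_cons_of_mem _ (List.mem_cons_of_mem _ hw), h2⟩

lemma Nice2.Ws (H : Hyp F c ε η M n0) {v : List (Xs m D) → ZMod 2} {p} {Z}
    (hv : Nice2 F i0 i1 c ε η M n0 v p Z) (Y : Finset (Finset (Fin m) × Bool))
    (hY : ∀ q ∈ Y, sw i0 i1 q.1 = q.1) :
    ∃ v', Nice2 F i0 i1 c ε η M n0 v' ((∏ q ∈ Y, lin (ia q.1)) * p) (↑Y ∪ Z) := by
  classical
  induction Y using Finset.induction_on with
  | empty => exact ⟨v, by simpa using hv⟩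
  | insert q Y hq ih =>
    obtain ⟨v', hv'⟩ := ih (fun q hq => hY q (Finset.mem_insert_of_mem hq))
    have := hv'.W H q.1 q.2 (hY q (Finset.mem_insert_self _ _))
    refine ⟨GHR.W (lab F q.1 q.2) v', ?_⟩
    rw [Finset.prod_insert hq, mul_assoc, Finset.coe_insert, Set.insert_union]
    exact this

lemma Nice2.Cs (H : Hyp F c ε η M n0) {v : List (Xs m D) → ZMod 2} {p} {Z}
    (hv : Nice2 F i0 i1 c ε η M n0 v p Z) (Y : Finset (Finset (Fin m) × Bool)) :
    ∃ v' Z', Nice2 F i0 i1 c ε η M n0 v'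
      ((∏ q ∈ Y, lin (ia q.1) * lin (ia (sw i0 i1 q.1))) * p) Z' ∧ Z ⊆ Z' ∧
      ∀ q ∈ Y, (q ∈ Z' ∧ (sw i0 i1 q.1, q.2) ∈ Z') := by
  classical
  induction Y using Finset.induction_on with
  | empty => exact ⟨v, Z, by simpa using hv, le_rfl, by simp⟩
  | insert q Y hq ih =>
    obtain ⟨v', Z', hv', h1, h2⟩ := ih
    refine ⟨GHR.C2 (lab F q.1 q.2) (lab F (sw i0 i1 q.1) q.2) (bl F i0 i1 q.1 q.2) v', insert q (insert (sw i0 i1 q.1, q.2) Z'), ?_, h1.trans ((Set.subset_insert (sw i0 i1 q.1, q.2) _).trans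
      (Set.subset_insert q _)), ?_⟩
    · have := hv'.C2 H q.1 q.2
      rw [Finset.prod_insert hq, mul_assoc, mul_assoc]
      exact this
    · intro r hr
      rcases Finset.mem_insert.1 hr with rfl | hr
      · simp
      · have := h2 r hr
        simp [this]

end
end GHR

namespace GHR
open Finsupp

section
variable {m D : ℕ} {F : Finset (Fin m) → Bool → Xs m D → ℝ} {i0 i1 : Fin m}
  {c ε η : ℝ} {M : ℕ} {n0 : Fin m → ℕ}

noncomputable def QQ (m : ℕ) : MvPolynomial (Fin m) (ZMod 2) :=
  ∏ α ∈ (Finset.univ : Finset (Finset (Fin m))).erase ∅, lin (ia α)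

lemma mem_sw (α : Finset (Fin m)) (i : Fin m) : i ∈ sw i0 i1 α ↔ Equiv.swap i0 i1 i ∈ α := by
  simp [sw, Finset.mem_map_equiv]

lemma sw_eq (α : Finset (Fin m)) : sw i0 i1 α = α ↔ (i0 ∈ α ↔ i1 ∈ α) := by
  constructor
  · intro h
    have := mem_sw (i0 := i0) (i1 := i1) α i0
    rw [h, Equiv.swap_apply_left] at this
    exact this
  · intro h
    ext i
    rw [mem_sw, Equiv.swap_apply_def]
    split_ifs with h1 h2
    · rw [h1, h]
    · rw [h2, h]
    · rfl

def A1 (i0 i1 : Fin m) : Finset (Finset (Fin m)) :=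
  Finset.univ.filter fun α => (i0 ∈ α ↔ i1 ∈ α) ∧ α ≠ ∅ ∧ α ≠ {i0, i1}

def A2 (i0 i1 : Fin m) : Finset (Finset (Fin m)) :=
  Finset.univ.filter fun α => i0 ∈ α ∧ i1 ∉ α

lemma QQ_split (i0 i1 : Fin m) : QQ m = lin (ia {i0, i1}) * ((∏ α ∈ A1 i0 i1, lin (ia α)) *
    ∏ α ∈ A2 i0 i1, (lin (ia α) * lin (ia (sw i0 i1 α)))) := by
  rw [QQ, ← Finset.prod_filter_mul_prod_filter_not _ (fun α => (i0 ∈ α ↔ i1 ∈ α)), ← mul_assoc]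
  congr 1
  · have : ((Finset.univ : Finset (Finset (Fin m))).erase ∅).filter (fun α => (i0 ∈ α ↔ i1 ∈ α)) =
        insert {i0, i1} (A1 i0 i1) := by
      ext α
      simp only [Finset.mem_filter, Finset.mem_erase, Finset.mem_univ, and_true, Finset.mem_insert,
        A1, true_and]
      by_cases h : α = {i0, i1}
      · subst h
        simp
      · simp [h]; tauto
    rw [this, Finset.prod_insert (by simp [A1])]
  · rw [Finset.prod_mul_distrib]
    have h1 : ∏ α ∈ A2 i0 i1, lin (ia (sw i0 i1 α)) = ∏ α ∈ (Finset.univ : Finset (Finset (Fin m))).filter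
        (fun α => i1 ∈ α ∧ i0 ∉ α), lin (ia α) := by
      refine Finset.prod_nbij' (sw i0 i1) (sw i0 i1) ?_ ?_ (fun α _ => sw_sw i0 i1 α)
        (fun α _ => sw_sw i0 i1 α) (fun _ _ => rfl)
      · intro α hα
        simpa [A2, mem_sw] using hα
      · intro α hα
        simpa [A2, mem_sw] using hα
    rw [h1, A2, ← Finset.prod_union]
    · congr 1
      ext α
      simp only [Finset.mem_filter, Finset.mem_erase, Finset.mem_univ, and_true, Finset.mem_union,
        true_and]
      by_cases h : α = ∅
      · subst h; simp
      · simp [h]; tauto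
    · rw [Finset.disjoint_filter]
      intro α _ h h'
      exact h.2 h'.1

theorem core (H : Hyp F c ε η M n0) (h01 : i0 ≠ i1) (hn : n0 i0 = n0 i1) (hpos : 0 < n0 i0)
    (C : ℝ) (hC : 2 * η < C) (hη : 0 ≤ η)
    (hd1 : ∀ x ∈ KK c, x i0 = x i1 → F {i0, i1} false x = C)
    (hd2 : ∀ x ∈ KK c, x i0 = - x i1 → F {i0, i1} false x = - C)
    (hpoly : ∀ P, lin (ia {i0, i1}) * P = QQ m ^ 2 →
      MvPolynomial.coeff (Finsupp.equivFunOnFinite.symm (dec n0 i0)) P = 1) :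
    ∃ x ∈ KK (m := m) (D := D) c, ∀ α, α ≠ ∅ → ∀ a, |F α a x| ≤ 2 * η := by
  classical
  have hsw : sw i0 i1 {i0, i1} = {i0, i1} := (sw_eq _).2 (by simp)
  obtain ⟨v2, Z2, hv2, -, hZ2⟩ := (Nice2.v0 (i0 := i0) (i1 := i1) H).Cs H (A2 i0 i1 ×ˢ Finset.univ)
  obtain ⟨v1, hv1⟩ := hv2.Ws H (A1 i0 i1 ×ˢ Finset.univ) (by
    rintro ⟨α, a⟩ hα
    exact (sw_eq _).2 (by simp [A1] at hα; exact hα.1))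
  set sf := lab F {i0, i1} false with hsf
  have hv := hv1.W H {i0, i1} false hsw
  have hΦ := hv.W H {i0, i1} true hsw
  set v := W sf v1 with hvdef
  have hlabσ : ∀ a x, lab F {i0, i1} a (pm (Equiv.swap i0 i1) x) = lab F {i0, i1} a x := by
    intro a x
    exact (lab_pm F (Equiv.swap i0 i1) (H.hπ _) {i0, i1} a x).trans
      (congrArg (fun α => lab F α a x) hsw)
  have hoff : ∀ x ∈ KK (m := m) (D := D) c, |F {i0, i1} false x| < C → Off i0 i1 x := by
    intro x hx h
    constructor
    · intro h'
      rw [hd1 x hx h'] at h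
      exact absurd (le_abs_self C) (not_le.2 h)
    · intro h'
      rw [hd2 x hx h', abs_neg] at h
      exact absurd (le_abs_self C) (not_le.2 h)
  obtain ⟨z, hz, hev⟩ := half H.hS h01 hn hpos hv.nice.coc hv.nice.inv
    (lab F {i0, i1} true) (ia {i0, i1}) (lab_T F H.hc H.hT _ true) (by simp [ia])
    (by intro i h1 h2; simp [ia, h1, h2])
    (by
      intro l hl
      rcases l with _ | ⟨x, _ | ⟨y, l⟩⟩
      · simp [s0]
      · simp [s0, hvdef, W]
      · simp only [List.map_cons, s0, hvdef, W, hlabσ, hsf]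
        by_cases he : lab F {i0, i1} false x = lab F {i0, i1} false y
        · rw [he, chadd]; simp
        · have hsm := lab_small F he (H.close hl (by simp) (by simp) _ _)
          congr 2
          refine hv1.sym (y :: l) (KS_sub hl (fun z hz => List.mem_cons_of_mem _ hz)) ?_
          intro w hw
          apply hoff w (hl.1 w (List.mem_cons_of_mem _ hw))
          have h1 := H.close hl (x := x) (y := w) (by simp) (List.mem_cons_of_mem _ hw)
            {i0, i1} false
          have h2 := hsm.1
          rw [abs_le] at h1 h2
          rw [abs_lt]
          constructor <;> linarith)
    (by
      intro l hl hfix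
      rcases l with _ | ⟨x, _ | ⟨y, l⟩⟩
      · simp [s0]
      · simp [s0, hvdef, W]
      · have hf := map_self_iff.1 hfix
        have hd : ∀ w ∈ x :: y :: l, lab F {i0, i1} false w = 0 := by
          intro w hw
          have h1 : w i0 = w i1 := by
            have := congrFun (hf w hw) i0
            simpa [pm] using this.symm
          have hC0 : 0 < C := by linarith
          simp [lab, hd1 w (hl.1 w hw) h1, hC0, not_lt.2 hC0.le]
        simp only [s0, hvdef, W, hsf, hd x (by simp), hd y (by simp)]
        simp)
  have hP : ev v (hh M (dec n0 i0)) = 1 := by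
    rw [hv.nice.val _ (dec_le le_rfl i0)]
    apply hpoly
    rw [QQ_split i0 i1, Finset.prod_product, Finset.prod_product]
    simp only [Finset.prod_const, Finset.card_univ, Fintype.card_bool, Finset.prod_pow]
    ring
  rw [hP] at hev
  have : ∃ l ∈ KS (m := m) (D := D) c ε, W (lab F {i0, i1} true) v l ≠ 0 := by
    by_contra hcon
    push Not at hcon
    rw [ev_eq_zero_of_sup hcon hz] at hev
    exact absurd hev (by decide)
  obtain ⟨l, hl, hne⟩ := this
  have hall : ∀ α, α ≠ ∅ → ∀ a, (α, a) ∈ insert ({i0, i1}, true) (insert ({i0, i1}, false)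
      (((A1 i0 i1 ×ˢ Finset.univ : Finset (Finset (Fin m) × Bool)) : Set _) ∪ Z2)) := by
    intro α hα a
    by_cases h1 : α = {i0, i1}
    · subst h1
      rcases a <;> simp
    · by_cases h2 : i0 ∈ α ↔ i1 ∈ α
      · right; right; left
        simp [A1, h1, h2, hα]
      · right; right; right
        by_cases h3 : i0 ∈ α
        · exact (hZ2 (α, a) (by simp [A2]; tauto)).1
        · have h4 : i1 ∈ α := by tauto
          have := (hZ2 (sw i0 i1 α, a) (by simp [A2, Finset.mem_map_equiv, h3, h4])).2
          simpa [sw_sw] using this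
  rcases l with _ | ⟨x, l⟩
  · simp [W] at hne
  refine ⟨x, hl.1 x (by simp), fun α hα a => ?_⟩
  obtain ⟨y, hy, h1⟩ := hΦ.sm (x :: l) hl hne _ (hall α hα a)
  have h2 := H.close hl (x := x) (y := y) (by simp) hy α a
  rw [abs_le] at h1 h2 ⊢
  simp only at h1
  constructor <;> linarith [h1.1, h1.2, h2.1, h2.2]

/-- the case `m = 1` -/
theorem core1 {F : Finset (Fin 1) → Bool → Xs 1 D → ℝ} {n0 : Fin 1 → ℕ}
    (H : Hyp F c ε η M n0) (hn : n0 0 = 2) :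
    ∃ x ∈ KK (m := 1) (D := D) c, ∀ α, α ≠ ∅ → ∀ a, |F α a x| ≤ 2 * η := by
  have hv := ((Nice2.v0 (i0 := 0) (i1 := 0) H).W H {0} true (by simp [sw])).W H {0} false
    (by simp [sw])
  have h1 := hv.nice.val n0 le_rfl
  have hl : lin (ia ({0} : Finset (Fin 1))) = MvPolynomial.X 0 := by
    simp [lin, ia]
  have h2 : MvPolynomial.coeff (Finsupp.equivFunOnFinite.symm n0)
      (lin (ia ({0} : Finset (Fin 1))) * (lin (ia ({0} : Finset (Fin 1))) * 1)) = 1 := by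
    rw [hl, mul_one, ← pow_two, MvPolynomial.coeff_X_pow, if_pos]
    refine Finsupp.ext fun i => ?_
    have : i = 0 := Subsingleton.elim _ _
    subst this
    simp [hn]
  rw [h2] at h1
  have : ∃ l ∈ KS (m := 1) (D := D) c ε, W (lab F {0} false) (W (lab F {0} true) v0) l ≠ 0 := by
    by_contra hcon
    push Not at hcon
    rw [ev_eq_zero_of_sup hcon (H.hS _ le_rfl)] at h1
    exact absurd h1 (by decide)
  obtain ⟨l, hl, hne⟩ := this
  rcases l with _ | ⟨x, l⟩
  · simp [W] at hne
  refine ⟨x, hl.1 x (by simp), fun α hα a => ?_⟩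
  have hα' : α = {0} := by
    ext i
    have : i = 0 := Subsingleton.elim _ _
    subst this
    obtain ⟨j, hj⟩ := Finset.nonempty_of_ne_empty hα
    have : j = 0 := Subsingleton.elim _ _
    subst this
    simpa using hj
  subst hα'
  obtain ⟨y, hy, h1⟩ := hv.sm (x :: l) hl hne ({0}, a) (by rcases a <;> simp)
  have h2 := H.close hl (x := x) (y := y) (by simp) hy {0} a
  rw [abs_le] at h1 h2 ⊢
  simp only at h1
  constructor <;> linarith [h1.1, h1.2, h2.1, h2.2]

end
end GHR

namespace GHR
open Finsupp

section
variable {m : ℕ}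
open MvPolynomial

lemma lin_ia (α : Finset (Fin m)) : lin (ia α) = ∑ i ∈ α, (X i : MvPolynomial (Fin m) (ZMod 2)) := by
  simp [lin, ia, Finset.sum_ite_mem]

lemma lin_ia_insert {α : Finset (Fin m)} {i : Fin m} (h : i ∉ α) :
    lin (ia (insert i α)) = X i + lin (ia α) := by
  rw [lin_ia, lin_ia, Finset.sum_insert h]

lemma lin_supp {s α : Finset (Fin m)} (h : α ⊆ s) :
    lin (ia α) ∈ MvPolynomial.supported (ZMod 2) (s : Set (Fin m)) := by
  rw [lin_ia]
  refine Subalgebra.sum_mem _ fun i hi => ?_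
  exact X_mem_supported.2 (h hi)

lemma linz (s : Finset (Fin m)) : ∃ cf : ℕ → MvPolynomial (Fin m) (ZMod 2),
    (∀ j, cf j ∈ MvPolynomial.supported (ZMod 2) (s : Set (Fin m))) ∧ cf s.card = 1 ∧
    (∀ j, s.card < j → cf j = 0) ∧
    ∀ y, ∏ α ∈ s.powerset, (y + lin (ia α)) = ∑ j ∈ Finset.range (s.card + 1), cf j * y ^ 2 ^ j := by
  classical
  induction s using Finset.induction_on with
  | empty =>
    refine ⟨fun j => if j = 0 then 1 else 0, ?_, by simp, ?_, ?_⟩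
    · intro j; dsimp only; split_ifs
      · exact Subalgebra.one_mem _
      · exact Subalgebra.zero_mem _
    · intro j hj
      simp at hj
      simp [hj.ne']
    · intro y; simp [lin_ia]
  | insert i s hi ih =>
    obtain ⟨cf, h1, h2, h3, h4⟩ := ih
    set g : MvPolynomial (Fin m) (ZMod 2) → MvPolynomial (Fin m) (ZMod 2) :=
      fun y => ∑ j ∈ Finset.range (s.card + 1), cf j * y ^ 2 ^ j with hg
    have hle : MvPolynomial.supported (ZMod 2) (s : Set (Fin m)) ≤
        MvPolynomial.supported (ZMod 2) ((insert i s : Finset (Fin m)) : Set (Fin m)) :=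
      MvPolynomial.supported_mono (by simp)
    have hgi : g (X i) ∈ MvPolynomial.supported (ZMod 2) ((insert i s : Finset (Fin m)) : Set (Fin m)) := by
      refine Subalgebra.sum_mem _ fun j _ => Subalgebra.mul_mem _ (hle (h1 j)) ?_
      exact Subalgebra.pow_mem _ (X_mem_supported.2 (by simp)) _
    refine ⟨fun j => (if j = 0 then 0 else cf (j - 1) ^ 2) + g (X i) * cf j, ?_, ?_, ?_, ?_⟩
    · intro j
      refine Subalgebra.add_mem _ ?_ (Subalgebra.mul_mem _ hgi (hle (h1 j)))
      split_ifs
      · exact Subalgebra.zero_mem _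
      · exact Subalgebra.pow_mem _ (hle (h1 _)) _
    · rw [Finset.card_insert_of_notMem hi]
      simp [h2, h3]
    · intro j hj
      rw [Finset.card_insert_of_notMem hi] at hj
      have : s.card < j - 1 := by omega
      simp [h3 j (by omega), h3 _ this]
    · intro y
      rw [Finset.prod_powerset_insert hi, h4]
      have e1 : ∏ t ∈ s.powerset, (y + lin (ia (insert i t))) = g (y + X i) := by
        rw [hg]
        simp only
        rw [← h4]
        refine Finset.prod_congr rfl fun t ht => ?_
        rw [lin_ia_insert (fun h => hi (Finset.mem_powerset.1 ht h)), add_assoc]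
      have e2 : g (y + X i) = g y + g (X i) := by
        simp only [hg]
        rw [← Finset.sum_add_distrib]
        refine Finset.sum_congr rfl fun j _ => ?_
        rw [add_pow_char_pow, mul_add]
      have e3 : g y ^ 2 = ∑ j ∈ Finset.range (s.card + 1), cf j ^ 2 * y ^ 2 ^ (j + 1) := by
        simp only [hg]
        rw [sum_pow_char 2]
        refine Finset.sum_congr rfl fun j _ => ?_
        rw [mul_pow, ← pow_mul, pow_succ 2 j]
      have e4 : ∑ j ∈ Finset.range (s.card + 1 + 1), (if j = 0 then 0 else cf (j - 1) ^ 2) * y ^ 2 ^ j = g y ^ 2 := by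
        rw [e3, Finset.sum_range_succ']
        simp
      have e5 : ∑ j ∈ Finset.range (s.card + 1 + 1), (g (X i) * cf j) * y ^ 2 ^ j = g (X i) * g y := by
        rw [Finset.sum_range_succ, h3 (s.card + 1) (by omega)]
        simp only [hg, Finset.mul_sum, mul_zero, zero_mul, add_zero, mul_assoc]
      rw [e1, e2, Finset.card_insert_of_notMem hi]
      simp only [add_mul]
      rw [Finset.sum_add_distrib, e4, e5]
      change g y * _ = g y ^ 2 + g (X i) * g y
      ring

noncomputable def Qs (s : Finset (Fin m)) : MvPolynomial (Fin m) (ZMod 2) :=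
  ∏ α ∈ s.powerset.erase ∅, lin (ia α)

lemma Qs_supp (s : Finset (Fin m)) : Qs s ∈ MvPolynomial.supported (ZMod 2) (s : Set (Fin m)) := by
  refine Subalgebra.prod_mem _ fun α hα => lin_supp ?_
  exact Finset.mem_powerset.1 (Finset.mem_of_mem_erase hα)

lemma Qs_insert {s : Finset (Fin m)} {i : Fin m} (hi : i ∉ s) :
    Qs (insert i s) = Qs s * ∏ α ∈ s.powerset, (X i + lin (ia α)) := by
  have h1 : (insert i s).powerset.erase ∅ = s.powerset.erase ∅ ∪ s.powerset.image (insert i) := by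
    rw [Finset.powerset_insert, Finset.erase_union_distrib, Finset.erase_eq_of_notMem (s := Finset.image _ _)]
    simp
  rw [Qs, h1, Finset.prod_union, Finset.prod_image, Qs]
  · congr 1
    refine Finset.prod_congr rfl fun t ht => ?_
    rw [lin_ia_insert (fun h => hi (Finset.mem_powerset.1 ht h))]
  · intro a ha b hb hab
    have ha' : i ∉ a := fun h => hi (Finset.mem_powerset.1 ha h)
    have hb' : i ∉ b := fun h => hi (Finset.mem_powerset.1 hb h)
    have := congrArg (fun t => Finset.erase t i) hab
    simpa [ha', hb'] using this
  · rw [Finset.disjoint_left]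
    intro a ha hb
    obtain ⟨b, -, rfl⟩ := Finset.mem_image.1 hb
    exact hi (Finset.mem_powerset.1 (Finset.mem_of_mem_erase ha) (Finset.mem_insert_self i b))

lemma coeff_mul_X_supp {s : Finset (Fin m)} {i : Fin m} (hi : i ∉ s)
    {g : MvPolynomial (Fin m) (ZMod 2)}
    (hg : g ∈ MvPolynomial.supported (ZMod 2) (s : Set (Fin m))) (n : Fin m →₀ ℕ) (e : ℕ) :
    coeff n (g * X i ^ e) = if n i = e then coeff (n.erase i) g else 0 := by
  classical
  have hz : ∀ d : Fin m →₀ ℕ, d i ≠ 0 → coeff d g = 0 := by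
    intro d hd
    by_contra hc
    have : i ∈ g.vars := mem_vars_iff_mem_support i |>.2 ⟨d, MvPolynomial.mem_support_iff.2 hc, by simpa using hd⟩
    exact hi (by simpa using (mem_supported.1 hg) this)
  rw [X_pow_eq_monomial, coeff_mul_monomial', mul_one]
  split_ifs with h1 h2 h2
  · congr 1
    ext j
    by_cases hj : j = i
    · subst hj; simp [h2]
    · simp [hj, Finsupp.single_apply, Ne.symm hj]
  · apply hz
    rw [Finsupp.single_le_iff] at h1
    simp; omega
  · exact absurd (Finsupp.single_le_iff.2 h2.ge) h1
  · rfl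

lemma Qs_coeff {s : Finset (Fin m)} {i : Fin m} (hi : i ∉ s) (n : Fin m →₀ ℕ) :
    (coeff n (Qs (insert i s)) ≠ 0 → ∃ j ≤ s.card, n i = 2 ^ j) ∧
    (n i = 2 ^ s.card → coeff n (Qs (insert i s)) = coeff (n.erase i) (Qs s)) := by
  obtain ⟨cf, h1, h2, h3, h4⟩ := linz s
  have key : coeff n (Qs (insert i s)) = ∑ j ∈ Finset.range (s.card + 1),
      if n i = 2 ^ j then coeff (n.erase i) (Qs s * cf j) else 0 := by
    rw [Qs_insert hi, h4, Finset.mul_sum, coeff_sum]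
    refine Finset.sum_congr rfl fun j _ => ?_
    rw [← mul_assoc, coeff_mul_X_supp hi (Subalgebra.mul_mem _ (Qs_supp s) (h1 j))]
  rw [key]
  constructor
  · intro h
    obtain ⟨j, hj, hne⟩ := Finset.exists_ne_zero_of_sum_ne_zero h
    refine ⟨j, by simpa [Nat.lt_succ_iff] using hj, ?_⟩
    by_contra hc
    simp [hc] at hne
  · intro h
    rw [Finset.sum_eq_single s.card]
    · simp [h, h2]
    · intro j _ hj
      rw [if_neg]
      rw [h]
      intro h'
      exact hj (Nat.pow_right_injective le_rfl h').symm
    · simp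

lemma QQ_eq : QQ m = Qs (Finset.univ : Finset (Fin m)) := by
  simp [QQ, Qs]

lemma QQ_pow2 {n : Fin m →₀ ℕ} (h : coeff n (QQ m) ≠ 0) (i : Fin m) :
    ∃ j, n i = 2 ^ j := by
  have h1 : insert i (Finset.univ.erase i) = (Finset.univ : Finset (Fin m)) :=
    Finset.insert_erase (Finset.mem_univ i)
  rw [QQ_eq, ← h1] at h
  obtain ⟨j, -, hj⟩ := (Qs_coeff (Finset.notMem_erase i _) n).1 h
  exact ⟨j, hj⟩

lemma QQ_perm (e : Equiv.Perm (Fin m)) :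
    coeff (Finsupp.equivFunOnFinite.symm fun i => 2 ^ (e i).val) (QQ m) = 1 := by
  classical
  have key : ∀ k ≤ m, coeff (Finsupp.equivFunOnFinite.symm
      fun i => if (e i).val < k then 2 ^ (e i).val else 0)
      (Qs (Finset.univ.filter fun i => (e i).val < k)) = 1 := by
    intro k
    induction k with
    | zero =>
      intro _
      simp only [Nat.not_lt_zero, Finset.filter_false, if_false]
      have h0 : (Finsupp.equivFunOnFinite.symm fun _ => 0 : Fin m →₀ ℕ) = 0 := by ext; simp
      rw [h0]
      simp [Qs]
    | succ k ih =>
      intro hk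
      have ih := ih (by omega)
      set i := e.symm ⟨k, hk⟩ with hi
      have hei : (e i).val = k := by simp [hi]
      have huniq : ∀ j, (e j).val = k → j = i := by
        intro j hj
        apply e.injective
        ext; rw [hj, hei]
      have h1 : (Finset.univ.filter fun j => (e j).val < k + 1) =
          insert i (Finset.univ.filter fun j => (e j).val < k) := by
        ext j
        simp only [Finset.mem_filter, Finset.mem_univ, true_and, Finset.mem_insert]
        constructor
        · intro h
          rcases Nat.lt_succ_iff_lt_or_eq.1 h with h | h
          · exact Or.inr h
          · exact Or.inl (huniq j h)
        · rintro (rfl | h) <;> omega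
      have hni : i ∉ Finset.univ.filter fun j => (e j).val < k := by simp [hei]
      have hcard : (Finset.univ.filter fun j => (e j).val < k).card = k := by
        have h5 : (Finset.univ.filter fun j => (e j).val < k).card =
            (Finset.univ.filter fun j : Fin m => j.val < k).card :=
          Finset.card_equiv e (by intro j; simp)
        rw [h5, Fin.card_filter_val_lt]
        omega
      rw [h1, (Qs_coeff hni _).2, ← ih]
      · congr 1
        ext j
        by_cases hj : j = i
        · subst hj; simp [hei]
        · have : (e j).val ≠ k := fun h => hj (huniq j h)
          simp only [Finsupp.erase_ne hj, Finsupp.equivFunOnFinite_symm_apply_apply]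
          have h3 : (e j).val < k + 1 ↔ (e j).val < k := by omega
          simp only [h3]
      · rw [hcard]; simp [hei]
  have := key m le_rfl
  rw [QQ_eq]
  simpa using this

lemma QQ_sq (n : Fin m →₀ ℕ) : (∀ i, ¬ 2 ∣ n i → coeff n (QQ m ^ 2) = 0) ∧
    coeff (2 • n) (QQ m ^ 2) = coeff n (QQ m) := by
  rw [← expand_zmod]
  exact ⟨fun i hi => coeff_expand_of_not_dvd _ hi, coeff_expand_smul 2 (by norm_num) _ _⟩

end

section
variable {m' : ℕ}

def pt (x y : ℕ) : Fin (m' + 2) → ℕ := fun k => if k = 0 then x else if k = 1 then y else 2 ^ k.val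

def ef (k : Fin (m' + 2)) : Fin (m' + 2) :=
  if k = 0 then 0 else if k = 1 then ⟨m' + 1, by omega⟩ else ⟨k.val - 1, by omega⟩

lemma ef_val (k : Fin (m' + 2)) : (ef k).val =
    if k.val = 0 then 0 else if k.val = 1 then m' + 1 else k.val - 1 := by
  unfold ef
  simp only [Fin.ext_iff, Fin.val_zero, Fin.val_one]
  split_ifs <;> rfl

lemma ef_inj : Function.Injective (ef (m' := m')) := by
  intro a b hab
  have h := congrArg Fin.val hab
  rw [ef_val, ef_val] at h
  have ha := a.2
  have hb := b.2
  apply Fin.ext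
  split_ifs at h <;> omega

open MvPolynomial in
lemma QQ_special : coeff (Finsupp.equivFunOnFinite.symm fun k : Fin (m' + 2) =>
    if k = 0 then 1 else if k = 1 then 2 ^ (m' + 1) else 2 ^ (k.val - 1)) (QQ (m' + 2)) = 1 := by
  rw [← QQ_perm (Equiv.ofBijective ef (Finite.injective_iff_bijective.1 ef_inj))]
  congr 1
  ext k
  simp only [Finsupp.equivFunOnFinite_symm_apply_apply, Equiv.ofBijective_apply, ef]
  split_ifs
  · simp
  · rfl
  · rfl

open MvPolynomial in
lemma poly_final (P : MvPolynomial (Fin (m' + 2)) (ZMod 2)) (hP : lin (ia {0, 1}) * P = QQ (m' + 2) ^ 2) :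
    coeff (Finsupp.equivFunOnFinite.symm (pt (2 ^ (m' + 1)) (2 ^ (m' + 1) + 1))) P = 1 := by
  set q := 2 ^ (m' + 1) with hq
  have hq2 : 2 ≤ q := by rw [hq, pow_succ]; have := Nat.one_le_two_pow (n := m'); omega
  have h10 : (1 : Fin (m' + 2)) ≠ 0 := by simp
  have hdec0 : ∀ x y, dec (pt (m' := m') x y) 0 = pt (x - 1) y := by
    intro x y; ext k; simp only [dec, Function.update_apply, pt]; split_ifs <;> simp_all
  have hdec1 : ∀ x y, dec (pt (m' := m') x y) 1 = pt x (y - 1) := by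
    intro x y; ext k; simp only [dec, Function.update_apply, pt]; split_ifs <;> simp_all
  have hrec : ∀ x y, coeff (Finsupp.equivFunOnFinite.symm (pt x y)) (QQ (m' + 2) ^ 2) =
      (if 0 < x then coeff (Finsupp.equivFunOnFinite.symm (pt (x - 1) y)) P else 0) +
      (if 0 < y then coeff (Finsupp.equivFunOnFinite.symm (pt x (y - 1))) P else 0) := by
    intro x y
    rw [← hP, coeff_lin, Fintype.sum_eq_add 0 1 h10.symm]
    · rw [hdec0, hdec1]
      simp [pt, ia]
    · rintro k ⟨h0, h1⟩
      simp [ia, h0, h1]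
  have hodd : ∀ x y, ¬ 2 ∣ x → coeff (Finsupp.equivFunOnFinite.symm (pt (m' := m') x y)) (QQ (m' + 2) ^ 2) = 0 := by
    intro x y hx
    refine (QQ_sq _).1 0 ?_
    simpa [pt] using hx
  have heven : ∀ x y, coeff (Finsupp.equivFunOnFinite.symm (pt (m' := m') (2 * x) (2 * y))) (QQ (m' + 2) ^ 2) =
      coeff (Finsupp.equivFunOnFinite.symm fun k : Fin (m' + 2) => if k = 0 then x else if k = 1 then y else 2 ^ (k.val - 1)) (QQ (m' + 2)) := by
    intro x y
    rw [← (QQ_sq _).2]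
    congr 1
    ext k
    simp only [Finsupp.equivFunOnFinite_symm_apply_apply, Finsupp.smul_apply, smul_eq_mul, pt]
    split_ifs with h0 h1
    · rfl
    · rfl
    · have : k.val ≠ 0 := fun h => h0 (Fin.ext h)
      obtain ⟨j, hj⟩ := Nat.exists_eq_succ_of_ne_zero this
      rw [hj, pow_succ]; simp [mul_comm]
  have hzero : ∀ i, i + 1 ≤ q → i ≠ 1 → coeff (Finsupp.equivFunOnFinite.symm (pt (m' := m') (i + 1) (2 * q + 1 - i))) (QQ (m' + 2) ^ 2) = 0 := by
    intro i hi hi1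
    by_cases h2 : 2 ∣ i + 1
    · obtain ⟨x, hx⟩ := h2
      have e : 2 * q + 1 - i = 2 * (q + 1 - x) := by omega
      rw [hx, e, heven]
      by_contra hc
      obtain ⟨a, ha⟩ := QQ_pow2 hc 0
      obtain ⟨b, hb⟩ := QQ_pow2 hc 1
      simp at ha hb
      have hb1 : b < m' + 2 := by
        by_contra hcon
        have : 2 ^ (m' + 2) ≤ 2 ^ b := Nat.pow_le_pow_right (by norm_num) (by omega)
        have e3 : 2 ^ (m' + 2) = 2 * q := by rw [hq]; ring
        omega
      have hb2 : m' < b := by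
        by_contra hcon
        have : 2 ^ b ≤ 2 ^ m' := Nat.pow_le_pow_right (by norm_num) (by omega)
        have e3 : q = 2 * 2 ^ m' := by rw [hq]; ring
        omega
      have : b = m' + 1 := by omega
      rw [this] at hb
      omega
    · exact hodd _ _ h2
  have hone : coeff (Finsupp.equivFunOnFinite.symm (pt (m' := m') 2 (2 * q))) (QQ (m' + 2) ^ 2) = 1 := by
    have := heven 1 q
    rw [mul_one] at this
    rw [this]
    exact QQ_special
  set A : ℕ → ZMod 2 := fun i => coeff (Finsupp.equivFunOnFinite.symm (pt i (2 * q + 1 - i))) P with hA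
  have hA0 : A 0 = 0 := by
    have h1 := hrec 0 (2 * q + 2)
    simp only [lt_irrefl, if_false, zero_add] at h1
    rw [if_pos (by omega)] at h1
    have h2 : coeff (Finsupp.equivFunOnFinite.symm (pt (m' := m') 0 (2 * q + 2))) (QQ (m' + 2) ^ 2) = 0 := by
      have h3 := heven 0 (q + 1)
      rw [mul_zero, mul_add, mul_one] at h3
      rw [h3]
      by_contra hc
      obtain ⟨a, ha⟩ := QQ_pow2 hc 0
      simp at ha
      exact absurd ha.symm (by positivity)
    rw [h2] at h1
    exact h1.symm
  have hAs : ∀ i, i + 1 ≤ q → A i + A (i + 1) = if i = 1 then 1 else 0 := by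
    intro i hi
    have h1 := hrec (i + 1) (2 * q + 1 - i)
    rw [if_pos (by omega), if_pos (by omega)] at h1
    have e2 : 2 * q + 1 - i - 1 = 2 * q + 1 - (i + 1) := by omega
    rw [e2, Nat.add_sub_cancel] at h1
    change _ = A i + A (i + 1) at h1
    rw [← h1]
    split_ifs with hi1
    · subst hi1
      rw [show 2 * q + 1 - 1 = 2 * q by omega]
      exact hone
    · exact hzero i hi hi1
  have hall : ∀ i, i ≤ q → A i = if 2 ≤ i then 1 else 0 := by
    intro i
    induction i with
    | zero => intro _; simpa using hA0
    | succ i ih =>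
      intro hi
      have h1 := hAs i hi
      rw [ih (by omega)] at h1
      have e : ∀ a b c : ZMod 2, a + b = c → b = a + c := by decide
      rw [e _ _ _ h1]
      by_cases h2 : i = 1
      · subst h2; simp
      · by_cases h3 : 2 ≤ i
        · simp [h2, h3, show 2 ≤ i + 1 by omega]
        · simp [h2, h3, show ¬ 2 ≤ i + 1 by omega]
  have := hall q le_rfl
  rw [if_pos hq2] at this
  rw [← this, hA]
  simp only
  congr 3
  omega

end
end GHR

namespace GHR
section
variable {m d : ℕ}

noncomputable def aff (v : Fin (d + 1) → ℝ) : (Fin d → ℝ) →ᵃ[ℝ] ℝ :=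
  (∑ j : Fin d, v j.succ • (LinearMap.proj j : (Fin d → ℝ) →ₗ[ℝ] ℝ)).toAffineMap + AffineMap.const ℝ _ (v 0)

lemma aff_apply (v : Fin (d + 1) → ℝ) (y : Fin d → ℝ) : aff v y = (∑ j : Fin d, v j.succ * y j) + v 0 := by
  simp [aff]

lemma aff_neg (v : Fin (d + 1) → ℝ) (y : Fin d → ℝ) : aff (-v) y = - aff v y := by
  simp [aff_apply, Finset.sum_neg_distrib]; ring

lemma aff_linear (v : Fin (d + 1) → ℝ) (h : (aff v).linear = 0) : ∀ j : Fin d, v j.succ = 0 := by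
  intro j
  have h1 := congrArg (fun l => l (Pi.single j 1)) h
  simpa [aff, Pi.single_apply] using h1

lemma aff_lin0 (v : Fin (d + 1) → ℝ) (h : (aff v).linear = 0) (y : Fin d → ℝ) : aff v y = v 0 := by
  simp [aff_apply, aff_linear v h]

lemma aff_lin0_ne (v : Fin (d + 1) → ℝ) (hv : v ≠ 0) (h : (aff v).linear = 0) : v 0 ≠ 0 := by
  intro h0
  apply hv
  ext j
  refine Fin.cases ?_ ?_ j
  · exact h0
  · intro j; exact aff_linear v h j

lemma aff_cont_y (v : Fin (d + 1) → ℝ) : Continuous (fun y => aff v y) := by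
  simp only [aff_apply]; fun_prop

lemma aff_cont_v (y : Fin d → ℝ) : Continuous (fun v : Fin (d + 1) → ℝ => aff v y) := by
  simp only [aff_apply]; fun_prop

lemma aff_null {ν : Measure (Fin d → ℝ)} (hν : IsMass ν) {v : Fin (d + 1) → ℝ} (hv : v ≠ 0) :
    ∀ᵐ y ∂ν, aff v y ≠ 0 := by
  by_cases h : (aff v).linear = 0
  · exact Filter.Eventually.of_forall fun y => by
      rw [aff_lin0 v h]; exact aff_lin0_ne v hv h
  · have := hν.2 _ h
    rw [ae_iff]
    simpa using this

lemma sign_meas : Measurable Real.sign := by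
  unfold Real.sign
  exact Measurable.ite measurableSet_Iio measurable_const
    (Measurable.ite measurableSet_Ioi measurable_const measurable_const)

lemma sign_abs (r : ℝ) : |Real.sign r| ≤ 1 := by
  unfold Real.sign; split_ifs <;> simp

lemma sign_cont {r : ℝ} (h : r ≠ 0) : ContinuousAt Real.sign r := by
  rcases lt_or_gt_of_ne h with h | h
  · have : Real.sign =ᶠ[nhds r] fun _ => -1 := by
      filter_upwards [Iio_mem_nhds h] with x hx
      exact Real.sign_of_neg hx
    exact continuousAt_const.congr this.symm
  · have : Real.sign =ᶠ[nhds r] fun _ => 1 := by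
      filter_upwards [Ioi_mem_nhds h] with x hx
      exact Real.sign_of_pos hx
    exact continuousAt_const.congr this.symm

noncomputable def spr (α : Finset (Fin m)) (x : Xs m (d + 1)) (y : Fin d → ℝ) : ℝ :=
  ∏ i ∈ α, Real.sign (aff (x i) y)

lemma pr_meas (α : Finset (Fin m)) (x : Xs m (d + 1)) : Measurable (spr α x) := by
  unfold spr
  exact Finset.measurable_prod _ fun i _ => sign_meas.comp (aff_cont_y _).measurable

lemma pr_abs (α : Finset (Fin m)) (x : Xs m (d + 1)) (y : Fin d → ℝ) : ‖spr α x y‖ ≤ 1 := by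
  rw [Real.norm_eq_abs, spr, Finset.abs_prod]
  exact Finset.prod_le_one (fun _ _ => abs_nonneg _) fun _ _ => sign_abs _

lemma pr_int {ν : Measure (Fin d → ℝ)} [IsFiniteMeasure ν] (α : Finset (Fin m)) (x : Xs m (d + 1)) :
    Integrable (spr α x) ν :=
  Integrable.of_bound (pr_meas α x).aestronglyMeasurable 1 (Filter.Eventually.of_forall (pr_abs α x))

noncomputable def FF (ν : Bool → Measure (Fin d → ℝ)) (α : Finset (Fin m)) (a : Bool) (x : Xs m (d + 1)) : ℝ :=
  ∫ y, spr α x y ∂(ν a)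

lemma int_cont {ν : Measure (Fin d → ℝ)} (hν : IsMass ν) (α : Finset (Fin m)) (x : Xs m (d + 1))
    (hx : ∀ i, x i ≠ 0) : ContinuousAt (fun x : Xs m (d + 1) => ∫ y, spr α x y ∂ν) x := by
  have := hν.1
  refine tendsto_integral_filter_of_dominated_convergence (fun _ => 1) ?_ ?_ (integrable_const _) ?_
  · exact Filter.Eventually.of_forall fun z => (pr_meas α z).aestronglyMeasurable
  · exact Filter.Eventually.of_forall fun z => Filter.Eventually.of_forall (pr_abs α z)
  · have h1 : ∀ᵐ y ∂ν, ∀ i, aff (x i) y ≠ 0 := ae_all_iff.2 fun i => aff_null hν (hx i)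
    filter_upwards [h1] with y hy
    unfold spr
    refine tendsto_finsetProd _ fun i _ => ?_
    have h2 : ContinuousAt (fun z : Xs m (d + 1) => aff (z i) y) x :=
      ((aff_cont_v y).comp (continuous_apply i)).continuousAt
    exact ContinuousAt.comp (f := fun z : Xs m (d + 1) => aff (z i) y) (sign_cont (hy i)) h2

lemma FF_T (ν : Bool → Measure (Fin d → ℝ)) (α : Finset (Fin m)) (a : Bool) (x : Xs m (d + 1)) (i : Fin m) :
    FF ν α a (T i x) = if i ∈ α then - FF ν α a x else FF ν α a x := by
  classical
  have key : ∀ y, spr α (T i x) y = if i ∈ α then - spr α x y else spr α x y := by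
    intro y
    have h1 : ∀ k ∈ α, Real.sign (aff (T i x k) y) = (if k = i then -1 else 1) * Real.sign (aff (x k) y) := by
      intro k _
      rw [T_apply]
      split_ifs
      · rw [aff_neg, Real.sign_neg]; ring
      · ring
    unfold spr
    rw [Finset.prod_congr rfl h1, Finset.prod_mul_distrib, Finset.prod_ite_eq' α i]
    split_ifs <;> ring
  unfold FF
  simp only [key]
  split_ifs
  · rw [integral_neg]
  · rfl

lemma FF_pm (ν : Bool → Measure (Fin d → ℝ)) (π : Equiv.Perm (Fin m)) (α : Finset (Fin m)) (a : Bool)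
    (x : Xs m (d + 1)) : FF ν α a (pm π x) = FF ν (α.map π.toEmbedding) a x := by
  simp [FF, spr, pm, Finset.prod_map]

lemma FF_diag1 {ν : Bool → Measure (Fin d → ℝ)} (hν : ∀ a, IsMass (ν a)) {i0 i1 : Fin m} (h01 : i0 ≠ i1) (a : Bool)
    (x : Xs m (d + 1)) (hx : ∀ i, x i ≠ 0) (h : x i0 = x i1) :
    FF ν {i0, i1} a x = (ν a Set.univ).toReal := by
  have : ∀ᵐ y ∂(ν a), spr {i0, i1} x y = 1 := by
    filter_upwards [aff_null (hν a) (hx i1)] with y hy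
    rw [spr, Finset.prod_pair h01, h]
    rcases Real.sign_apply_eq_of_ne_zero _ hy with h | h <;> rw [h] <;> norm_num
  rw [FF, integral_congr_ae this]
  simp [Measure.real]

lemma FF_diag2 {ν : Bool → Measure (Fin d → ℝ)} (hν : ∀ a, IsMass (ν a)) {i0 i1 : Fin m} (h01 : i0 ≠ i1) (a : Bool)
    (x : Xs m (d + 1)) (hx : ∀ i, x i ≠ 0) (h : x i0 = - x i1) :
    FF ν {i0, i1} a x = - (ν a Set.univ).toReal := by
  have : ∀ᵐ y ∂(ν a), spr {i0, i1} x y = -1 := by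
    filter_upwards [aff_null (hν a) (hx i1)] with y hy
    rw [spr, Finset.prod_pair h01, h, aff_neg, Real.sign_neg]
    rcases Real.sign_apply_eq_of_ne_zero _ hy with h | h <;> rw [h] <;> norm_num
  rw [FF, integral_congr_ae this]
  simp [Measure.real]

lemma KK_compact (c : ℝ) : IsCompact (KK c : Set (Xs m (d + 1))) := by
  have hcl : IsClosed (KK c : Set (Xs m (d + 1))) := by
    have : (KK c : Set (Xs m (d + 1))) = ⋂ i, ((⋂ j, {x | |x i j| ≤ 1}) ∩ ⋃ j, {x | c ≤ |x i j|}) := by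
      ext x; simp [KK]
    rw [this]
    refine isClosed_iInter fun i => IsClosed.inter (isClosed_iInter fun j => ?_) (isClosed_iUnion_of_finite fun j => ?_)
    · exact isClosed_le (by fun_prop) continuous_const
    · exact isClosed_le continuous_const (by fun_prop)
  have hc2 : IsCompact (Set.univ.pi fun _ : Fin m => Set.univ.pi fun _ : Fin (d + 1) => Set.Icc (-1 : ℝ) 1) :=
    isCompact_univ_pi fun _ => isCompact_univ_pi fun _ => isCompact_Icc
  refine hc2.of_isClosed_subset hcl ?_
  intro x hx i _ j _
  exact abs_le.1 ((hx i).1 j)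

lemma exists_zero (ν : Bool → Measure (Fin d → ℝ)) (hν : ∀ a, IsMass (ν a)) (n0 : Fin m → ℕ)
    (hD : ∀ i, n0 i < d + 1) (C : ℝ) (hC : 0 < C)
    (hcore : ∀ (c ε η : ℝ) (M : ℕ), 0 ≤ η → 2 * η < C → Hyp (FF ν) c ε η M n0 →
      ∃ x ∈ (KK c : Set (Xs m (d + 1))), ∀ α, α ≠ ∅ → ∀ a, |FF ν α a x| ≤ 2 * η) :
    ∃ x : Xs m (d + 1), (∀ i, x i ≠ 0) ∧ ∀ α, α ≠ ∅ → ∀ a, FF ν α a x = 0 := by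
  set N := ∑ i, n0 i with hN
  set c : ℝ := 1 / ((N : ℝ) + 1) with hc
  have hc0 : 0 < c := by positivity
  have hcont : ∀ α a, ContinuousOn (FF ν α a) (KK c : Set (Xs m (d + 1))) := fun α a x hx =>
    (int_cont (hν a) α x (fun i => KK_ne hc0 hx i)).continuousWithinAt
  let G : Xs m (d + 1) → (Finset (Fin m) × Bool → ℝ) := fun x p => FF ν p.1 p.2 x
  have hG : ContinuousOn G (KK c) := continuousOn_pi.2 fun p => hcont p.1 p.2
  have hu := (KK_compact c).uniformContinuousOn_of_continuous hG
  rw [Metric.uniformContinuousOn_iff] at hu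
  have hap : ∀ η, 0 < η → 2 * η < C → ∃ x ∈ (KK c : Set (Xs m (d + 1))), ∀ α, α ≠ ∅ → ∀ a, |FF ν α a x| ≤ 2 * η := by
    intro η hη hηC
    obtain ⟨δ, hδ, hd⟩ := hu η hη
    obtain ⟨M, hM⟩ := exists_nat_gt ((N : ℝ) * 2 / δ)
    have hM1 : (0 : ℝ) < (M : ℝ) + 1 := by positivity
    have hlt : (N : ℝ) * (2 / ((M : ℝ) + 1)) < δ := by
      rw [div_lt_iff₀ hδ] at hM
      rw [← mul_div_assoc, div_lt_iff₀ hM1]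
      nlinarith
    refine hcore c (N * (2 / ((M : ℝ) + 1))) η M hη.le hηC ⟨?_, hD, hc0, FF_T ν, FF_pm ν, ?_⟩
    · intro n hn
      exact hh_KS M N n (fun i => (hn i).trans_lt (hD i)) (Finset.sum_le_sum fun i _ => hn i)
    · intro x hx y hy hxy α a
      have h1 : dist x y < δ := by
        refine lt_of_le_of_lt ?_ hlt
        refine (dist_pi_le_iff (by positivity)).2 fun i => (dist_pi_le_iff (by positivity)).2 fun j => ?_
        rw [Real.dist_eq]; exact hxy i j
      have h2 := hd x hx y hy h1
      have h3 := (dist_le_pi_dist (G x) (G y) (α, a)).trans h2.le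
      rwa [Real.dist_eq] at h3
  let G' : Xs m (d + 1) → ({α : Finset (Fin m) // α ≠ ∅} × Bool → ℝ) := fun x p => FF ν p.1 p.2 x
  have hG' : ContinuousOn (fun x => ‖G' x‖) (KK c) := ContinuousOn.norm (f := G') (continuousOn_pi.2 fun p => hcont p.1 p.2)
  have hne : (KK c : Set (Xs m (d + 1))).Nonempty := by
    obtain ⟨x, hx, -⟩ := hap (C / 4) (by positivity) (by linarith)
    exact ⟨x, hx⟩
  obtain ⟨x, hx, hmin⟩ := (KK_compact c).exists_isMinOn hne hG'
  have h0 : ‖G' x‖ ≤ 0 := by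
    refine le_of_forall_pos_le_add fun e he => ?_
    obtain ⟨z, hz, hz2⟩ := hap (min (e / 2) (C / 4)) (by positivity) (by
      have := min_le_right (e / 2) (C / 4); linarith)
    have h1 : ‖G' z‖ ≤ e := by
      refine (pi_norm_le_iff_of_nonneg he.le).2 fun p => ?_
      have := hz2 p.1 p.1.2 p.2
      have h3 := min_le_left (e / 2) (C / 4)
      rw [Real.norm_eq_abs]
      exact this.trans (by linarith)
    have h2 : ‖G' x‖ ≤ ‖G' z‖ := hmin hz
    linarith
  refine ⟨x, fun i => KK_ne hc0 hx i, fun α hα a => ?_⟩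
  have := congrFun (norm_le_zero_iff.1 h0) (⟨α, hα⟩, a)
  exact this

end
end GHR

namespace GHR
section
variable {m d : ℕ}

lemma equi {ν : Measure (Fin d → ℝ)} (hν : IsMass ν) (x : Xs m (d + 1)) (hx : ∀ i, x i ≠ 0)
    (h0 : ∀ α, α ≠ ∅ → ∫ y, spr α x y ∂ν = 0) : Equiparts (fun t => aff (x t)) ν := by
  classical
  have := hν.1
  intro ε
  set O := {y | ∀ t, if ε t then 0 < aff (x t) y else aff (x t) y < 0} with hO
  have hOm : MeasurableSet O := by
    have : O = ⋂ t, {y | if ε t then 0 < aff (x t) y else aff (x t) y < 0} := by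
      ext y; simp [hO]
    rw [this]
    refine MeasurableSet.iInter fun t => ?_
    split_ifs
    · exact measurableSet_lt measurable_const (aff_cont_y _).measurable
    · exact measurableSet_lt (aff_cont_y _).measurable measurable_const
  let σ : Fin m → ℝ := fun i => if ε i then 1 else -1
  have hpt : ∀ᵐ y ∂ν, O.indicator (fun _ => (1 : ℝ)) y = (∑ α : Finset (Fin m), (∏ i ∈ α, σ i) * spr α x y) / 2 ^ m := by
    have h1 : ∀ᵐ y ∂ν, ∀ i, aff (x i) y ≠ 0 := ae_all_iff.2 fun i => aff_null hν (hx i)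
    filter_upwards [h1] with y hy
    have h2 : ∑ α : Finset (Fin m), (∏ i ∈ α, σ i) * spr α x y = ∏ i, (1 + σ i * Real.sign (aff (x i) y)) := by
      rw [Finset.prod_one_add, Finset.powerset_univ]
      refine Finset.sum_congr rfl fun α _ => ?_
      rw [spr, Finset.prod_mul_distrib]
    rw [h2]
    by_cases hyO : y ∈ O
    · rw [Set.indicator_of_mem hyO]
      have h3 : ∀ i ∈ Finset.univ, 1 + σ i * Real.sign (aff (x i) y) = 2 := by
        intro i _
        have := hyO i
        simp only [σ]
        split_ifs at this ⊢
        · rw [Real.sign_of_pos this]; norm_num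
        · rw [Real.sign_of_neg this]; norm_num
      rw [Finset.prod_congr rfl h3]
      simp
    · rw [Set.indicator_of_notMem hyO]
      have : ∃ t, ¬ (if ε t then 0 < aff (x t) y else aff (x t) y < 0) := by
        by_contra hc
        push Not at hc
        exact hyO hc
      obtain ⟨t, ht⟩ := this
      rw [Finset.prod_eq_zero (Finset.mem_univ t), zero_div]
      simp only [σ]
      split_ifs at ht ⊢
      · rw [Real.sign_of_neg (lt_of_le_of_ne (not_lt.1 ht) (hy t))]; norm_num
      · rw [Real.sign_of_pos (lt_of_le_of_ne (not_lt.1 ht) (hy t).symm)]; norm_num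
  have hreal : (ν O).toReal = (ν Set.univ).toReal / 2 ^ m := by
    have h1 : ∫ y, O.indicator (fun _ => (1 : ℝ)) y ∂ν = (ν O).toReal := by
      rw [integral_indicator hOm]; simp [Measure.real]
    rw [← h1, integral_congr_ae hpt, integral_div, integral_finsetSum]
    · congr 1
      rw [Finset.sum_eq_single ∅]
      · simp [spr, Measure.real]
      · intro α _ hα
        rw [integral_const_mul, h0 α hα, mul_zero]
      · simp
    · intro α _
      exact (pr_int α x).const_mul _
  have hne : ν Set.univ / 2 ^ m ≠ ⊤ := ENNReal.div_ne_top (measure_ne_top _ _) (by simp)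
  rw [← ENNReal.toReal_eq_toReal_iff' (measure_ne_top _ _) hne, hreal, ENNReal.toReal_div]
  simp

lemma lin_ne {ν : Measure (Fin d → ℝ)} (hν : IsMass ν) (h : ν Set.univ ≠ 0) (x : Xs m (d + 1)) (i : Fin m)
    (hx : x i ≠ 0) (h0 : ∫ y, spr {i} x y ∂ν = 0) : (aff (x i)).linear ≠ 0 := by
  have := hν.1
  intro hl
  have h1 : ∀ y, spr {i} x y = Real.sign (x i 0) := by
    intro y; rw [spr, Finset.prod_singleton, aff_lin0 _ hl]
  simp only [h1, integral_const, smul_eq_mul, Measure.real] at h0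
  rcases mul_eq_zero.1 h0 with h2 | h2
  · exact h ((ENNReal.toReal_eq_zero_iff _).1 h2 |>.resolve_right (measure_ne_top _ _))
  · exact aff_lin0_ne _ hx hl (Real.sign_eq_zero_iff.1 h2)

noncomputable def path (θ : ℝ) : Xs 1 (d + 1) := fun _ j =>
  if j = 0 then Real.cos θ else if j = Fin.last d then Real.sin θ else 0

lemma path_ne (hd : 0 < d) (θ : ℝ) (i : Fin 1) : path (d := d) θ i ≠ 0 := by
  intro h
  have h1 : Real.cos θ = 0 := by simpa [path] using congrFun h 0
  have h2 : Real.sin θ = 0 := by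
    have hl : Fin.last d ≠ 0 := by intro h; have := congrArg Fin.val h; simp at this; omega
    simpa [path, hl] using congrFun h (Fin.last d)
  have := Real.sin_sq_add_cos_sq θ
  rw [h1, h2] at this
  norm_num at this

lemma path_cont : Continuous (path (d := d)) := by
  refine continuous_pi fun i => continuous_pi fun j => ?_
  unfold path
  split_ifs <;> fun_prop

lemma path_pi : path (d := d) Real.pi = T 0 (path 0) := by
  ext i j
  rw [T_apply, if_pos (Subsingleton.elim _ _)]
  simp only [path, Pi.neg_apply]
  split_ifs <;> simp

lemma halve {μ : Measure (Fin d → ℝ)} (hμ : IsMass μ) (hd : 0 < d) :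
    ∃ x : Xs 1 (d + 1), x 0 ≠ 0 ∧ ∫ y, spr {0} x y ∂μ = 0 := by
  let g : ℝ → ℝ := fun θ => ∫ y, spr {0} (path (d := d) θ) y ∂μ
  have hg : Continuous g := continuous_iff_continuousAt.2 fun θ =>
    ContinuousAt.comp (f := path (d := d)) (int_cont hμ {0} (path θ) (path_ne hd θ)) path_cont.continuousAt
  have hneg : g Real.pi = - g 0 := by
    have := FF_T (fun _ => μ) {0} true (path (d := d) 0) 0
    rw [← path_pi, if_pos (by simp)] at this
    exact this
  have : (0 : ℝ) ∈ Set.range g := by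
    rcases le_total (g 0) 0 with h | h
    · exact mem_range_of_exists_le_of_exists_ge hg ⟨0, h⟩ ⟨Real.pi, by rw [hneg]; linarith⟩
    · exact mem_range_of_exists_le_of_exists_ge hg ⟨Real.pi, by rw [hneg]; linarith⟩ ⟨0, h⟩
  obtain ⟨θ, hθ⟩ := this
  exact ⟨path θ, path_ne hd θ 0, hθ⟩

lemma mass_restrict {μ : Measure (Fin d → ℝ)} (hμ : IsMass μ) (s : Set (Fin d → ℝ)) : IsMass (μ.restrict s) := by
  have := hμ.1
  refine ⟨inferInstance, fun f hf => ?_⟩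
  exact le_antisymm ((Measure.restrict_apply_le _ _).trans (hμ.2 f hf).le) bot_le

lemma Fin1 : ∀ α : Finset (Fin 1), α ≠ ∅ → α = {0} := by decide

/-- zeros for the two halves give the arrangement -/
lemma final {μ : Measure (Fin d → ℝ)} (hμ : IsMass μ) (hd : 0 < d) (h0 : μ Set.univ ≠ 0)
    (hz : ∀ ν : Bool → Measure (Fin d → ℝ), (∀ a, IsMass (ν a)) → (∀ a, ν a Set.univ ≠ 0) →
      ∃ x : Xs m (d + 1), (∀ i, x i ≠ 0) ∧ ∀ α, α ≠ ∅ → ∀ a, FF ν α a x = 0) :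
    ∃ f : Fin (m + 1) → ((Fin d → ℝ) →ᵃ[ℝ] ℝ), (∀ t, (f t).linear ≠ 0) ∧ Equiparts f μ := by
  have := hμ.1
  obtain ⟨w, hw, hw0⟩ := halve hμ hd
  have hwl := lin_ne hμ h0 w 0 hw hw0
  have hwe := equi hμ w (fun i => by rw [Subsingleton.elim i 0]; exact hw) (fun α hα => by rw [Fin1 α hα]; exact hw0)
  let S : Bool → Set (Fin d → ℝ) := fun a => {y | if a then 0 < aff (w 0) y else aff (w 0) y < 0}
  have hS : ∀ a, μ (S a) = μ Set.univ / 2 := by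
    intro a
    have := hwe (fun _ => a)
    simpa [S] using this
  have hSm : ∀ a, MeasurableSet (S a) := by
    intro a
    simp only [S]
    split_ifs
    · exact measurableSet_lt measurable_const (aff_cont_y _).measurable
    · exact measurableSet_lt (aff_cont_y _).measurable measurable_const
  obtain ⟨x, hx, hx0⟩ := hz (fun a => μ.restrict (S a)) (fun a => mass_restrict hμ _) (fun a => by
    rw [Measure.restrict_apply_univ, hS]
    simp [h0])
  refine ⟨Fin.cons (aff (w 0)) (fun t => aff (x t)), ?_, ?_⟩
  · intro t
    refine Fin.cases ?_ ?_ t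
    · exact hwl
    · intro i
      refine lin_ne (mass_restrict hμ (S true)) ?_ x i (hx i) (hx0 {i} (by simp) true)
      rw [Measure.restrict_apply_univ, hS]
      simp [h0]
  · intro ε
    have h1 := equi (mass_restrict hμ (S (ε 0))) x hx (fun α hα => hx0 α hα (ε 0)) (fun i => ε i.succ)
    rw [Measure.restrict_apply_univ, hS, Measure.restrict_apply' (hSm _)] at h1
    have h2 : {y | ∀ t : Fin (m + 1), if ε t then 0 < (Fin.cons (aff (w 0)) (fun t => aff (x t)) : Fin (m + 1) → ((Fin d → ℝ) →ᵃ[ℝ] ℝ)) t y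
        else (Fin.cons (aff (w 0)) (fun t => aff (x t)) : Fin (m + 1) → ((Fin d → ℝ) →ᵃ[ℝ] ℝ)) t y < 0} =
        {y | ∀ t, if ε (Fin.succ t) then 0 < aff (x t) y else aff (x t) y < 0} ∩ S (ε 0) := by
      ext y
      simp only [Fin.forall_fin_succ, Set.mem_ofPred_eq, Set.mem_inter_iff, Fin.cons_zero, Fin.cons_succ, S]
      exact and_comm
    rw [h2, h1, pow_succ, mul_comm, ENNReal.div_eq_inv_mul, ENNReal.div_eq_inv_mul, ENNReal.div_eq_inv_mul,
      ENNReal.mul_inv (by simp) (by simp)]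
    ring

lemma trivial_case {k : ℕ} {μ : Measure (Fin d → ℝ)} (hd : 0 < d) (h0 : μ Set.univ = 0) :
    ∃ f : Fin k → ((Fin d → ℝ) →ᵃ[ℝ] ℝ), (∀ t, (f t).linear ≠ 0) ∧ Equiparts f μ := by
  refine ⟨fun _ => (LinearMap.proj ⟨0, hd⟩ : (Fin d → ℝ) →ₗ[ℝ] ℝ).toAffineMap, ?_, ?_⟩
  · intro t h
    have := congrArg (fun l => l (Pi.single ⟨0, hd⟩ 1)) h
    simp at this
  · intro ε
    rw [h0, ENNReal.zero_div, ← nonpos_iff_eq_zero, ← h0]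
    exact measure_mono (Set.subset_univ _)

lemma zeros1 (ν : Bool → Measure (Fin 2 → ℝ)) (hν : ∀ a, IsMass (ν a)) :
    ∃ x : Xs 1 (2 + 1), (∀ i, x i ≠ 0) ∧ ∀ α, α ≠ ∅ → ∀ a, FF ν α a x = 0 := by
  refine exists_zero ν hν (fun _ => 2) (by simp) 1 one_pos ?_
  intro c ε η M hη _ H
  exact core1 H rfl

lemma zeros2 {m' : ℕ} (ν : Bool → Measure (Fin (2 ^ (m' + 1) + 1) → ℝ)) (hν : ∀ a, IsMass (ν a))
    (hν0 : ∀ a, ν a Set.univ ≠ 0) :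
    ∃ x : Xs (m' + 2) (2 ^ (m' + 1) + 1 + 1), (∀ i, x i ≠ 0) ∧ ∀ α, α ≠ ∅ → ∀ a, FF ν α a x = 0 := by
  have := (hν false).1
  have hC : 0 < (ν false Set.univ).toReal := ENNReal.toReal_pos (hν0 _) (measure_ne_top _ _)
  have h01 : (0 : Fin (m' + 2)) ≠ 1 := by simp
  refine exists_zero ν hν (pt (2 ^ (m' + 1) + 1) (2 ^ (m' + 1) + 1)) ?_ _ hC ?_
  · intro i
    unfold pt
    split_ifs
    · omega
    · omega
    · have : 2 ^ i.val ≤ 2 ^ (m' + 1) := Nat.pow_le_pow_right (by norm_num) (by omega)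
      omega
  · intro c ε η M hη hηC H
    refine core H h01 (by simp [pt]) (by simp [pt]) _ hηC hη ?_ ?_ ?_
    · intro x hx h
      exact FF_diag1 hν h01 false x (fun i => KK_ne H.hc hx i) h
    · intro x hx h
      exact FF_diag2 hν h01 false x (fun i => KK_ne H.hc hx i) h
    · intro P hP
      have h2 : dec (pt (m' := m') (2 ^ (m' + 1) + 1) (2 ^ (m' + 1) + 1)) 0 = pt (2 ^ (m' + 1)) (2 ^ (m' + 1) + 1) := by
        ext k; simp only [dec, Function.update_apply, pt]; split_ifs <;> simp_all
      rw [h2]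
      exact poly_final P hP

end
end GHR

/-- For `k ≥ 2` and `d = 2^(k-2) + 1`, any mass on `ℝ^d` is equiparted by some
arrangement of `k` affine hyperplanes. -/
theorem GHR_upper_bound_one_mass (k : ℕ) (hk : 2 ≤ k)
    (μ : Measure (Fin (2 ^ (k - 2) + 1) → ℝ)) (hμ : IsMass μ) :
    ∃ f : Fin k → ((Fin (2 ^ (k - 2) + 1) → ℝ) →ᵃ[ℝ] ℝ),
      (∀ t, (f t).linear ≠ 0) ∧ Equiparts f μ := by
  by_cases h0 : μ Set.univ = 0
  · exact GHR.trivial_case (Nat.succ_pos _) h0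
  obtain ⟨j, rfl⟩ := Nat.exists_eq_add_of_le' hk
  change Measure (Fin (2 ^ j + 1) → ℝ) at μ
  cases j with
  | zero => exact GHR.final (m := 1) hμ (Nat.succ_pos _) h0 fun ν hν _ => GHR.zeros1 ν hν
  | succ j => exact GHR.final (m := j + 2) hμ (Nat.succ_pos _) h0 fun ν hν hν0 => GHR.zeros2 ν hν hν0
end

section
/- Let k ≥ 2, n ≥ 0 and 0 ≤ r < 2^n be integers. Then I(2^n + r, k) = 2^{n+k−1} + r. -/
/-- The predecessor-endpoint of the `i`-th consecutive pair in a sequence of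
length `2 ^ k`. -/
def finLo (k : ℕ) (i : Fin (2 ^ k - 1)) : Fin (2 ^ k) :=
  ⟨i.val, by have h := i.isLt; have h2 : 0 < 2 ^ k := pow_pos (by norm_num) k; omega⟩

/-- The successor-endpoint of the `i`-th consecutive pair in a sequence of
length `2 ^ k`. -/
def finHi (k : ℕ) (i : Fin (2 ^ k - 1)) : Fin (2 ^ k) :=
  ⟨i.val + 1, by have h := i.isLt; have h2 : 0 < 2 ^ k := pow_pos (by norm_num) k; omega⟩

/-- A `k`-bit Gray code: a sequence of `2 ^ k` vectors in `{0,1}^k` in which every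
vector occurs exactly once and consecutive vectors differ in exactly one coordinate. -/
def IsGrayCode (k : ℕ) (g : Fin (2 ^ k) → Fin k → Bool) : Prop :=
  Function.Bijective g ∧
    ∀ i : Fin (2 ^ k - 1), ∃! t : Fin k, g (finLo k i) t ≠ g (finHi k i) t

/-- `D` is the delta sequence of `g`: for each `i`, `D i` is the unique coordinate in
which the `i`-th and `(i+1)`-st vector differ. -/
def IsDeltaOf (k : ℕ) (g : Fin (2 ^ k) → Fin k → Bool)
    (D : Fin (2 ^ k - 1) → Fin k) : Prop :=
  ∀ (i : Fin (2 ^ k - 1)) (t : Fin k), (g (finLo k i) t ≠ g (finHi k i) t) ↔ t = D i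

/-- A `k`-bit delta sequence: the delta sequence of some `k`-bit Gray code. -/
def IsDeltaSequence (k : ℕ) (D : Fin (2 ^ k - 1) → Fin k) : Prop :=
  ∃ g, IsGrayCode k g ∧ IsDeltaOf k g D

/-- Transition counts of a sequence over `Fin k`: the number of occurrences of each symbol. -/
def transCount {m k : ℕ} (D : Fin m → Fin k) (t : Fin k) : ℕ :=
  (Finset.univ.filter fun i => D i = t).card

/-- Transition counts of a Gray code: the number of consecutive pairs differing in
coordinate `t`. -/
def grayTransCount (k : ℕ) (g : Fin (2 ^ k) → Fin k → Bool) (t : Fin k) : ℕ :=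
  (Finset.univ.filter fun i : Fin (2 ^ k - 1) => g (finLo k i) t ≠ g (finHi k i) t).card

/-- The standard (reflected binary) `k`-bit Gray code, whose `i`-th vector is the
binary expansion of `i XOR (i / 2)`; coordinate `0` (row 1) changes most often.
This agrees with the inductive definition: the front facet (last coordinate `0`) is
traversed by the standard `(k-1)`-bit Gray code, then the back facet in reverse order. -/
def standardGray (k : ℕ) : Fin (2 ^ k) → Fin k → Bool :=
  fun i t => Nat.testBit (i.val ^^^ (i.val / 2)) t.val

/-- A `(c 0, …, c (k-1))`-equiparting matrix: a `j`-tuple of `k`-bit Gray codes where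
the last column of each Gray code equals the first column of the next, and the sum of
the transition counts equals `c`. -/
def IsEquipartingMatrix (j k : ℕ) (c : Fin k → ℕ)
    (G : Fin j → Fin (2 ^ k) → Fin k → Bool) : Prop :=
  (∀ i, IsGrayCode k (G i)) ∧
    (∀ i : Fin j, ∀ h : i.val + 1 < j,
      G i ⟨2 ^ k - 1, by have h2 : 0 < 2 ^ k := pow_pos (by norm_num) k; omega⟩ =
        G ⟨i.val + 1, h⟩ ⟨0, pow_pos (by norm_num) k⟩) ∧
    ∀ t, (∑ i, grayTransCount k (G i) t) = c t

/-- Two equiparting matrices are isomorphic if they lie in one orbit of `(ℤ/2)^k`,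
acting by simultaneously flipping all bits in selected rows. -/
def EMIso (j k : ℕ) (G G' : Fin j → Fin (2 ^ k) → Fin k → Bool) : Prop :=
  ∃ β : Fin k → Bool, ∀ i m t, G' i m t = xor (β t) (G i m t)

/-- Two equiparting matrices are equivalent if they lie in one orbit of
`(ℤ/2)^k ⋊ Stab`, where `Stab` is the stabilizer of `c` in `S_k`, acting by flipping
bits in selected rows and permuting rows. -/
def EMEquiv (j k : ℕ) (c : Fin k → ℕ)
    (G G' : Fin j → Fin (2 ^ k) → Fin k → Bool) : Prop :=
  ∃ (β : Fin k → Bool) (τ : Equiv.Perm (Fin k)),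
    (∀ t, c (τ t) = c t) ∧ ∀ i m t, G' i m t = xor (β t) (G i m (τ t))

/-- The number of isomorphism classes of `c`-equiparting matrices. -/
noncomputable def numIsoClasses (j k : ℕ) (c : Fin k → ℕ) : ℕ :=
  Nat.card (Quot fun G G' : {G // IsEquipartingMatrix j k c G} => EMIso j k G.1 G'.1)

/-- The number of equivalence classes of `c`-equiparting matrices. -/
noncomputable def numEquivClasses (j k : ℕ) (c : Fin k → ℕ) : ℕ :=
  Nat.card (Quot fun G G' : {G // IsEquipartingMatrix j k c G} => EMEquiv j k c G.1 G'.1)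


section GrayWords
open MvPolynomial
set_option linter.unusedSectionVars false
variable {α : Type*} [DecidableEq α] [Fintype α]

def GEv (b : List α) : Prop := ∀ t, Even (b.count t)

def GW (S : Finset α) : Set (List α) :=
  {w | w.length = 2 ^ S.card - 1 ∧ (∀ a ∈ w, a ∈ S) ∧ ∀ b, b <:+: w → GEv b → b = []}

theorem gw_finite (S : Finset α) : (GW S).Finite :=
  (List.finite_length_eq α (2 ^ S.card - 1)).subset fun _ h => h.1

theorem infix_split {b x y : List α} {t : α} (h : b <:+: x ++ t :: y) (ht : t ∉ b) :
    b <:+: x ∨ b <:+: y := by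
  obtain ⟨a, c, h⟩ := h
  rw [List.append_assoc, List.append_eq_append_iff] at h
  rcases h with ⟨a', rfl, h⟩ | ⟨c', rfl, h⟩
  · left
    rw [List.append_eq_append_iff] at h
    rcases h with ⟨a'', rfl, h⟩ | ⟨c', rfl, h⟩
    · exact ⟨a, a'', by simp⟩
    · cases c' with
      | nil => exact ⟨a, [], by simp⟩
      | cons z zs => simp at h; exact absurd (by simp [h.1]) ht
  · cases c' with
    | nil =>
      cases b with
      | nil => exact Or.inl List.nil_infix
      | cons z zs => simp at h; exact absurd (by simp [h.1]) ht
    | cons z zs =>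
      right
      simp at h
      exact ⟨zs, c, by simp [h.2]⟩

theorem gw_reverse {S : Finset α} {w : List α} (h : w ∈ GW S) : w.reverse ∈ GW S := by
  refine ⟨by simpa using h.1, by simpa using h.2.1, fun b hb he => ?_⟩
  have := h.2.2 b.reverse (by rw [← List.reverse_infix]; simpa using hb)
    (fun t => by simpa using he t)
  simpa using this

theorem gw_pal {S : Finset α} {u : List α} {t : α} :
    u ++ t :: u.reverse ∈ GW S ↔ t ∈ S ∧ u ∈ GW (S.erase t) := by
  constructor
  · rintro ⟨h1, h2, h3⟩
    have hS : t ∈ S := h2 t (by simp)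
    have htu : t ∉ u := by
      intro hu
      obtain ⟨p, q, rfl⟩ := List.append_of_mem hu
      have := h3 (t :: q ++ t :: q.reverse) ⟨p, t :: p.reverse, by simp⟩ (fun x => by
        simp only [List.count_append, List.count_cons, List.count_reverse]
        exact ⟨_, rfl⟩)
      simp at this
    refine ⟨hS, ?_, ?_, ?_⟩
    · rw [Finset.card_erase_of_mem hS]
      have : 0 < S.card := Finset.card_pos.2 ⟨t, hS⟩
      obtain ⟨c, hc⟩ : ∃ c, S.card = c + 1 := ⟨S.card - 1, by omega⟩
      rw [hc, pow_succ] at h1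
      rw [hc]
      simp at h1 ⊢
      omega
    · intro a ha
      exact Finset.mem_erase.2 ⟨fun h => htu (h ▸ ha), h2 a (by simp [ha])⟩
    · intro b hb
      exact h3 b (hb.trans ⟨[], t :: u.reverse, by simp⟩)
  · rintro ⟨hS, h1, h2, h3⟩
    have htu : t ∉ u := fun h => by simpa using h2 t h
    refine ⟨?_, ?_, ?_⟩
    · rw [Finset.card_erase_of_mem hS] at h1
      have : 0 < S.card := Finset.card_pos.2 ⟨t, hS⟩
      obtain ⟨c, hc⟩ : ∃ c, S.card = c + 1 := ⟨S.card - 1, by omega⟩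
      have := Nat.one_le_two_pow (n := c)
      rw [hc, pow_succ]
      rw [hc] at h1
      simp at h1 ⊢
      omega
    · intro a ha
      simp at ha
      rcases ha with h | rfl | h
      · exact Finset.mem_of_mem_erase (h2 a h)
      · exact hS
      · exact Finset.mem_of_mem_erase (h2 a h)
    · intro b hb he
      have htb : t ∉ b := by
        intro hb'
        have h4 := hb.sublist.count_le t
        have h5 := List.count_pos_iff.2 hb'
        simp [List.count_append, List.count_eq_zero.2 htu] at h4
        have : b.count t = 1 := by omega
        have h6 := he t
        rw [this] at h6
        simp at h6
      rcases infix_split hb htb with h | h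
      · exact h3 b h he
      · have := h3 b.reverse (by rw [← List.reverse_infix]; simpa using h)
          (fun t => by simpa using he t)
        simpa using this

theorem pal_odd {w : List α} (L : ℕ) (hl : w.length = 2 * L + 1) (hw : w.reverse = w) :
    ∃ u t, w = u ++ t :: u.reverse := by
  have h0 := List.take_append_drop L w
  have hd : (w.drop L).length = L + 1 := by simp; omega
  have ht : (w.take L).length = L := by simp; omega
  generalize w.take L = u at *
  generalize w.drop L = d at *
  cases d with
  | nil => simp at hd
  | cons t v =>
    refine ⟨u, t, ?_⟩
    subst h0
    simp at hw
    simp at hd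
    have := List.append_inj hw (by simp [hd, ht])
    rw [← this.1]; simp

noncomputable def gmon (w : List α) : MvPolynomial α (ZMod 2) := (w.map X).prod

noncomputable def GP (S : Finset α) : MvPolynomial α (ZMod 2) :=
  ∑ w ∈ (gw_finite S).toFinset, gmon w

theorem gmon_rev (w : List α) : gmon w.reverse = gmon w := by
  unfold gmon
  exact ((List.reverse_perm w).map _).prod_eq

theorem gmon_pal (u : List α) (t : α) : gmon (u ++ t :: u.reverse) = X t * gmon u ^ 2 := by
  have := gmon_rev u
  unfold gmon at *
  simp only [List.map_append, List.prod_append, List.map_cons, List.prod_cons, this]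
  ring

theorem GP_empty : GP (∅ : Finset α) = 1 := by
  have : (gw_finite (∅ : Finset α)).toFinset = {[]} := by
    ext w
    simp only [Set.Finite.mem_toFinset, Finset.mem_singleton]
    constructor
    · intro h; simpa using h.1
    · rintro rfl
      exact ⟨by simp, by simp, by simp⟩
  simp [GP, this, gmon]

theorem GP_rec (S : Finset α) (hS : S.Nonempty) :
    GP S = ∑ t ∈ S, X t * GP (S.erase t) ^ 2 := by
  unfold GP
  rw [← Finset.sum_filter_add_sum_filter_not _ (fun w : List α => w.reverse = w)]
  have h2 : ∑ w ∈ (gw_finite S).toFinset with ¬ w.reverse = w, gmon w = 0 := by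
    refine Finset.sum_involution (fun w _ => w.reverse) ?_ ?_ ?_ ?_
    · intro w _
      rw [gmon_rev]
      exact CharTwo.add_self_eq_zero _
    · intro w hw _
      simp at hw
      exact hw.2
    · intro w hw
      simp at hw ⊢
      exact ⟨gw_reverse hw.1, fun h => hw.2 h.symm⟩
    · intro w _; simp
  rw [h2, add_zero]
  simp_rw [sum_pow_char 2, Finset.mul_sum]
  rw [Finset.sum_sigma']
  symm
  refine Finset.sum_bij (fun p _ => p.2 ++ p.1 :: p.2.reverse) ?_ ?_ ?_ ?_
  · rintro ⟨t, u⟩ h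
    simp at h
    simpa using gw_pal.2 h
  · rintro ⟨t, u⟩ h ⟨t', u'⟩ h' he
    simp only at he
    have hl : u.length = u'.length := by
      have := congrArg List.length he
      simp at this; omega
    have := List.append_inj he hl
    simp at this
    simp [this]
  · intro w hw
    simp at hw
    have hc : 0 < S.card := Finset.card_pos.2 hS
    obtain ⟨c, hc⟩ : ∃ c, S.card = c + 1 := ⟨S.card - 1, by omega⟩
    have := Nat.one_le_two_pow (n := c)
    obtain ⟨u, t, rfl⟩ := pal_odd (2 ^ c - 1) (by rw [hw.1.1, hc, pow_succ]; omega) hw.2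
    exact ⟨⟨t, u⟩, by simpa using gw_pal.1 hw.1, rfl⟩
  · rintro ⟨t, u⟩ _
    exact (gmon_pal u t).symm

end GrayWords

section GrayAlg
open MvPolynomial
set_option linter.unusedSectionVars false
variable {α : Type*} [DecidableEq α] [Fintype α]

/-- ideal spanned by the `N`-th powers of variables in `U` -/
noncomputable def GJ (U : Finset α) (N : ℕ) : Ideal (MvPolynomial α (ZMod 2)) :=
  Ideal.span {f | ∃ y ∈ U, f = X y ^ N}

theorem GJ_X {U : Finset α} {y : α} (h : y ∈ U) (N : ℕ) : X y ^ N ∈ GJ U N :=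
  Ideal.subset_span ⟨y, h, rfl⟩

theorem GJ_mono {U V : Finset α} (h : U ⊆ V) (N : ℕ) : GJ U N ≤ GJ V N :=
  Ideal.span_mono (by rintro f ⟨y, hy, rfl⟩; exact ⟨y, h hy, rfl⟩)

theorem GJ_sq {U : Finset α} {N : ℕ} {f : MvPolynomial α (ZMod 2)} (h : f ∈ GJ U N) :
    f ^ 2 ∈ GJ U (2 * N) := by
  refine Submodule.span_induction (p := fun f _ => f ^ 2 ∈ GJ U (2 * N)) ?_ ?_ ?_ ?_ h
  · rintro f ⟨y, hy, rfl⟩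
    rw [← pow_mul, mul_comm]
    exact GJ_X hy _
  · simp
  · intro f g _ _ hf hg
    rw [CharTwo.add_sq]
    exact add_mem hf hg
  · intro a f _ hf
    rw [smul_eq_mul, mul_pow]
    exact Ideal.mul_mem_left _ _ hf

theorem GJ_pow {U : Finset α} {N : ℕ} {f : MvPolynomial α (ZMod 2)} (h : f ∈ GJ U N) (n : ℕ) :
    f ^ 2 ^ n ∈ GJ U (2 ^ n * N) := by
  induction n with
  | zero => simpa using h
  | succ n ih =>
    have := GJ_sq ih
    rw [← pow_mul, ← pow_succ, ← mul_assoc, ← pow_succ'] at this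
    exact this

theorem GJ_mul {U : Finset α} {N r : ℕ} {f g : MvPolynomial α (ZMod 2)} (h : f ∈ GJ U N)
    (hg : ∀ y ∈ U, X y ^ r ∣ g) : f * g ∈ GJ U (N + r) := by
  refine Submodule.span_induction (p := fun f _ => f * g ∈ GJ U (N + r)) ?_ ?_ ?_ ?_ h
  · rintro f ⟨y, hy, rfl⟩
    obtain ⟨q, hq⟩ := hg y hy
    rw [hq, ← mul_assoc, ← pow_add]
    exact Ideal.mul_mem_right _ _ (GJ_X hy _)
  · simp
  · intro f g _ _ hf hg
    rw [add_mul]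
    exact add_mem hf hg
  · intro a f _ hf
    rw [smul_eq_mul, mul_assoc]
    exact Ideal.mul_mem_left _ _ hf

theorem GJ_coeff {U : Finset α} {N : ℕ} {f : MvPolynomial α (ZMod 2)} (h : f ∈ GJ U N)
    (m : α →₀ ℕ) (hm : ∀ y ∈ U, m y < N) : coeff m f = 0 := by
  refine Submodule.span_induction (p := fun f _ => ∀ m : α →₀ ℕ, (∀ y ∈ U, m y < N) →
    coeff m f = 0) ?_ ?_ ?_ ?_ h m hm
  · rintro f ⟨y, hy, rfl⟩ m hm
    rw [coeff_X_pow, if_neg]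
    rintro rfl
    have := hm y hy
    simp at this
  · simp
  · intro f g _ _ hf hg m hm
    rw [coeff_add, hf m hm, hg m hm, add_zero]
  · intro a f _ hf m hm
    rw [smul_eq_mul, coeff_mul]
    refine Finset.sum_eq_zero fun p hp => ?_
    rw [Finset.HasAntidiagonal.mem_antidiagonal] at hp
    rw [hf p.2 (fun y hy => lt_of_le_of_lt (by rw [← hp]; simp) (hm y hy)), mul_zero]

theorem GP_dvd (S : Finset α) : ∀ s ∈ S, X s ∣ GP S := by
  induction S using Finset.strongInduction with
  | H S ih =>
    intro s hs
    rw [GP_rec S ⟨s, hs⟩]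
    refine Finset.dvd_sum fun t ht => ?_
    by_cases h : t = s
    · subst h; exact dvd_mul_right _ _
    · refine Dvd.dvd.mul_left (dvd_pow (ih _ (Finset.erase_ssubset ht) s ?_) two_ne_zero) _
      exact Finset.mem_erase.2 ⟨fun h' => h h'.symm, hs⟩

theorem GP_low (S : Finset α) (t : α) (ht : t ∈ S) :
    ∃ Q, GP S = X t * (GP (S.erase t) ^ 2 + X t * Q) := by
  have : X t * X t ∣ ∑ s ∈ S.erase t, X s * GP (S.erase s) ^ 2 := by
    refine Finset.dvd_sum fun s hs => ?_
    rw [← pow_two]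
    refine Dvd.dvd.mul_left (pow_dvd_pow_of_dvd (GP_dvd _ t ?_) 2) _
    exact Finset.mem_erase.2 ⟨fun h => by simp [h] at hs, ht⟩
  obtain ⟨Q, hQ⟩ := this
  refine ⟨Q, ?_⟩
  rw [GP_rec S ⟨t, ht⟩, ← Finset.add_sum_erase _ _ ht, hQ]
  ring

theorem GP_low_pow (S : Finset α) (t : α) (ht : t ∈ S) (r : ℕ) :
    ∃ Q, GP S ^ r = X t ^ r * (GP (S.erase t) ^ (2 * r) + X t * Q) := by
  obtain ⟨Q, hQ⟩ := GP_low S t ht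
  have : X t ∣ (GP (S.erase t) ^ 2 + X t * Q) ^ r - (GP (S.erase t) ^ 2) ^ r :=
    dvd_trans ⟨Q, by ring⟩ (sub_dvd_pow_sub_pow _ _ r)
  obtain ⟨Q', hQ'⟩ := this
  refine ⟨Q', ?_⟩
  rw [hQ, mul_pow, pow_mul, ← hQ']
  ring

theorem GP_mem (c : ℕ) : ∀ S : Finset α, S.card = c + 1 → GP S ∈ GJ S (2 ^ c) := by
  induction c with
  | zero =>
    intro S hS
    obtain ⟨t, rfl⟩ := Finset.card_eq_one.1 hS
    rw [GP_rec _ (by simp)]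
    simpa [GP_empty] using GJ_X (Finset.mem_singleton_self t) 1
  | succ c ih =>
    intro S hS
    rw [GP_rec S (Finset.card_pos.1 (by omega))]
    refine sum_mem fun t ht => Ideal.mul_mem_left _ _ ?_
    rw [pow_succ']
    exact GJ_mono (Finset.erase_subset _ _) _
      (GJ_sq (ih _ (by rw [Finset.card_erase_of_mem ht]; omega)))

theorem GP_top (c : ℕ) : ∀ (S : Finset α) (t : α), t ∈ S → S.card = c + 1 →
    GP S - X t ^ 2 ^ c * GP (S.erase t) ∈ GJ (S.erase t) (2 ^ c) := by
  induction c with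
  | zero =>
    intro S t ht hS
    obtain ⟨t', rfl⟩ := Finset.card_eq_one.1 hS
    simp at ht
    subst ht
    rw [GP_rec _ (by simp)]
    simp [GP_empty]
  | succ c ih =>
    intro S t ht hS
    have hc : (S.erase t).card = c + 1 := by rw [Finset.card_erase_of_mem ht]; omega
    have key : GP S - X t ^ 2 ^ (c + 1) * GP (S.erase t) =
        X t * GP (S.erase t) ^ 2 + ∑ s ∈ S.erase t,
          X s * (GP (S.erase s) - X t ^ 2 ^ c * GP ((S.erase s).erase t)) ^ 2 := by
      rw [GP_rec S ⟨t, ht⟩, ← Finset.add_sum_erase _ _ ht]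
      conv_lhs => rw [GP_rec (S.erase t) (Finset.card_pos.1 (by omega))]
      rw [add_sub_assoc, Finset.mul_sum, ← Finset.sum_sub_distrib]
      rw [← GP_rec (S.erase t) (Finset.card_pos.1 (by omega))]
      congr 1
      refine Finset.sum_congr rfl fun s hs => ?_
      rw [CharTwo.sub_eq_add, CharTwo.sub_eq_add, CharTwo.add_sq, Finset.erase_right_comm,
        pow_succ 2 c, pow_mul]
      ring
    rw [key, pow_succ']
    refine add_mem (Ideal.mul_mem_left _ _ (GJ_sq (GP_mem c _ hc)))
      (sum_mem fun s hs => Ideal.mul_mem_left _ _ ?_)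
    have hs' := Finset.mem_of_mem_erase hs
    have hst : t ∈ S.erase s := Finset.mem_erase.2 ⟨fun h => by simp [h] at hs, ht⟩
    refine GJ_mono ?_ _ (GJ_sq (ih (S.erase s) t hst
      (by rw [Finset.card_erase_of_mem hs']; omega)))
    exact Finset.erase_subset_erase _ (Finset.erase_subset _ _)

theorem GP_lower (c n r : ℕ) (S : Finset α) (hS : S.card = c + 1) :
    GP S ^ (2 ^ n + r) ∈ GJ S (2 ^ (n + c) + r) := by
  rw [pow_add, pow_add]
  exact GJ_mul (GJ_pow (GP_mem c S hS) n) fun y hy => pow_dvd_pow_of_dvd (GP_dvd S y hy) r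

theorem GP_step (c n r : ℕ) (S : Finset α) (t : α) (ht : t ∈ S) (hS : S.card = c + 1)
    (m : α →₀ ℕ) (hm : m t = 0) (hmS : ∀ y ∈ S.erase t, m y < 2 ^ (n + c) + r) :
    coeff (m + Finsupp.single t (2 ^ (n + c) + r)) (GP S ^ (2 ^ n + r)) =
      coeff m (GP (S.erase t) ^ (2 ^ n + 2 * r)) := by
  obtain ⟨Q, hQ⟩ := GP_low_pow S t ht r
  set B := GP S - X t ^ 2 ^ c * GP (S.erase t) with hB
  have hBm : B ^ 2 ^ n * GP S ^ r ∈ GJ (S.erase t) (2 ^ (n + c) + r) := by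
    rw [pow_add 2 n c]
    exact GJ_mul (GJ_pow (GP_top c S t ht hS) n)
      fun y hy => pow_dvd_pow_of_dvd (GP_dvd S y (Finset.mem_of_mem_erase hy)) r
  have hG : GP S ^ (2 ^ n + r) = B ^ 2 ^ n * GP S ^ r +
      (GP (S.erase t) ^ (2 ^ n + 2 * r) + X t * (GP (S.erase t) ^ 2 ^ n * Q)) *
        X t ^ (2 ^ (n + c) + r) := by
    have h1 : GP S = B + X t ^ 2 ^ c * GP (S.erase t) := by rw [hB]; ring
    have h2 : GP S ^ 2 ^ n = B ^ 2 ^ n + (X t ^ 2 ^ c * GP (S.erase t)) ^ 2 ^ n := by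
      conv_lhs => rw [h1]
      rw [add_pow_char_pow]
    rw [pow_add, h2, add_mul]
    congr 1
    rw [hQ, mul_pow, ← pow_mul, pow_add 2 n c, mul_comm (2 ^ c)]
    ring
  rw [hG, coeff_add, GJ_coeff hBm, zero_add, X_pow_eq_monomial, coeff_mul_monomial, mul_one,
    coeff_add, mul_comm (X t), coeff_mul_X', if_neg, add_zero]
  · simp [hm]
  · intro y hy
    have := hmS y hy
    have hne : t ≠ y := fun h => by simp [h] at hy
    simpa [Finsupp.single_apply, hne] using this

theorem GP_upper (c : ℕ) : ∀ (S : Finset α) (n r : ℕ), S.card = c → r < 2 ^ n →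
    ∃ m : α →₀ ℕ, (∀ y, y ∉ S → m y = 0) ∧ coeff m (GP S ^ (2 ^ n + r)) ≠ 0 ∧
      ∀ y ∈ S, m y ≤ 2 ^ (n + c - 1) + r := by
  induction c with
  | zero =>
    intro S n r hS _
    obtain rfl := Finset.card_eq_zero.1 hS
    exact ⟨0, by simp, by simp [GP_empty], by simp⟩
  | succ c ih =>
    intro S n r hS hr
    obtain ⟨t, ht⟩ := Finset.card_pos.1 (by omega : 0 < S.card)
    have hc : (S.erase t).card = c := by rw [Finset.card_erase_of_mem ht]; omega
    have : ∃ m : α →₀ ℕ, (∀ y, y ∉ S.erase t → m y = 0) ∧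
        coeff m (GP (S.erase t) ^ (2 ^ n + 2 * r)) ≠ 0 ∧
        ∀ y ∈ S.erase t, m y < 2 ^ (n + c) + r := by
      rcases c with _ | c
      · have : S.erase t = ∅ := Finset.card_eq_zero.1 hc
        rw [this]
        exact ⟨0, by simp, by simp [GP_empty], by simp⟩
      · by_cases h : 2 * r < 2 ^ n
        · obtain ⟨m, h1, h2, h3⟩ := ih (S.erase t) n (2 * r) hc h
          refine ⟨m, h1, h2, fun y hy => lt_of_le_of_lt (h3 y hy) ?_⟩
          have e1 : n + (c + 1) - 1 = n + c := by omega
          have e2 : 2 ^ n ≤ 2 ^ (n + c) := Nat.pow_le_pow_right (by omega) (by omega)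
          rw [e1, ← add_assoc, pow_succ]
          omega
        · obtain ⟨m, h1, h2, h3⟩ := ih (S.erase t) (n + 1) (2 * r - 2 ^ n) hc
            (by rw [pow_succ]; omega)
          have e0 : 2 ^ (n + 1) + (2 * r - 2 ^ n) = 2 ^ n + 2 * r := by rw [pow_succ]; omega
          rw [e0] at h2
          refine ⟨m, h1, h2, fun y hy => lt_of_le_of_lt (h3 y hy) ?_⟩
          have e1 : n + 1 + (c + 1) - 1 = n + (c + 1) := by omega
          rw [e1]
          omega
    obtain ⟨m, h1, h2, h3⟩ := this
    refine ⟨m + Finsupp.single t (2 ^ (n + c) + r), ?_, ?_, ?_⟩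
    · intro y hy
      have hne : t ≠ y := fun h => hy (h ▸ ht)
      simp [Finsupp.single_apply, hne, h1 y (fun h => hy (Finset.mem_of_mem_erase h))]
    · rw [GP_step c n r S t ht hS m (h1 t (by simp)) h3]
      exact h2
    · intro y hy
      have e : n + (c + 1) - 1 = n + c := by omega
      rw [e]
      by_cases hne : t = y
      · subst hne
        simp [h1 t (by simp)]
      · have := h3 y (Finset.mem_erase.2 ⟨fun h => hne h.symm, hy⟩)
        simp [Finsupp.single_apply, hne]
        omega

end GrayAlg

section GrayLink
open MvPolynomial

theorem gmon_eq {α : Type*} [DecidableEq α] (w : List α) :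
    gmon w = monomial (Multiset.toFinsupp (w : Multiset α)) (1 : ZMod 2) := by
  induction w with
  | nil => simp [gmon]
  | cons a w ih =>
    have h1 : gmon (a :: w) = X a * gmon w := by simp [gmon]
    rw [h1, ih, X, monomial_mul, mul_one, ← Multiset.cons_coe, ← Multiset.singleton_add,
      Multiset.toFinsupp_add, Multiset.toFinsupp_singleton]

noncomputable def gtuples (j k : ℕ) (c : Fin k → ℕ) : Finset (Fin j → List (Fin k)) :=
  (Fintype.piFinset (fun _ : Fin j => (gw_finite (Finset.univ : Finset (Fin k))).toFinset)).filter
    fun ws => ∀ t, ∑ i, (ws i).count t = c t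

theorem coeff_GP (j k : ℕ) (m : Fin k →₀ ℕ) :
    coeff m (GP (Finset.univ : Finset (Fin k)) ^ j) = ((gtuples j k m).card : ZMod 2) := by
  have : GP (Finset.univ : Finset (Fin k)) ^ j =
      ∏ _i : Fin j, GP (Finset.univ : Finset (Fin k)) := by simp
  rw [this]
  unfold GP
  rw [Finset.prod_univ_sum, coeff_sum, gtuples, Finset.card_filter, Nat.cast_sum]
  refine Finset.sum_congr rfl fun ws _ => ?_
  simp_rw [gmon_eq]
  rw [← monomial_sum_one, coeff_monomial]
  have : (∑ i, Multiset.toFinsupp (ws i : Multiset (Fin k)) = m) ↔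
      ∀ t, ∑ i, (ws i).count t = m t := by
    rw [Finsupp.ext_iff]
    simp [Finsupp.finset_sum_apply]
  simp [this]

def gpar {k : ℕ} (l : List (Fin k)) (t : Fin k) : Bool := decide (Odd (l.count t))

theorem gpar_append {k : ℕ} (l l' : List (Fin k)) (t : Fin k) :
    gpar (l ++ l') t = xor (gpar l t) (gpar l' t) := by
  simp only [gpar, List.count_append, Nat.odd_add']
  by_cases h : Odd (l.count t) <;> by_cases h' : Odd (l'.count t) <;> simp [h, h'] <;> grind

theorem gpar_single {k : ℕ} (a t : Fin k) : gpar [a] t = decide (t = a) := by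
  by_cases h : t = a
  · subst h; simp [gpar]
  · simp [gpar, h, List.count_singleton]
    grind

def gOf {k : ℕ} (v : Fin k → Bool) (w : List (Fin k)) : Fin (2 ^ k) → Fin k → Bool :=
  fun m t => xor (v t) (gpar (w.take m) t)

theorem gOf_step {k : ℕ} (v : Fin k → Bool) (w : List (Fin k)) (hw : w.length = 2 ^ k - 1)
    (i : Fin (2 ^ k - 1)) (t : Fin k) :
    gOf v w (finLo k i) t ≠ gOf v w (finHi k i) t ↔ t = w[i.val]'(by rw [hw]; exact i.2) := by
  have hi : i.val < w.length := by rw [hw]; exact i.2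
  simp only [gOf, finLo, finHi]
  rw [List.take_add_one, List.getElem?_eq_getElem hi, Option.toList_some, gpar_append, gpar_single]
  by_cases h : t = w[i.val] <;> simp [h]

theorem gOf_count {k : ℕ} (v : Fin k → Bool) (w : List (Fin k)) (hw : w.length = 2 ^ k - 1)
    (t : Fin k) : grayTransCount k (gOf v w) t = w.count t := by
  unfold grayTransCount
  simp_rw [gOf_step v w hw]
  have h : List.ofFn (fun i : Fin (2 ^ k - 1) => w[i.val]'(by rw [hw]; exact i.2)) = w := by
    apply List.ext_getElem
    · simp [hw]
    · intro n h1 h2; simp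
  conv_rhs => rw [← h, ← Multiset.coe_count, ← Fin.univ_val_map, Multiset.count_map]
  rfl

theorem gpar_ev {k : ℕ} (b : List (Fin k)) : (∀ t, gpar b t = false) ↔ GEv b := by
  simp [gpar, GEv]

theorem gOf_inj {k : ℕ} (v : Fin k → Bool) (w : List (Fin k)) (hw : w.length = 2 ^ k - 1) :
    Function.Injective (gOf v w) ↔ ∀ b, b <:+: w → GEv b → b = [] := by
  have h2 : 0 < 2 ^ k := by positivity
  constructor
  · rintro h b ⟨a, c, rfl⟩ he
    simp at hw
    have := @h ⟨a.length, by omega⟩ ⟨a.length + b.length, by omega⟩ (by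
      funext t
      have e1 : (a ++ b ++ c).take a.length = a := by simp
      have e2 : (a ++ b ++ c).take (a.length + b.length) = a ++ b := by
        rw [← List.length_append, List.take_left]
      simp only [gOf]
      rw [e1, e2, gpar_append, (gpar_ev b).2 he t, Bool.xor_false])
    simp at this
    exact this
  · intro h
    have key : ∀ p q : Fin (2 ^ k), p < q → gOf v w p ≠ gOf v w q := by
      intro p q hpq he
      have hp := p.2
      have hq := q.2
      have hpq' : p.val < q.val := hpq
      obtain ⟨d, hd⟩ : ∃ d, q.val = p.val + d := ⟨q.val - p.val, by omega⟩
      have hb := h ((w.drop p).take d)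
        ((List.take_prefix _ _).isInfix.trans (List.drop_suffix _ _).isInfix)
        ((gpar_ev _).1 fun t => by
          have := congrFun he t
          simp only [gOf] at this
          rw [hd, List.take_add, gpar_append] at this
          revert this
          generalize gpar _ t = x
          generalize gpar _ t = y
          cases x <;> cases y <;> cases v t <;> simp)
      have := congrArg List.length hb
      simp at this
      omega
    intro p q he
    rcases lt_trichotomy p q with h | h | h
    · exact absurd he (key p q h)
    · exact h
    · exact absurd he.symm (key q p h)

theorem gOf_gray {k : ℕ} (v : Fin k → Bool) (w : List (Fin k))
    (hw : w ∈ GW (Finset.univ : Finset (Fin k))) : IsGrayCode k (gOf v w) := by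
  obtain ⟨h1, _, h3⟩ := hw
  simp at h1
  refine ⟨?_, fun i => ?_⟩
  · rw [Fintype.bijective_iff_injective_and_card]
    exact ⟨(gOf_inj v w h1).2 h3, by simp⟩
  · refine ⟨w[i.val]'(by rw [h1]; exact i.2), (gOf_step v w h1 i _).2 rfl, fun t ht => ?_⟩
    exact (gOf_step v w h1 i t).1 ht

theorem gray_gOf {k : ℕ} (g : Fin (2 ^ k) → Fin k → Bool) (hg : IsGrayCode k g) :
    ∃ w ∈ GW (Finset.univ : Finset (Fin k)), g = gOf (g ⟨0, pow_pos (by norm_num) k⟩) w := by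
  obtain ⟨hb, hs⟩ := hg
  choose D hD hD' using hs
  have hlen : (List.ofFn D).length = 2 ^ k - 1 := by simp
  have heq : g = gOf (g ⟨0, pow_pos (by norm_num) k⟩) (List.ofFn D) := by
    have : ∀ (m : ℕ) (hm : m < 2 ^ k) (t : Fin k),
        g ⟨m, hm⟩ t = gOf (g ⟨0, pow_pos (by norm_num) k⟩) (List.ofFn D) ⟨m, hm⟩ t := by
      intro m
      induction m with
      | zero => intro hm t; simp [gOf, gpar]
      | succ m ih =>
        intro hm t
        have hi : m < 2 ^ k - 1 := by omega
        have h1 := ih (by omega) t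
        have h2 := gOf_step (g ⟨0, pow_pos (by norm_num) k⟩) (List.ofFn D) hlen ⟨m, hi⟩ t
        have h3 : g (finLo k ⟨m, hi⟩) t ≠ g (finHi k ⟨m, hi⟩) t ↔ t = D ⟨m, hi⟩ :=
          ⟨fun h => hD' ⟨m, hi⟩ t h, fun h => h ▸ hD ⟨m, hi⟩⟩
        simp only [List.getElem_ofFn, finLo, finHi] at h2 h3
        rw [← h3, ← h1] at h2
        revert h2
        generalize g ⟨m + 1, hm⟩ t = a
        generalize g ⟨m, _⟩ t = b
        generalize gOf _ _ _ _ = d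
        cases a <;> cases b <;> cases d <;> simp
    funext m t
    exact this m.1 m.2 t
  refine ⟨List.ofFn D, ⟨by simp, by simp, ?_⟩, heq⟩
  refine (gOf_inj (g ⟨0, pow_pos (by norm_num) k⟩) _ hlen).1 ?_
  rw [← heq]
  exact hb.1

def gstart {k : ℕ} (ws : ℕ → List (Fin k)) : ℕ → Fin k → Bool
  | 0 => fun _ => false
  | n + 1 => fun t => xor (gstart ws n t) (gpar (ws n) t)

def gext {j k : ℕ} (ws : Fin j → List (Fin k)) (n : ℕ) : List (Fin k) :=
  if h : n < j then ws ⟨n, h⟩ else []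

def gmat {j k : ℕ} (ws : Fin j → List (Fin k)) : Fin j → Fin (2 ^ k) → Fin k → Bool :=
  fun i => gOf (gstart (gext ws) i) (ws i)

theorem mem_gtuples {j k : ℕ} {c : Fin k → ℕ} {ws : Fin j → List (Fin k)} :
    ws ∈ gtuples j k c ↔ (∀ i, ws i ∈ GW (Finset.univ : Finset (Fin k))) ∧
      ∀ t, ∑ i, (ws i).count t = c t := by
  simp [gtuples]

theorem gmat_equi {j k : ℕ} {c : Fin k → ℕ} {ws : Fin j → List (Fin k)}
    (h : ws ∈ gtuples j k c) : IsEquipartingMatrix j k c (gmat ws) := by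
  rw [mem_gtuples] at h
  have hl : ∀ i, (ws i).length = 2 ^ k - 1 := fun i => by simpa using (h.1 i).1
  refine ⟨fun i => gOf_gray _ _ (h.1 i), fun i hi => ?_, fun t => ?_⟩
  · funext t
    have : (ws i).take (2 ^ k - 1) = ws i := by rw [← hl i, List.take_length]
    simp only [gmat, gOf, this, List.take_zero, gstart]
    simp [gext, gpar]
  · rw [← h.2 t]
    exact Finset.sum_congr rfl fun i _ => gOf_count _ _ (hl i) t

theorem gmat_inj {j k : ℕ} {c : Fin k → ℕ} {ws ws' : Fin j → List (Fin k)}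
    (h : ws ∈ gtuples j k c) (h' : ws' ∈ gtuples j k c) (he : EMIso j k (gmat ws) (gmat ws')) :
    ws = ws' := by
  rw [mem_gtuples] at h h'
  obtain ⟨β, hβ⟩ := he
  funext i
  have hl : (ws i).length = 2 ^ k - 1 := by simpa using (h.1 i).1
  have hl' : (ws' i).length = 2 ^ k - 1 := by simpa using (h'.1 i).1
  apply List.ext_getElem (by rw [hl, hl'])
  intro n h1 h2
  have hn : n < 2 ^ k - 1 := by omega
  have e1 := (gOf_step (gstart (gext ws) i) (ws i) hl ⟨n, hn⟩ ((ws i)[n])).2 rfl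
  refine (gOf_step (gstart (gext ws') i) (ws' i) hl' ⟨n, hn⟩ ((ws i)[n])).1 ?_
  have e2 := hβ i (finLo k ⟨n, hn⟩) ((ws i)[n])
  have e3 := hβ i (finHi k ⟨n, hn⟩) ((ws i)[n])
  unfold gmat at e2 e3
  rw [e2, e3]
  intro e
  exact e1 (by simpa using e)

theorem gmat_surj {j k : ℕ} {c : Fin k → ℕ} {G : Fin j → Fin (2 ^ k) → Fin k → Bool}
    (hG : IsEquipartingMatrix j k c G) : ∃ ws ∈ gtuples j k c, EMIso j k (gmat ws) G := by
  obtain ⟨h1, h2, h3⟩ := hG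
  choose ws hws heq using fun i => gray_gOf (G i) (h1 i)
  have hl : ∀ i, (ws i).length = 2 ^ k - 1 := fun i => by simpa using (hws i).1
  refine ⟨ws, mem_gtuples.2 ⟨hws, fun t => ?_⟩, ?_⟩
  · rw [← h3 t]
    refine Finset.sum_congr rfl fun i _ => ?_
    rw [heq i, gOf_count _ _ (hl i)]
  · refine ⟨fun t => if h : 0 < j then G ⟨0, h⟩ ⟨0, pow_pos (by norm_num) k⟩ t else false, ?_⟩
    intro i m t
    have hj : 0 < j := by have := i.2; omega
    simp only [hj, dite_true]
    have key : ∀ (n : ℕ) (hn : n < j), G ⟨n, hn⟩ ⟨0, pow_pos (by norm_num) k⟩ t =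
        xor (G ⟨0, hj⟩ ⟨0, pow_pos (by norm_num) k⟩ t) (gstart (gext ws) n t) := by
      intro n
      induction n with
      | zero => intro hn; simp [gstart]
      | succ n ih =>
        intro hn
        have hn' : n < j := by omega
        rw [← h2 ⟨n, hn'⟩ hn, heq ⟨n, hn'⟩]
        have : (ws ⟨n, hn'⟩).take (2 ^ k - 1) = ws ⟨n, hn'⟩ := by
          rw [← hl ⟨n, hn'⟩, List.take_length]
        simp only [gOf, this, gstart]
        rw [ih hn']
        simp [gext, hn']
    conv_lhs => rw [heq i]
    simp only [gmat, gOf]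
    rw [key i.1 i.2, Bool.xor_assoc]

theorem EMIso_equiv {j k : ℕ} : Equivalence (EMIso j k) where
  refl G := ⟨fun _ => false, by simp⟩
  symm := by
    rintro G G' ⟨β, h⟩
    exact ⟨β, fun i m t => by rw [h]; simp [← Bool.xor_assoc]⟩
  trans := by
    rintro G G' G'' ⟨β, h⟩ ⟨γ, h'⟩
    exact ⟨fun t => xor (γ t) (β t), fun i m t => by rw [h', h, Bool.xor_assoc]⟩

theorem num_eq (j k : ℕ) (c : Fin k → ℕ) : numIsoClasses j k c = (gtuples j k c).card := by
  unfold numIsoClasses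
  rw [← Fintype.card_coe, ← Nat.card_eq_fintype_card]
  symm
  refine Nat.card_eq_of_bijective (fun ws : gtuples j k c =>
    Quot.mk _ ⟨gmat ws.1, gmat_equi ws.2⟩) ⟨?_, ?_⟩
  · rintro ⟨ws, h⟩ ⟨ws', h'⟩ he
    have hE : Equivalence (fun G G' : {G // IsEquipartingMatrix j k c G} =>
        EMIso j k G.1 G'.1) :=
      ⟨fun G => EMIso_equiv.refl _, fun h => EMIso_equiv.symm h,
        fun h h' => EMIso_equiv.trans h h'⟩
    have := (Quot.eqvGen_exact he)
    rw [hE.eqvGen_iff] at this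
    exact Subtype.ext (gmat_inj h h' this)
  · rintro ⟨G, hG⟩
    obtain ⟨ws, h, hi⟩ := gmat_surj hG
    exact ⟨⟨ws, h⟩, Quot.sound hi⟩

theorem odd_iff_coeff (j k : ℕ) (m : Fin k →₀ ℕ) :
    Odd (numIsoClasses j k m) ↔ coeff m (GP (Finset.univ : Finset (Fin k)) ^ j) ≠ 0 := by
  rw [num_eq, coeff_GP, ZMod.natCast_ne_zero_iff_odd]

theorem sum_of_odd {j k : ℕ} {c : Fin k → ℕ} (h : Odd (numIsoClasses j k c)) :
    ∑ t, c t = j * (2 ^ k - 1) := by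
  rw [num_eq] at h
  obtain ⟨ws, hws⟩ := Finset.card_pos.1 h.pos
  rw [mem_gtuples] at hws
  simp_rw [← hws.2]
  rw [Finset.sum_comm]
  have : ∀ i, ∑ t, (ws i).count t = 2 ^ k - 1 := fun i => by
    have h1 : (ws i).length = 2 ^ k - 1 := by simpa using (hws.1 i).1
    rw [← h1]
    have := Multiset.sum_count_eq_card (s := Finset.univ) (m := (ws i : Multiset (Fin k)))
      (by simp)
    simpa using this
  simp [this]

end GrayLink

/-- `I(2^n + r, k) = 2^(n+k-1) + r` for `0 ≤ r < 2^n`: the least value of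
`max (c 0, …, c (k-1))` over all tuples `c` of nonnegative integers with
`∑ c = j (2^k - 1)` for which the number of isomorphism classes of
`c`-equiparting matrices is odd. -/
theorem I_value (k n r : ℕ) (hk : 2 ≤ k) (hr : r < 2 ^ n) :
    IsLeast {M : ℕ | ∃ c : Fin k → ℕ,
        (∑ t, c t) = (2 ^ n + r) * (2 ^ k - 1) ∧
        Odd (numIsoClasses (2 ^ n + r) k c) ∧
        M = Finset.univ.sup c}
      (2 ^ (n + k - 1) + r) := by
  obtain ⟨k', rfl⟩ : ∃ k', k = k' + 1 := ⟨k - 1, by omega⟩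
  have e : n + (k' + 1) - 1 = n + k' := by omega
  have lower : ∀ c : Fin (k' + 1) → ℕ, Odd (numIsoClasses (2 ^ n + r) (k' + 1) c) →
      2 ^ (n + k') + r ≤ Finset.univ.sup c := by
    intro c hc
    have hc' : Odd (numIsoClasses (2 ^ n + r) (k' + 1)
      (Finsupp.equivFunOnFinite.symm c : Fin (k' + 1) →₀ ℕ)) := by simpa using hc
    rw [odd_iff_coeff] at hc'
    by_contra hlt
    push Not at hlt
    refine hc' (GJ_coeff (GP_lower k' n r Finset.univ (by simp)) _ fun y _ => ?_)
    exact lt_of_le_of_lt (Finset.le_sup (f := c) (Finset.mem_univ y)) hlt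
  rw [e]
  constructor
  · obtain ⟨m, _, h2, h3⟩ := GP_upper (k' + 1) (Finset.univ : Finset (Fin (k' + 1))) n r
      (by simp) hr
    rw [← odd_iff_coeff] at h2
    rw [e] at h3
    exact ⟨m, sum_of_odd h2, h2, le_antisymm (lower m h2) (Finset.sup_le fun y hy => h3 y hy)⟩
  · rintro M ⟨c, _, hc, rfl⟩
    exact lower c hc
end
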